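/- Let θ_1 and θ_2 be Lie algebra automorphisms of g, both of order exactly m, such that θ_1 ∘ θ_2^{-1} is inner. Suppose that for each j ∈ {1,2} the grading g = ⊕_i g_i^{(j)} determined by θ_j is S-regular and locally free. Then there exists τ ∈ Int g with θ_1 = τ ∘ θ_2 ∘ τ^{-1}. -/

import Mathlib

open LieAlgebra Module

variable (k : Type*) [Field k] [IsAlgClosed k] [CharZero k]
variable (g : Type*) [LieRing g] [LieAlgebra k g] [FiniteDimensional k g]
  [LieAlgebra.IsSemisimple k g]

/-- The `ζ^i`-eigenspace of the automorphism `θ`, i.e. the graded piece `g_i`. -/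
noncomputable def gradePiece {m : ℕ} (ζ : k) (θ : g ≃ₗ[k] g) (i : ZMod m) : Submodule k g :=
  Module.End.eigenspace (θ : g →ₗ[k] g) (ζ ^ i.val)

/-- The centraliser `z(x) = {y : ⁅x, y⁆ = 0}` of `x`. -/
noncomputable def zc (x : g) : Submodule k g := LinearMap.ker (LieAlgebra.ad k g x)

/-- Truncated exponential of an endomorphism; it agrees with the exponential series for
nilpotent endomorphisms of a finite-dimensional space. -/
noncomputable def expEnd (N : Module.End k g) : Module.End k g :=
  ∑ i ∈ Finset.range (Module.finrank k g + 1), ((i.factorial : k))⁻¹ • N ^ i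

/-- The group `Int g` of inner automorphisms: the subgroup of the automorphism group
generated by `exp (ad n)` for `n` with `ad n` nilpotent. -/
noncomputable def IntG : Subgroup (g ≃ₗ[k] g) :=
  Subgroup.closure {τ | ∃ n : g, IsNilpotent (LieAlgebra.ad k g n) ∧
    (τ : g →ₗ[k] g) = expEnd k g (LieAlgebra.ad k g n)}

/-- A Cartan subspace of `g_1`: a commutative subspace consisting of semisimple elements,
maximal among subspaces of `g_1` with these two properties. -/
def IsCartanSubspace (m : ℕ) (ζ : k) (θ : g ≃ₗ[k] g) (c : Submodule k g) : Prop :=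
  c ≤ gradePiece k g ζ θ (1 : ZMod m) ∧
  (∀ x ∈ c, ∀ y ∈ c, ⁅x, y⁆ = 0) ∧
  (∀ x ∈ c, (LieAlgebra.ad k g x).IsSemisimple) ∧
  ∀ c' : Submodule k g, c' ≤ gradePiece k g ζ θ (1 : ZMod m) →
    (∀ x ∈ c', ∀ y ∈ c', ⁅x, y⁆ = 0) → (∀ x ∈ c', (LieAlgebra.ad k g x).IsSemisimple) →
    c ≤ c' → c = c'

/-- Polynomial functions on `g`: functions arising from the symmetric algebra of `g*`. -/
def IsPolyFun (F : g → k) : Prop :=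
  ∃ p : MvPolynomial (Module.Dual k g) k, ∀ x, F x = MvPolynomial.eval (fun φ => φ x) p

/-- The number `k_i = Σ_{c ∈ ℤ, c ≡ i (mod m)} dim {v ∈ z(e) : ⁅h, v⁆ = 2c • v}`. -/
noncomputable def kNum (m : ℕ) (e h : g) (i : ZMod m) : ℕ :=
  ∑ᶠ c : ℤ, if ((c : ZMod m) = i) then
    Module.finrank k ↥(zc k g e ⊓ Module.End.eigenspace (LieAlgebra.ad k g h) (2 * (c : k)))
  else 0

set_option linter.all false
set_option linter.unusedSimpArgs false
set_option linter.unusedSectionVars false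
namespace CL
section Dom
open MvPolynomial

variable {k : Type*} [Field k] {ι : Type*} [Fintype ι] [DecidableEq ι]

theorem chain_rule (F : ι → MvPolynomial ι k) (P : MvPolynomial ι k) (i : ι) :
    pderiv i (aeval F P) = ∑ j, pderiv i (F j) * aeval F (pderiv j P) := by
  induction P using MvPolynomial.induction_on with
  | C a => simp
  | add p q hp hq => simp only [map_add, hp, hq, mul_add, Finset.sum_add_distrib]
  | mul_X p n hp =>
    simp only [map_mul, aeval_X, pderiv_mul, hp, pderiv_X, map_add, mul_add, Finset.sum_add_distrib,
      Finset.sum_mul]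
    congr 1
    · exact Finset.sum_congr rfl fun j _ => by ring
    · rw [Finset.sum_eq_single n]
      · simp; ring
      · intro b _ hb; simp [Pi.single_apply, hb.symm]
      · simp

theorem degree_pderiv [CharZero k] {P : MvPolynomial ι k} {n : ℕ} (h : P.totalDegree ≤ n + 1) (i : ι) :
    (pderiv i P).totalDegree ≤ n := by
  rw [MvPolynomial.totalDegree, Finset.sup_le_iff] 
  intro m hm
  rw [MvPolynomial.mem_support_iff, coeff_pderiv] at hm
  have h1 : coeff (m + Finsupp.single i 1) P ≠ 0 := fun h0 => hm (by simp [h0])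
  have h2 := le_totalDegree (mem_support_iff.2 h1)
  have h3 : (m + Finsupp.single i 1).sum (fun _ e => e) = m.sum (fun _ e => e) + 1 := by
    rw [Finsupp.sum_add_index'] <;> simp
  omega

theorem aeval_injective [CharZero k] (F : ι → MvPolynomial ι k)
    (hJ : (Matrix.of fun i j => constantCoeff (pderiv i (F j))).det ≠ 0) :
    ∀ n (P : MvPolynomial ι k), P.totalDegree ≤ n → aeval F P = 0 → P = 0 := by
  have hdet : (Matrix.of fun i j => (pderiv i (F j))).det ≠ 0 := by
    intro h0
    apply hJ
    have := congrArg constantCoeff h0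
    rw [RingHom.map_det] at this
    rw [map_zero] at this
    exact this
  intro n
  have key : ∀ P : MvPolynomial ι k, P.totalDegree ≤ 0 → aeval F P = 0 → P = 0 := by
    intro P hP h
    rw [totalDegree_eq_zero_iff_eq_C.1 (Nat.le_zero.1 hP)] at h ⊢
    simpa using h
  induction n with
  | zero => exact key
  | succ n ih =>
    intro P hP h
    have hv : (fun j => aeval F (pderiv j P)) = 0 := by
      apply Matrix.eq_zero_of_mulVec_eq_zero hdet
      ext1 i
      have := chain_rule F P i
      rw [h, map_zero] at this
      simp only [Matrix.mulVec, dotProduct, Matrix.of_apply, Pi.zero_apply]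
      exact this.symm
    have hz : ∀ j, pderiv j P = 0 := fun j => ih _ (degree_pderiv hP j) (congrFun hv j)
    apply key P _ h
    rw [MvPolynomial.totalDegree, Finset.sup_le_iff]
    intro m hm
    by_contra hne
    have : m ≠ 0 := by rintro rfl; simp at hne
    obtain ⟨i, hi⟩ : ∃ i, m i ≠ 0 := by
      by_contra hc; push Not at hc; exact this (Finsupp.ext hc)
    have h1 := congrArg (coeff (m - Finsupp.single i 1)) (hz i)
    rw [coeff_pderiv, tsub_add_cancel_of_le (by simpa using Nat.one_le_iff_ne_zero.2 hi)] at h1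
    simp only [coeff_zero, mul_eq_zero] at h1
    rcases h1 with h1 | h1
    · exact (mem_support_iff.1 hm) h1
    · exact Nat.cast_add_one_ne_zero _ h1

theorem dom [CharZero k] [IsAlgClosed k] (F : ι → MvPolynomial ι k)
    (hJ : (Matrix.of fun i j => constantCoeff (pderiv i (F j))).det ≠ 0) :
    ∃ q : MvPolynomial ι k, q ≠ 0 ∧ ∀ y : ι → k, eval y q ≠ 0 → ∃ x : ι → k, ∀ j, eval x (F j) = y j := by
  let φ : MvPolynomial ι k →ₐ[k] MvPolynomial ι k := aeval F
  have hinj : Function.Injective φ :=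
    (injective_iff_map_eq_zero φ).2 fun P hP => aeval_injective F hJ _ P le_rfl hP
  have hfp : (φ : MvPolynomial ι k →+* MvPolynomial ι k).FinitePresentation := by
    have h1 : (algebraMap k (MvPolynomial ι k)).FinitePresentation := by
      rw [RingHom.finitePresentation_algebraMap]; infer_instance
    have h2 : (algebraMap k (MvPolynomial ι k)).FiniteType := by
      rw [RingHom.finiteType_algebraMap]; infer_instance
    refine RingHom.FinitePresentation.of_comp_finiteType (algebraMap k (MvPolynomial ι k)) ?_ h2
    rw [φ.comp_algebraMap]
    exact h1
  obtain ⟨S, hS⟩ := PrimeSpectrum.exists_constructibleSetData_iff.2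
    (PrimeSpectrum.isConstructible_range_comap hfp)
  have hbot : (⟨⊥, Ideal.isPrime_bot⟩ : PrimeSpectrum (MvPolynomial ι k)) ∈ S.toSet := by
    rw [hS]
    refine ⟨⟨⊥, Ideal.isPrime_bot⟩, ?_⟩
    ext x
    simp [PrimeSpectrum.comap_asIdeal, Ideal.mem_comap]
    exact map_eq_zero_iff φ hinj
  simp only [PrimeSpectrum.ConstructibleSetData.toSet, Set.mem_iUnion] at hbot
  obtain ⟨C, hC, hb⟩ := hbot
  obtain ⟨hb1, hb2⟩ := hb
  have hg : ∀ i, C.g i = 0 := fun i => by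
    have := hb1 (Set.mem_range_self i)
    simpa using this
  refine ⟨C.f, fun h0 => hb2 ?_, ?_⟩
  · simp [PrimeSpectrum.mem_zeroLocus, h0]
  intro y hy
  have hmem : (⟨vanishingIdeal k {y}, inferInstance⟩ : PrimeSpectrum (MvPolynomial ι k)) ∈ S.toSet := by
    simp only [PrimeSpectrum.ConstructibleSetData.toSet, Set.mem_iUnion]
    refine ⟨C, hC, ?_, ?_⟩
    · rintro _ ⟨i, rfl⟩
      rw [hg i]; exact Ideal.zero_mem _
    · intro h
      have := h (Set.mem_singleton _)
      exact hy (by simpa [mem_vanishingIdeal_singleton_iff, aeval_eq_eval] using this)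
  rw [hS] at hmem
  obtain ⟨p, hp⟩ := hmem
  obtain ⟨M, hM, hpM⟩ := Ideal.exists_le_maximal p.asIdeal p.2.ne_top
  obtain ⟨x, rfl⟩ := isMaximal_iff_eq_vanishingIdeal_singleton.1 hM
  refine ⟨x, fun j => ?_⟩
  have h1 : (X j - MvPolynomial.C (y j) : MvPolynomial ι k) ∈ vanishingIdeal k {y} := by
    simp [mem_vanishingIdeal_singleton_iff]
  have h2 : (X j - MvPolynomial.C (y j) : MvPolynomial ι k) ∈ (PrimeSpectrum.comap (φ : MvPolynomial ι k →+* MvPolynomial ι k) p).asIdeal := by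
    rw [hp]; exact h1
  rw [PrimeSpectrum.comap_asIdeal, Ideal.mem_comap] at h2
  have h3 := hpM h2
  rw [mem_vanishingIdeal_singleton_iff] at h3
  simp [φ] at h3
  rw [sub_eq_zero] at h3
  simpa [aeval_eq_eval] using h3

end Dom
end CL

set_option linter.all false
set_option linter.unusedSimpArgs false
set_option linter.unusedSectionVars false
namespace CL
section Basics
open LieAlgebra Module
variable {k : Type*} [Field k] [IsAlgClosed k] [CharZero k]
variable {g : Type*} [LieRing g] [LieAlgebra k g] [FiniteDimensional k g]
  [LieAlgebra.IsSemisimple k g]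

theorem pow_big {N : End k g} (hN : IsNilpotent N) {i : ℕ} (hi : finrank k g ≤ i) : N ^ i = 0 := by
  obtain ⟨j, hj⟩ := hN
  have h2 : N ^ finrank k g = 0 := by
    ext x
    have := Module.End.ker_pow_le_ker_pow_finrank N j (x := x) (by simp [hj])
    simpa using this
  exact pow_eq_zero_of_le hi h2

theorem expEnd_apply {N : End k g} (hN : IsNilpotent N) {v : g} {j : ℕ} (hj : (N ^ j) v = 0) :
    expEnd k g N v = ∑ i ∈ Finset.range j, ((i.factorial : k))⁻¹ • (N ^ i) v := by
  have hz : ∀ i, j ≤ i → (N ^ i) v = 0 := by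
    intro i hi
    obtain ⟨c, rfl⟩ := Nat.exists_eq_add_of_le hi
    rw [add_comm, pow_add, End.mul_apply, hj, map_zero]
  rw [expEnd, LinearMap.sum_apply]
  simp only [LinearMap.smul_apply]
  rcases le_total j (finrank k g + 1) with h | h
  · symm
    apply Finset.sum_subset (by simpa using h)
    intro i _ hi
    rw [hz i (by simpa using hi), smul_zero]
  · apply Finset.sum_subset (by simpa using h)
    intro i _ hi
    rw [pow_big hN (by simp at hi; omega)]; simp

theorem expEnd_eq_exp [Module ℚ (End k g)] {N : End k g} (hN : IsNilpotent N) :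
    expEnd k g N = IsNilpotent.exp N := by
  rw [IsNilpotent.exp_eq_sum (pow_big hN (Nat.le_succ _)), expEnd]
  refine Finset.sum_congr rfl fun i _ => ?_
  have h1 : ((i.factorial : ℚ)) • (((i.factorial : k))⁻¹ • N ^ i) = N ^ i := by
    rw [Nat.cast_smul_eq_nsmul, ← Nat.cast_smul_eq_nsmul k, smul_smul, mul_inv_cancel₀, one_smul]
    exact_mod_cast i.factorial_ne_zero
  have h0 : ((i.factorial : ℚ)) ≠ 0 := by exact_mod_cast i.factorial_ne_zero
  calc _ = ((i.factorial : ℚ))⁻¹ • ((i.factorial : ℚ)) • (((i.factorial : k))⁻¹ • N ^ i) := by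
        rw [smul_smul, inv_mul_cancel₀ h0, one_smul]
    _ = _ := by rw [h1]

variable (k g) in
/-- Lie automorphisms as a subgroup of linear automorphisms. -/
def LA : Subgroup (g ≃ₗ[k] g) where
  carrier := {φ | ∀ x y : g, φ ⁅x, y⁆ = ⁅φ x, φ y⁆}
  mul_mem' := by intro a b ha hb x y; simp only [LinearEquiv.mul_apply]; rw [hb, ha]
  one_mem' := by intro x y; rfl
  inv_mem' := by
    intro a ha x y
    apply a.injective
    have h : ∀ z, a (a⁻¹ z) = z := fun z => a.apply_symm_apply z
    rw [ha, h, h, h]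

@[simp] theorem app_inv (a : g ≃ₗ[k] g) (z : g) : a (a⁻¹ z) = z := a.apply_symm_apply z
@[simp] theorem inv_app (a : g ≃ₗ[k] g) (z : g) : a⁻¹ (a z) = z := a.symm_apply_apply z

theorem LA.map_lie {φ : g ≃ₗ[k] g} (h : φ ∈ LA k g) (x y : g) : φ ⁅x, y⁆ = ⁅φ x, φ y⁆ := h x y

theorem exists_exp (n : g) (hn : IsNilpotent (ad k g n)) :
    ∃ τ ∈ IntG k g, (τ : g →ₗ[k] g) = expEnd k g (ad k g n) ∧ τ ∈ LA k g := by
  letI : Module ℚ g := Module.compHom g (algebraMap ℚ k)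
  have hq : ∀ (t : ℚ) (x y : g), ⁅x, t • y⁆ = t • ⁅x, y⁆ := fun t x y => by
    change ⁅x, (algebraMap ℚ k t) • y⁆ = (algebraMap ℚ k t) • ⁅x, y⁆
    exact lie_smul _ _ _
  letI : LieAlgebra ℚ g := { lie_smul := hq }
  let D : LieDerivation k g g := LieDerivation.ad k g n
  have hD : D.toLinearMap = ad k g n := by
    ext x; simp [D, LieDerivation.ad_apply_apply]
  have hD' : IsNilpotent D.toLinearMap := by rw [hD]; exact hn
  let e := LieDerivation.exp D hD'
  have he : ((e.toLinearEquiv : g ≃ₗ[k] g) : g →ₗ[k] g) = expEnd k g (ad k g n) := by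
    rw [expEnd_eq_exp hn, ← hD]; rfl
  refine ⟨e.toLinearEquiv, Subgroup.subset_closure ⟨n, hn, he⟩, he, ?_⟩
  intro x y
  exact e.map_lie x y

theorem IntG_le_LA : IntG k g ≤ LA k g := by
  rw [IntG, Subgroup.closure_le]
  rintro τ ⟨n, hn, hτ⟩
  obtain ⟨τ', _, h1, h2⟩ := exists_exp n hn
  have : τ = τ' := by
    apply LinearEquiv.toLinearMap_injective
    rw [hτ, h1]
  rw [this]; exact h2

/-- conjugating powers -/
theorem ad_conj {φ : g ≃ₗ[k] g} (h : φ ∈ LA k g) (n x : g) (i : ℕ) :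
    ((ad k g (φ n)) ^ i) x = φ (((ad k g n) ^ i) (φ⁻¹ x)) := by
  induction i generalizing x with
  | zero => simp
  | succ i ih =>
    rw [pow_succ, pow_succ, End.mul_apply, End.mul_apply, ih, ad_apply, ad_apply]
    congr 2
    have := LA.map_lie ((LA k g).inv_mem h) (φ n) x
    simpa using this

theorem ad_nilp_conj {φ : g ≃ₗ[k] g} (h : φ ∈ LA k g) {n : g} (hn : IsNilpotent (ad k g n)) :
    IsNilpotent (ad k g (φ n)) := by
  obtain ⟨i, hi⟩ := hn
  exact ⟨i, by ext x; rw [ad_conj h, hi]; simp⟩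

theorem IntG_conj {φ : g ≃ₗ[k] g} (h : φ ∈ LA k g) {τ : g ≃ₗ[k] g} (hτ : τ ∈ IntG k g) :
    φ * τ * φ⁻¹ ∈ IntG k g := by
  rw [IntG] at hτ ⊢
  induction hτ using Subgroup.closure_induction with
  | mem τ h1 =>
    obtain ⟨n, hn, h2⟩ := h1
    apply Subgroup.subset_closure
    refine ⟨φ n, ad_nilp_conj h hn, ?_⟩
    ext x
    have h3 : ∀ y, τ y = expEnd k g (ad k g n) y := fun y => by rw [← h2]; rfl
    change φ (τ (φ⁻¹ x)) = _
    rw [h3]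
    simp only [expEnd, LinearMap.sum_apply, LinearMap.smul_apply, ad_conj h, map_sum, map_smul]
  | one => simp
  | mul a b _ _ ha hb =>
    have : φ * (a * b) * φ⁻¹ = (φ * a * φ⁻¹) * (φ * b * φ⁻¹) := by group
    rw [this]; exact Subgroup.mul_mem _ ha hb
  | inv a _ ha =>
    have : φ * a⁻¹ * φ⁻¹ = (φ * a * φ⁻¹)⁻¹ := by group
    rw [this]; exact Subgroup.inv_mem _ ha

end Basics
end CL

set_option linter.all false
set_option linter.unusedSimpArgs false
set_option linter.unusedSectionVars false
namespace CL
section RootData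
open LieAlgebra Module
variable {k : Type*} [Field k] [IsAlgClosed k] [CharZero k]
variable {g : Type*} [LieRing g] [LieAlgebra k g] [FiniteDimensional k g]
  [LieAlgebra.IsSemisimple k g]
variable {I Φ : Type*} [Fintype I] [DecidableEq I] [Fintype Φ] [DecidableEq Φ]

variable (k g I Φ) in
/-- Concrete root data adapted to a split Cartan subalgebra with a base. -/
structure RD where
  B : Basis (I ⊕ Φ) k g
  n : Φ → I → ℤ
  A : I → I → ℤ
  s : I → Φ
  f : I → Φ
  F : I → g
  c : I → k
  hF : ∀ i, F i = c i • B (Sum.inr (f i))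
  n_inj : Function.Injective n
  n_ne : ∀ a, n a ≠ 0
  n_s : ∀ i, n (s i) = Pi.single i 1
  n_f : ∀ i, n (f i) = - Pi.single i 1
  pos : ∀ a, 0 ≤ n a ∨ n a ≤ 0
  red : ∀ a i, (∀ j, j ≠ i → n a j = 0) → a = s i ∨ a = f i
  lie_tt : ∀ i j, ⁅B (Sum.inl i), B (Sum.inl j)⁆ = 0
  lie_te : ∀ i a, ⁅B (Sum.inl i), B (Sum.inr a)⁆ = (n a i : k) • B (Sum.inr a)
  lie_sF : ∀ i, ⁅B (Sum.inr (s i)), F i⁆ = ∑ j, (A i j : k) • B (Sum.inl j)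
  A_ii : ∀ i, A i i = 2
  A_det : (Matrix.of A).det ≠ 0

namespace RD
variable (R : RD k g I Φ)

/-- coweights -/
noncomputable def w (i : I) : g := R.B (Sum.inl i)
/-- root vectors -/
noncomputable def e (a : Φ) : g := R.B (Sum.inr a)
/-- coroots -/
noncomputable def h (i : I) : g := ∑ j, (R.A i j : k) • R.w j
/-- weights of the basis vectors -/
def wt : I ⊕ Φ → I → ℤ
  | Sum.inl _ => 0
  | Sum.inr a => R.n a
/-- roots as functionals -/
noncomputable def al (μ : I → ℤ) : g →ₗ[k] k := ∑ i, (μ i : k) • R.B.coord (Sum.inl i)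
/-- the Cartan subalgebra -/
noncomputable def t : Submodule k g := Submodule.span k (Set.range R.w)

theorem al_apply (μ : I → ℤ) (x : g) : R.al μ x = ∑ i, (μ i : k) * R.B.repr x (Sum.inl i) := by
  simp [al]

theorem al_w (μ : I → ℤ) (i : I) : R.al μ (R.w i) = μ i := by
  simp [al_apply, w, Finsupp.single_apply]

theorem w_mem (i : I) : R.w i ∈ R.t := Submodule.subset_span ⟨i, rfl⟩

theorem mem_t_iff {x : g} : x ∈ R.t ↔ ∀ a, R.B.repr x (Sum.inr a) = 0 := by
  constructor
  · intro hx a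
    induction hx using Submodule.span_induction with
    | mem x h => obtain ⟨i, rfl⟩ := h; simp [w]
    | zero => simp
    | add x y _ _ hx hy => simp [hx, hy]
    | smul c x _ hx => simp [hx]
  · intro h
    rw [← R.B.sum_repr x]
    apply Submodule.sum_mem
    rintro (i | a) _
    · exact Submodule.smul_mem _ _ (R.w_mem i)
    · rw [h a]; simp

theorem t_eq_sum {x : g} (hx : x ∈ R.t) : x = ∑ i, R.al (Pi.single i 1) x • R.w i := by
  conv_lhs => rw [← R.B.sum_repr x]
  rw [Fintype.sum_sum_type]
  simp only [R.mem_t_iff.1 hx, zero_smul, Finset.sum_const_zero, add_zero]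
  refine Finset.sum_congr rfl fun i _ => ?_
  congr 1
  simp [al_apply, Pi.single_apply]

theorem al_eq_sum (μ : I → ℤ) (x : g) : R.al μ x = ∑ i, (μ i : k) * R.al (Pi.single i 1) x := by
  simp [al_apply, Pi.single_apply]

/-- `t` separated by simple coordinates -/
theorem t_ext {x y : g} (hx : x ∈ R.t) (hy : y ∈ R.t)
    (h : ∀ i, R.al (Pi.single i 1) x = R.al (Pi.single i 1) y) : x = y := by
  rw [R.t_eq_sum hx, R.t_eq_sum hy]; simp [h]

theorem al_add (μ ν : I → ℤ) (x : g) : R.al (μ + ν) x = R.al μ x + R.al ν x := by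
  simp [al_apply, add_mul, Finset.sum_add_distrib]

theorem al_neg (μ : I → ℤ) (x : g) : R.al (-μ) x = - R.al μ x := by
  simp [al_apply]

theorem al_inj {μ ν : I → ℤ} (h : ∀ x ∈ R.t, R.al μ x = R.al ν x) : μ = ν := by
  ext i
  have := h _ (R.w_mem i)
  rw [al_w, al_w] at this
  exact_mod_cast this

theorem lie_t_B {x : g} (hx : x ∈ R.t) (b : I ⊕ Φ) : ⁅x, R.B b⁆ = R.al (R.wt b) x • R.B b := by
  induction hx using Submodule.span_induction with
  | mem x h =>
    obtain ⟨i, rfl⟩ := h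
    rw [al_w]
    rcases b with j | a
    · simp [wt, w, R.lie_tt]
    · simp [wt, w, R.lie_te]
  | zero => simp
  | add x y _ _ hx hy => simp [hx, hy, add_smul]
  | smul c x _ hx => simp [hx, mul_smul]

theorem lie_t_e {x : g} (hx : x ∈ R.t) (a : Φ) : ⁅x, R.e a⁆ = R.al (R.n a) x • R.e a :=
  R.lie_t_B hx (Sum.inr a)

theorem al_zero (x : g) : R.al 0 x = 0 := by simp [al_apply]

theorem lie_t_t {x y : g} (hx : x ∈ R.t) (hy : y ∈ R.t) : ⁅x, y⁆ = 0 := by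
  rw [R.t_eq_sum hy, lie_sum]
  refine Finset.sum_eq_zero fun i _ => ?_
  have := R.lie_t_B hx (Sum.inl i)
  rw [lie_smul, w, this]
  simp [wt, al_zero]

theorem repr_lie {x : g} (hx : x ∈ R.t) (y : g) (b : I ⊕ Φ) :
    R.B.repr ⁅x, y⁆ b = R.al (R.wt b) x * R.B.repr y b := by
  conv_lhs => rw [← R.B.sum_repr y]
  rw [lie_sum]
  simp only [lie_smul, R.lie_t_B hx, map_sum, map_smul, Finsupp.coe_finset_sum, Finset.sum_apply,
    Finsupp.smul_apply, Basis.repr_self, smul_eq_mul]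
  rw [Finset.sum_eq_single b]
  · simp; ring
  · intro c _ hc; simp [Finsupp.single_apply, hc]
  · simp

/-- A nonzero weight vector has a weight among those of the basis. -/
theorem wt_of {y : g} {χ : g → k} (hχ : ∀ x ∈ R.t, ⁅x, y⁆ = χ x • y) {b : I ⊕ Φ}
    (hb : R.B.repr y b ≠ 0) : ∀ x ∈ R.t, R.al (R.wt b) x = χ x := by
  intro x hx
  have := R.repr_lie hx y b
  rw [hχ x hx] at this
  simp at this
  tauto

theorem exists_repr_ne {y : g} (hy : y ≠ 0) : ∃ b, R.B.repr y b ≠ 0 := by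
  by_contra h
  push Not at h
  exact hy (R.B.repr.map_eq_zero_iff.1 (Finsupp.ext h))

theorem wt_zero_mem {y : g} (h : ∀ x ∈ R.t, ⁅x, y⁆ = 0) : y ∈ R.t := by
  rw [mem_t_iff]
  intro a
  by_contra hb
  have := R.wt_of (χ := fun _ => 0) (y := y) (by simpa using h) hb
  exact R.n_ne a (R.al_inj (fun x hx => by rw [al_zero]; exact this x hx))

/-- vectors of weight `μ` -/
theorem wt_vec {y : g} {μ : I → ℤ} (hμ : ∀ x ∈ R.t, ⁅x, y⁆ = R.al μ x • y) (hy : y ≠ 0) :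
    (μ = 0 ∧ y ∈ R.t) ∨ ∃ a, μ = R.n a ∧ ∃ c : k, c ≠ 0 ∧ y = c • R.e a := by
  obtain ⟨b, hb⟩ := R.exists_repr_ne hy
  have h1 := R.al_inj (R.wt_of hμ hb)
  rcases b with i | a
  · left
    refine ⟨h1.symm, R.wt_zero_mem fun x hx => ?_⟩
    rw [hμ x hx, ← h1]; simp [wt, al_zero]
  · right
    refine ⟨a, h1.symm, R.B.repr y (Sum.inr a), hb, ?_⟩
    have h3 : ∀ b', b' ≠ Sum.inr a → R.B.repr y b' = 0 := by
      intro b' hb'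
      by_contra hc
      have h2 := R.al_inj (R.wt_of hμ hc)
      rw [← h1] at h2
      rcases b' with i | a'
      · exact R.n_ne a h2.symm
      · exact hb' (congrArg Sum.inr (R.n_inj h2))
    conv_lhs => rw [← R.B.sum_repr y]
    rw [Finset.sum_eq_single (Sum.inr a)]
    · rfl
    · intro b' _ hb'; rw [h3 b' hb', zero_smul]
    · simp

theorem e_ne (a : Φ) : R.e a ≠ 0 := R.B.ne_zero _
theorem w_ne (i : I) : R.w i ≠ 0 := R.B.ne_zero _

/-- brackets of weight vectors -/
theorem lie_wt {μ ν : I → ℤ} {y z x : g} (hy : ⁅x, y⁆ = R.al μ x • y) (hz : ⁅x, z⁆ = R.al ν x • z) :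
    ⁅x, ⁅y, z⁆⁆ = R.al (μ + ν) x • ⁅y, z⁆ := by
  rw [leibniz_lie, hy, hz, al_add, add_smul]; simp

/-- Regular elements of `t`. -/
def Reg (x : g) : Prop := x ∈ R.t ∧ ∀ a, R.al (R.n a) x ≠ 0

theorem Reg.zc {x : g} (hx : R.Reg x) : zc k g x = R.t := by
  ext y
  rw [_root_.zc, LinearMap.mem_ker, ad_apply]
  constructor
  · intro h
    rw [mem_t_iff]
    intro a
    have := R.repr_lie hx.1 y (Sum.inr a)
    rw [h] at this
    simp at this
    rcases this with h | h
    · exact absurd h (hx.2 a)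
    · exact h
  · intro hy; exact R.lie_t_t hx.1 hy

theorem Reg_of_zc {x : g} (hx : zc k g x = R.t) : R.Reg x := by
  have h1 : x ∈ R.t := by rw [← hx]; simp [_root_.zc]
  refine ⟨h1, fun a ha => ?_⟩
  have : R.e a ∈ R.t := by
    rw [← hx, _root_.zc, LinearMap.mem_ker, ad_apply, R.lie_t_e h1, ha, zero_smul]
  rw [mem_t_iff] at this
  simpa [e] using this a

/-- `φ` normalises `t`. -/
def Nt (φ : g ≃ₗ[k] g) : Prop := φ ∈ LA k g ∧ ∀ x, φ x ∈ R.t ↔ x ∈ R.t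

theorem Nt_of {φ : g ≃ₗ[k] g} (h : φ ∈ LA k g) (h2 : ∀ x ∈ R.t, φ x ∈ R.t) : R.Nt φ := by
  refine ⟨h, fun x => ⟨fun hx => ?_, h2 x⟩⟩
  have h3 : R.t.map (φ : g →ₗ[k] g) = R.t := by
    apply Submodule.eq_of_le_of_finrank_eq
    · rintro _ ⟨x, hx, rfl⟩; exact h2 x hx
    · exact LinearEquiv.finrank_map_eq φ R.t
  rw [← h3] at hx
  obtain ⟨y, hy, hyx⟩ := hx
  rwa [← φ.injective hyx]

theorem Nt.mul {φ ψ : g ≃ₗ[k] g} (h1 : R.Nt φ) (h2 : R.Nt ψ) : R.Nt (φ * ψ) :=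
  ⟨(LA k g).mul_mem h1.1 h2.1, fun x => by rw [LinearEquiv.mul_apply, h1.2, h2.2]⟩

theorem Nt.inv {φ : g ≃ₗ[k] g} (h1 : R.Nt φ) : R.Nt φ⁻¹ :=
  ⟨(LA k g).inv_mem h1.1, fun x => by rw [← h1.2, app_inv]⟩

theorem Nt.exists_perm {φ : g ≃ₗ[k] g} (h : R.Nt φ) : ∃ (π : Equiv.Perm Φ) (c : Φ → k),
    (∀ a, c a ≠ 0) ∧ (∀ a, φ (R.e a) = c a • R.e (π a)) ∧
    ∀ a, ∀ x ∈ R.t, R.al (R.n (π a)) (φ x) = R.al (R.n a) x := by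
  have key : ∀ a, ∃ a' : Φ, ∃ c : k, c ≠ 0 ∧ φ (R.e a) = c • R.e a' ∧
      ∀ x ∈ R.t, R.al (R.n a') (φ x) = R.al (R.n a) x := by
    intro a
    have hχ : ∀ x ∈ R.t, ⁅x, φ (R.e a)⁆ = R.al (R.n a) (φ⁻¹ x) • φ (R.e a) := by
      intro x hx
      have h1 := LA.map_lie h.1 (φ⁻¹ x) (R.e a)
      rw [app_inv] at h1
      rw [← h1, R.lie_t_e ((Nt.inv R h).2 x |>.2 hx), map_smul]
    have hne : φ (R.e a) ≠ 0 := fun h0 => R.e_ne a (by simpa using h0)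
    obtain ⟨b, hb⟩ := R.exists_repr_ne hne
    have h1 := R.wt_of (χ := fun x => R.al (R.n a) (φ⁻¹ x)) hχ hb
    rcases b with i | a'
    · exfalso
      apply R.n_ne a
      apply R.al_inj
      intro x hx
      have := h1 (φ x) ((h.2 x).2 hx)
      simp only [inv_app, wt] at this
      rw [← this, al_zero, al_zero]
    · have hμ : ∀ x ∈ R.t, ⁅x, φ (R.e a)⁆ = R.al (R.n a') x • φ (R.e a) := by
        intro x hx; rw [hχ x hx, ← h1 x hx]; rfl
      rcases R.wt_vec hμ hne with ⟨h0, _⟩ | ⟨a'', h2, c, hc, h3⟩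
      · exact absurd h0 (R.n_ne _)
      · rw [← R.n_inj h2] at h3
        refine ⟨a', c, hc, h3, fun x hx => ?_⟩
        have := h1 (φ x) ((h.2 x).2 hx)
        simp only [inv_app] at this
        exact this
  choose π c hc h1 h2 using key
  have hinj : Function.Injective π := by
    intro a b hab
    apply R.n_inj
    apply R.al_inj
    intro x hx
    rw [← h2 a x hx, ← h2 b x hx, hab]
  exact ⟨Equiv.ofBijective π (Finite.injective_iff_bijective.1 hinj), c, hc, h1, h2⟩

end RD
end RootData
end CL

set_option linter.all false
set_option linter.unusedSimpArgs false
set_option linter.unusedSectionVars false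
namespace CL
section Filtration
open LieAlgebra Module
variable {k : Type*} [Field k] [IsAlgClosed k] [CharZero k]
variable {g : Type*} [LieRing g] [LieAlgebra k g] [FiniteDimensional k g]
  [LieAlgebra.IsSemisimple k g]
variable {I Φ : Type*} [Fintype I] [DecidableEq I] [Fintype Φ] [DecidableEq Φ]
namespace RD
variable (R : RD k g I Φ)

/-- height -/
def ht (b : I ⊕ Φ) : ℤ := ∑ i, R.wt b i

/-- filtration by (signed) height -/
def Fil (σ m : ℤ) : Submodule k g where
  carrier := {y | ∀ b, R.B.repr y b ≠ 0 → σ * R.ht b ≤ m}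
  zero_mem' := by intro b hb; simp at hb
  add_mem' := by
    intro x y hx hy b hb
    by_cases h : R.B.repr x b = 0
    · apply hy; intro h2; apply hb; simp [h, h2]
    · exact hx b h
  smul_mem' := by
    intro c x hx b hb
    apply hx; intro h; apply hb; simp [h]

theorem mem_Fil {σ m : ℤ} {y : g} : y ∈ R.Fil σ m ↔ ∀ b, R.B.repr y b ≠ 0 → σ * R.ht b ≤ m := Iff.rfl

theorem Fil_mono (σ : ℤ) {m l : ℤ} (h : m ≤ l) : R.Fil σ m ≤ R.Fil σ l :=
  fun y hy b hb => (hy b hb).trans h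

theorem B_mem_Fil {σ m : ℤ} {b : I ⊕ Φ} (h : σ * R.ht b ≤ m) : R.B b ∈ R.Fil σ m := by
  intro c hc
  rw [Basis.repr_self, Finsupp.single_apply] at hc
  split_ifs at hc with h1
  · rwa [← h1]
  · simp at hc

theorem B_lie_B (b c d : I ⊕ Φ) (h : R.B.repr ⁅R.B b, R.B c⁆ d ≠ 0) : R.wt d = R.wt b + R.wt c := by
  apply R.al_inj
  apply R.wt_of _ h
  intro x hx
  exact R.lie_wt (R.lie_t_B hx b) (R.lie_t_B hx c)

theorem ht_add {b c d : I ⊕ Φ} (h : R.wt d = R.wt b + R.wt c) : R.ht d = R.ht b + R.ht c := by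
  simp [ht, h, Finset.sum_add_distrib]

theorem lie_mem_Fil {σ m l : ℤ} {y z : g} (hy : y ∈ R.Fil σ m) (hz : z ∈ R.Fil σ l) :
    ⁅y, z⁆ ∈ R.Fil σ (m + l) := by
  rw [← R.B.sum_repr y, ← R.B.sum_repr z, sum_lie]
  refine Submodule.sum_mem _ fun b _ => ?_
  rw [lie_sum]
  refine Submodule.sum_mem _ fun c _ => ?_
  rw [smul_lie, lie_smul]
  by_cases h1 : R.B.repr y b = 0
  · rw [h1]; simp
  by_cases h2 : R.B.repr z c = 0
  · rw [h2]; simp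
  refine Submodule.smul_mem _ _ (Submodule.smul_mem _ _ ?_)
  intro d hd
  rw [R.ht_add (R.B_lie_B b c d hd), mul_add]
  exact add_le_add (hy b h1) (hz c h2)

/-- bound for heights -/
def M : ℤ := ∑ b, |R.ht b| + 1

theorem M_pos : 0 < R.M := by
  have : 0 ≤ ∑ b, |R.ht b| := Finset.sum_nonneg fun _ _ => abs_nonneg _
  unfold M; omega

theorem ht_lt (b : I ⊕ Φ) : |R.ht b| < R.M := by
  have : |R.ht b| ≤ ∑ b, |R.ht b| :=
    Finset.single_le_sum (f := fun b => |R.ht b|) (fun _ _ => abs_nonneg _) (Finset.mem_univ b)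
  unfold M; omega

theorem sht_lt {σ : ℤ} (hσ : |σ| = 1) (b : I ⊕ Φ) : |σ * R.ht b| < R.M := by
  rw [abs_mul, hσ, one_mul]; exact R.ht_lt b

theorem Fil_top {σ : ℤ} (hσ : |σ| = 1) (y : g) : y ∈ R.Fil σ R.M := by
  intro b _
  exact (abs_lt.1 (R.sht_lt hσ b)).2.le

theorem Fil_bot {σ m : ℤ} (hσ : |σ| = 1) (hm : m ≤ - R.M) {y : g} (hy : y ∈ R.Fil σ m) : y = 0 := by
  by_contra h
  obtain ⟨b, hb⟩ := R.exists_repr_ne h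
  have := hy b hb
  have := (abs_lt.1 (R.sht_lt hσ b)).1
  omega

theorem ad_pow_mem {σ m l : ℤ} {ν z : g} (hν : ν ∈ R.Fil σ m) (hz : z ∈ R.Fil σ l) (j : ℕ) :
    ((ad k g ν) ^ j) z ∈ R.Fil σ (j * m + l) := by
  induction j with
  | zero => simpa using hz
  | succ j ih =>
    rw [pow_succ', End.mul_apply, ad_apply]
    have := R.lie_mem_Fil hν ih
    refine R.Fil_mono σ (le_of_eq ?_) this
    push_cast; ring

theorem ad_nilp {σ : ℤ} (hσ : |σ| = 1) {ν : g} (hν : ν ∈ R.Fil σ (-1)) : IsNilpotent (ad k g ν) := by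
  refine ⟨(2 * R.M).toNat, ?_⟩
  ext z
  apply R.Fil_bot hσ _ (R.ad_pow_mem hν (R.Fil_top hσ z) _)
  have := R.M_pos
  rw [Int.toNat_of_nonneg (by omega)]; omega

theorem n_ne' {a : Φ} : ∃ i, R.n a i ≠ 0 := by
  by_contra h
  push Not at h
  exact R.n_ne a (funext h)

theorem ht_ne (a : Φ) : R.ht (Sum.inr a) ≠ 0 := by
  obtain ⟨i, hi⟩ := R.n_ne' (a := a)
  intro h
  simp only [ht, wt] at h
  rcases R.pos a with hp | hp
  · rw [Finset.sum_eq_zero_iff_of_nonneg (fun i _ => hp i)] at h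
    exact hi (h i (Finset.mem_univ i))
  · rw [Finset.sum_eq_zero_iff_of_nonpos (fun i _ => hp i)] at h
    exact hi (h i (Finset.mem_univ i))

theorem e_nilp (a : Φ) (c : k) : IsNilpotent (ad k g (c • R.e a)) := by
  rcases lt_or_gt_of_ne (R.ht_ne a) with h | h
  · apply R.ad_nilp (σ := 1) (by simp)
    exact Submodule.smul_mem _ _ (R.B_mem_Fil (by omega))
  · apply R.ad_nilp (σ := -1) (by simp)
    exact Submodule.smul_mem _ _ (R.B_mem_Fil (by omega))

end RD
end Filtration

section DomApp
open LieAlgebra Module MvPolynomial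
variable {k : Type*} [Field k] [IsAlgClosed k] [CharZero k]
variable {ι : Type*} [Fintype ι] [DecidableEq ι]

/-- constant coefficient of a matrix -/
noncomputable def m0 {p q : Type*} (M : Matrix p q (MvPolynomial ι k)) : Matrix p q k := M.map constantCoeff
/-- linear coefficient of a matrix -/
noncomputable def m1 {p q : Type*} (i : ι) (M : Matrix p q (MvPolynomial ι k)) : Matrix p q k :=
  M.map fun x => constantCoeff (pderiv i x)

theorem m0_mul {p q r : Type*} [Fintype q] (M : Matrix p q (MvPolynomial ι k))
    (N : Matrix q r (MvPolynomial ι k)) : m0 (M * N) = m0 M * m0 N := by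
  rw [m0, Matrix.map_mul]; rfl

theorem m1_mul {p q r : Type*} [Fintype q] (i : ι) (M : Matrix p q (MvPolynomial ι k))
    (N : Matrix q r (MvPolynomial ι k)) : m1 i (M * N) = m1 i M * m0 N + m0 M * m1 i N := by
  ext a b
  simp only [m1, m0, Matrix.map_apply, Matrix.mul_apply, map_sum, pderiv_mul, map_add, map_mul,
    Matrix.add_apply, Finset.sum_add_distrib]

theorem m0_list (l : List (Matrix ι ι (MvPolynomial ι k))) (h : ∀ M ∈ l, m0 M = 1) : m0 l.prod = 1 := by
  induction l with
  | nil => simp [m0]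
  | cons a l ih =>
    rw [List.prod_cons, m0_mul, h a (by simp), ih fun M hM => h M (by simp [hM]), one_mul]

theorem m1_list (i : ι) (l : List (Matrix ι ι (MvPolynomial ι k))) (h : ∀ M ∈ l, m0 M = 1) :
    m1 i l.prod = (l.map (m1 i)).sum := by
  induction l with
  | nil => ext a b; by_cases h : a = b <;> simp [m1, Matrix.one_apply, h]
  | cons a l ih =>
    rw [List.prod_cons, m1_mul, h a (by simp), ih fun M hM => h M (by simp [hM]),
      m0_list l fun M hM => h M (by simp [hM])]
    simp

/-- matrix exponential with polynomial parameter -/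
noncomputable def Em (j : ι) (d : ℕ) (N : Matrix ι ι k) : Matrix ι ι (MvPolynomial ι k) :=
  ∑ i ∈ Finset.range (d + 1), (C ((i.factorial : k)⁻¹) * X j ^ i) • (N ^ i).map C

theorem m0_Em (j : ι) (d : ℕ) (N : Matrix ι ι k) : m0 (Em j d N) = 1 := by
  ext a b
  simp only [m0, Em, Matrix.map_apply, Matrix.sum_apply, Matrix.smul_apply, map_sum, smul_eq_mul,
    map_mul, map_pow, constantCoeff_X, constantCoeff_C]
  rw [Finset.sum_range_succ']
  simp

theorem m1_Em (j l : ι) (d : ℕ) (hd : 0 < d) (N : Matrix ι ι k) :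
    m1 l (Em j d N) = if l = j then N else 0 := by
  ext a b
  obtain ⟨d, rfl⟩ := Nat.exists_eq_succ_of_ne_zero hd.ne'
  simp only [m1, Em, Matrix.map_apply, Matrix.sum_apply, Matrix.smul_apply, map_sum, smul_eq_mul,
    pderiv_mul, pderiv_C, pderiv_pow, map_mul, map_add, map_pow, constantCoeff_X, constantCoeff_C,
    map_zero, zero_mul, mul_zero, add_zero, zero_add]
  rw [Nat.succ_eq_add_one, Finset.sum_range_succ', Finset.sum_range_succ']
  have h2 : ∀ i, (0 : k) ^ (i + 1 + 1 - 1) = 0 := fun i => by simp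
  simp only [h2]
  by_cases h : l = j
  · subst h; simp
  · simp [h, pderiv_X_of_ne (Ne.symm h)]

theorem eval_Em (x : ι → k) (j : ι) (d : ℕ) (N : Matrix ι ι k) :
    (Em j d N).map (eval x) = ∑ i ∈ Finset.range (d + 1), ((i.factorial : k)⁻¹) • (x j • N) ^ i := by
  ext a b
  simp only [Em, Matrix.map_apply, Matrix.sum_apply, Matrix.smul_apply, map_sum, smul_eq_mul,
    map_mul, map_pow, eval_X, eval_C, smul_pow]
  exact Finset.sum_congr rfl fun i _ => by ring

end DomApp

section CartanConj
open LieAlgebra Module MvPolynomial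
variable {k : Type*} [Field k] [IsAlgClosed k] [CharZero k]
variable {g : Type*} [LieRing g] [LieAlgebra k g] [FiniteDimensional k g]
  [LieAlgebra.IsSemisimple k g]
variable {I Φ : Type*} [Fintype I] [DecidableEq I] [Fintype Φ] [DecidableEq Φ]
namespace RD
variable (R : RD k g I Φ)

theorem exists_Reg : ∃ x, R.Reg x := by
  refine ⟨∑ i, R.w i, Submodule.sum_mem _ fun i _ => R.w_mem i, fun a => ?_⟩
  rw [map_sum]
  simp only [al_w]
  have := R.ht_ne a
  simp only [ht, wt] at this
  exact_mod_cast this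

/-- matrix of `ad e_a` -/
noncomputable def Nm (a : Φ) : Matrix (I ⊕ Φ) (I ⊕ Φ) k := LinearMap.toMatrix R.B R.B (ad k g (R.e a))

/-- ordered product of exponentials -/
noncomputable def Pm (l : List Φ) : Matrix (I ⊕ Φ) (I ⊕ Φ) (MvPolynomial (I ⊕ Φ) k) :=
  (l.map fun a => Em (Sum.inr a) (finrank k g) (R.Nm a)).prod

theorem exists_u (l : List Φ) (x : I ⊕ Φ → k) : ∃ u ∈ IntG k g,
    (R.Pm l).map (eval x) = LinearMap.toMatrix R.B R.B (u : g →ₗ[k] g) := by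
  induction l with
  | nil => exact ⟨1, Subgroup.one_mem _, by simp [Pm, ← Module.End.one_eq_id, LinearEquiv.coe_one] <;> rfl⟩
  | cons a l ih =>
    obtain ⟨u, hu, h1⟩ := ih
    obtain ⟨τ, hτ, h2, _⟩ := exists_exp _ (R.e_nilp a (x (Sum.inr a)))
    refine ⟨τ * u, Subgroup.mul_mem _ hτ hu, ?_⟩
    have h3 : ((τ * u : g ≃ₗ[k] g) : g →ₗ[k] g) = (τ : g →ₗ[k] g) ∘ₗ (u : g →ₗ[k] g) := rfl
    have h4 : R.Pm (a :: l) = Em (Sum.inr a) (finrank k g) (R.Nm a) * R.Pm l := by simp [Pm]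
    rw [h3, LinearMap.toMatrix_comp R.B R.B R.B, ← h1, h4, Matrix.map_mul, eval_Em, h2]
    congr 1
    simp only [expEnd, map_sum, map_smul, LinearMap.toMatrix_pow, Nm]
    exact Finset.sum_congr rfl fun i _ => by rw [← map_smul, LinearMap.toMatrix_pow]

/-- base vector -/
noncomputable def v0 (h0 : g) : Matrix (I ⊕ Φ) Unit (MvPolynomial (I ⊕ Φ) k) :=
  Matrix.of fun b _ => Sum.elim (fun i => X (Sum.inl i) + C (R.B.repr h0 (Sum.inl i))) (fun _ => 0) b

theorem generic : ∃ q : MvPolynomial (I ⊕ Φ) k, q ≠ 0 ∧ ∀ y : g, eval (R.B.repr y) q ≠ 0 →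
    ∃ u ∈ IntG k g, ∃ h ∈ R.t, y = u h := by
  obtain ⟨h0, hh0⟩ := R.exists_Reg
  let l : List Φ := Finset.univ.toList
  let F : I ⊕ Φ → MvPolynomial (I ⊕ Φ) k := fun b => (R.Pm l * R.v0 h0) b ()
  have hfr : 0 < finrank k g ∨ IsEmpty Φ := by
    by_cases h : IsEmpty Φ
    · right; exact h
    · left
      rw [not_isEmpty_iff] at h
      have : Nonempty (I ⊕ Φ) := ⟨Sum.inr h.some⟩
      rw [finrank_eq_card_basis R.B]; exact Fintype.card_pos
  have hl : ∀ M ∈ (l.map fun a => Em (Sum.inr a) (finrank k g) (R.Nm a)), m0 M = 1 := by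
    intro M hM
    rw [List.mem_map] at hM
    obtain ⟨a, _, rfl⟩ := hM
    exact m0_Em _ _ _
  have hF : ∀ i j, constantCoeff (pderiv i (F j)) = Matrix.diagonal
      (Sum.elim (fun _ => 1) (fun a => - R.al (R.n a) h0) : I ⊕ Φ → k) i j := by
    intro i j
    have h1 : constantCoeff (pderiv i (F j)) = m1 i (R.Pm l * R.v0 h0) j () := rfl
    rw [h1, m1_mul, Pm, m0_list _ hl, m1_list _ _ hl, Matrix.one_mul, Matrix.add_apply, List.map_map]
    have h2 : (l.map (m1 i ∘ fun a => Em (Sum.inr a) (finrank k g) (R.Nm a))).sum =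
        Sum.elim (fun _ => 0) (fun a => R.Nm a) i := by
      rw [Finset.sum_map_toList]
      rcases hfr with hfr | hfr
      · rcases i with i | a
        · simp only [Function.comp, m1_Em _ _ _ hfr]
          simp
        · simp only [Function.comp, m1_Em _ _ _ hfr]
          simp
      · rcases i with i | a
        · simp
        · exact hfr.elim a
    rw [h2]
    have hm0 : ∀ b, m0 (R.v0 h0) b () = R.B.repr h0 b := by
      rintro (b | b)
      · simp [m0, v0]
      · simp [m0, v0, R.mem_t_iff.1 hh0.1]
    rcases i with i | a
    · rcases j with j | b
      · by_cases h : i = j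
        · subst h; simp [m1, v0]
        · simp [m1, v0, h, pderiv_X_of_ne, Ne.symm h]
      · simp [m1, v0]
    · have h5 : m1 (Sum.inr a) (R.v0 h0) = 0 := by
        ext b u
        rcases b with b | b <;> simp [m1, v0]
      rw [h5]
      simp only [Sum.elim_inr, Matrix.zero_apply, add_zero, Matrix.mul_apply, hm0]
      have h6 := LinearMap.toMatrix_mulVec_repr R.B R.B (ad k g (R.e a)) h0
      have h7 := congrFun h6 j
      rw [Matrix.mulVec, dotProduct] at h7
      rw [Nm, h7, ad_apply, ← lie_skew, R.lie_t_e hh0.1]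
      by_cases h : Sum.inr a = j
      · subst h; simp [e]
      · rw [Matrix.diagonal_apply_ne _ h]; simp [e, Finsupp.single_apply, h]
  have hJ : (Matrix.of fun i j => constantCoeff (pderiv i (F j))).det ≠ 0 := by
    have : (Matrix.of fun i j => constantCoeff (pderiv i (F j))) = Matrix.diagonal
      (Sum.elim (fun _ => 1) (fun a => - R.al (R.n a) h0) : I ⊕ Φ → k) := by
      ext i j; exact hF i j
    rw [this, Matrix.det_diagonal, Finset.prod_ne_zero_iff]
    rintro (i | a) _
    · simp
    · simpa using hh0.2 a
  obtain ⟨q, hq, h⟩ := dom F hJ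
  refine ⟨q, hq, fun y hy => ?_⟩
  obtain ⟨x, hx⟩ := h _ hy
  obtain ⟨u, hu, h1⟩ := R.exists_u l x
  refine ⟨u, hu, ∑ i, (x (Sum.inl i) + R.B.repr h0 (Sum.inl i)) • R.w i,
    Submodule.sum_mem _ fun i _ => Submodule.smul_mem _ _ (R.w_mem i), ?_⟩
  apply R.B.repr.injective
  ext b
  rw [← hx b]
  have h2 := LinearMap.toMatrix_mulVec_repr R.B R.B (u : g →ₗ[k] g)
    (∑ i, (x (Sum.inl i) + R.B.repr h0 (Sum.inl i)) • R.w i)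
  have h3 := congrFun h2 b
  rw [← h1, Matrix.mulVec, dotProduct] at h3
  refine Eq.trans ?_ h3
  simp only [F, Matrix.mul_apply, map_sum, map_mul, Matrix.map_apply]
  refine Finset.sum_congr rfl fun c _ => ?_
  congr 1
  rcases c with c | c
  · simp [v0, w, Finsupp.single_apply, Finset.sum_add_distrib]
  · simp [v0, w, Finsupp.single_apply]

end RD
end CartanConj
end CL

set_option linter.all false
set_option linter.unusedSimpArgs false
set_option linter.unusedSectionVars false
namespace CL
section StepZero
open LieAlgebra Module LieSubalgebra
variable {k : Type*} [Field k] [IsAlgClosed k] [CharZero k]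
variable {g : Type*} [LieRing g] [LieAlgebra k g] [FiniteDimensional k g]
  [LieAlgebra.IsSemisimple k g]
variable {I Φ : Type*} [Fintype I] [DecidableEq I] [Fintype Φ] [DecidableEq Φ]

/-- polynomial along lines -/
def PL (f : g → k) : Prop := ∀ x d : g, ∃ p : Polynomial k, ∀ s : k, f (x + s • d) = p.eval s

theorem PL.mul {f f' : g → k} (h : PL (k := k) f) (h' : PL (k := k) f') : PL (k := k) (fun x => f x * f' x) := by
  intro x d
  obtain ⟨p, hp⟩ := h x d
  obtain ⟨q, hq⟩ := h' x d
  exact ⟨p * q, fun s => by simp [hp, hq]⟩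

theorem PL.both {f f' : g → k} (h : PL (k := k) f) (h' : PL (k := k) f') {x x' : g} (hx : f x ≠ 0) (hx' : f' x' ≠ 0) :
    ∃ s : k, f (x + s • (x' - x)) * f' (x + s • (x' - x)) ≠ 0 := by
  obtain ⟨p, hp⟩ := h x (x' - x)
  obtain ⟨q, hq⟩ := h' x (x' - x)
  have hp0 : p ≠ 0 := by
    rintro rfl
    have := hp 0
    simp at this; exact hx this
  have hq0 : q ≠ 0 := by
    rintro rfl
    have := hq 1
    simp at this; exact hx' this
  obtain ⟨s, hs⟩ := Polynomial.exists_eval_ne_zero_of_natDegree_lt_card (p * q) (mul_ne_zero hp0 hq0)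
    (lt_of_lt_of_le (Cardinal.natCast_lt_aleph0) (Cardinal.infinite_iff.mp inferInstance))
  exact ⟨s, by rw [hp, hq, ← Polynomial.eval_mul]; exact hs⟩

theorem PL_mv {ι : Type*} [Fintype ι] [DecidableEq ι] (B : Basis ι k g) (q : MvPolynomial ι k) :
    PL (k := k) (fun y => MvPolynomial.eval (B.repr y) q) := by
  intro x d
  refine ⟨MvPolynomial.aeval (fun i => Polynomial.C (B.repr x i) + Polynomial.X * Polynomial.C (B.repr d i)) q, fun s => ?_⟩
  change MvPolynomial.eval _ q = _
  induction q using MvPolynomial.induction_on with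
  | C a => simp
  | add p q hp hq => rw [map_add, hp, hq, map_add, Polynomial.eval_add]
  | mul_X p i hp => rw [map_mul, hp, map_mul, Polynomial.eval_mul]; simp; left; ring

theorem PL_det {n : Type*} [Fintype n] [DecidableEq n] (L : g →ₗ[k] Matrix n n k) :
    PL (k := k) (fun y => (L y).det) := by
  intro x d
  refine ⟨((L x).map Polynomial.C + (Polynomial.X : Polynomial k) • (L d).map Polynomial.C).det, fun s => ?_⟩
  change (L (x + s • d)).det = _
  rw [← Polynomial.coe_evalRingHom, RingHom.map_det]
  refine congrArg Matrix.det ?_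
  ext i j
  simp; ring

theorem engel_cartan {x : g} (hx : IsRegular k x) : IsCartanSubalgebra (engel k x) := by
  have h : (finrank k g : Cardinal) ≤ Cardinal.mk k :=
    Cardinal.natCast_le_aleph0.trans <| Cardinal.infinite_iff.mp inferInstance
  refine ⟨?_, normalizer_engel _ _⟩
  apply isNilpotent_of_forall_le_engel
  intro y hy
  set Ex : {engel k z | z ∈ engel k x} := ⟨engel k x, x, self_mem_engel _ _, rfl⟩
  suffices IsBot Ex from @this ⟨engel k y, y, hy, rfl⟩
  apply engel_isBot_of_isMin h (engel k x) Ex le_rfl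
  rintro ⟨_, y, hy, rfl⟩ hyx
  suffices finrank k (engel k x) ≤ finrank k (engel k y) by
    suffices engel k y = engel k x from this.ge
    apply LieSubalgebra.toSubmodule_injective
    exact Submodule.eq_of_le_of_finrank_le hyx this
  rw [(isRegular_iff_finrank_engel_eq_rank k x).mp hx]
  apply rank_le_finrank_engel

theorem engel_abelian {x : g} (hx : IsRegular k x) {y z : g} (hy : y ∈ engel k x) (hz : z ∈ engel k x) :
    ⁅y, z⁆ = 0 := by
  haveI := engel_cartan hx
  have h : IsLieAbelian (engel k x) := inferInstance
  have := h.trivial ⟨y, hy⟩ ⟨z, hz⟩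
  exact congrArg Subtype.val this

theorem mem_engel_iff_zc {x : g} (hx : IsRegular k x) (y : g) : y ∈ engel k x ↔ y ∈ zc k g x := by
  constructor
  · intro hy
    exact engel_abelian hx (self_mem_engel k x) hy
  · intro hy
    rw [mem_engel_iff]
    refine ⟨1, ?_⟩
    rw [pow_one]; exact hy

theorem zc_abelian {x : g} (hx : IsRegular k x) {y z : g} (hy : y ∈ zc k g x) (hz : z ∈ zc k g x) :
    ⁅y, z⁆ = 0 :=
  engel_abelian hx ((mem_engel_iff_zc hx y).2 hy) ((mem_engel_iff_zc hx z).2 hz)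

theorem regular_of_ss {x : g} (hs : (ad k g x).IsSemisimple) (hr : finrank k (zc k g x) = rank k g) :
    IsRegular k x := by
  rw [isRegular_iff_finrank_engel_eq_rank, ← hr]
  have : (engel k x).toSubmodule = zc k g x := by
    ext y
    rw [LieSubalgebra.mem_toSubmodule, mem_engel_iff]
    constructor
    · rintro ⟨n, hn⟩
      have h1 := Module.End.IsFinitelySemisimple.maxGenEigenspace_eq_eigenspace hs.isFinitelySemisimple (0 : k)
      have h2 : y ∈ (ad k g x).maxGenEigenspace (0:k) := by
        rw [Module.End.mem_maxGenEigenspace]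
        exact ⟨n, by simpa using hn⟩
      rw [h1] at h2
      simpa [zc] using h2
    · intro h; exact ⟨1, by rw [pow_one]; exact h⟩
  rw [← this]; rfl

theorem PL_regular : ∃ f : g → k, PL (k := k) f ∧ ∀ x, f x ≠ 0 ↔ IsRegular k x := by
  let b := finBasis k g
  exact ⟨_, PL_mv b ((LinearMap.polyCharpoly (ad k g : g →ₗ[k] End k g) b).coeff (rank k g)), fun x =>
    (isRegular_iff_coeff_polyCharpoly_rank_ne_zero k b x).symm⟩

theorem step0 (V W : Submodule k g)
    (hS : ∃ x ∈ W, (ad k g x).IsSemisimple ∧ finrank k (zc k g x) = rank k g)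
    (hL : ∃ x ∈ W, zc k g x ⊓ V = ⊥) :
    ∃ x ∈ W, IsRegular k x ∧ zc k g x ⊓ V = ⊥ := by
  obtain ⟨x, hxW, hx1, hx2⟩ := hS
  obtain ⟨x', hxW', hx'⟩ := hL
  obtain ⟨f, hf, hf2⟩ := PL_regular (k := k) (g := g)
  have hinj : LinearMap.ker ((ad k g x') ∘ₗ V.subtype) = ⊥ := by
    rw [LinearMap.ker_eq_bot']
    intro v hv
    have : (v : g) ∈ zc k g x' ⊓ V := ⟨hv, v.2⟩
    rw [hx'] at this
    simpa using this
  obtain ⟨P, hP⟩ := LinearMap.exists_leftInverse_of_injective _ hinj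
  let bV := finBasis k V
  let L : g →ₗ[k] Matrix (Fin (finrank k V)) (Fin (finrank k V)) k :=
    { toFun := fun y => LinearMap.toMatrix bV bV (P ∘ₗ ((ad k g y) ∘ₗ V.subtype))
      map_add' := by intro a b; rw [← map_add]; congr 1; ext v; simp
      map_smul' := by intro c a; rw [← map_smul]; congr 1; ext v; simp }
  have h1 : (L x').det ≠ 0 := by
    have : L x' = 1 := by
      change LinearMap.toMatrix bV bV (P ∘ₗ ((ad k g x') ∘ₗ V.subtype)) = 1
      rw [hP, LinearMap.toMatrix_id]
    rw [this]; simp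
  obtain ⟨s, hs⟩ := hf.both (PL_det L) ((hf2 x).2 (regular_of_ss hx1 hx2)) h1
  refine ⟨x + s • (x' - x), W.add_mem hxW (W.smul_mem _ (W.sub_mem hxW' hxW)),
    (hf2 _).1 (left_ne_zero_of_mul hs), ?_⟩
  rw [_root_.eq_bot_iff]
  rintro y ⟨hy1, hy2⟩
  have h2 := right_ne_zero_of_mul hs
  have h3 : (L (x + s • (x' - x))).mulVec (bV.repr ⟨y, hy2⟩) = 0 := by
    change (LinearMap.toMatrix bV bV (P ∘ₗ ((ad k g (x + s • (x' - x))) ∘ₗ V.subtype))).mulVec _ = 0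
    rw [LinearMap.toMatrix_mulVec_repr]
    have : (P ∘ₗ ((ad k g (x + s • (x' - x))) ∘ₗ V.subtype)) ⟨y, hy2⟩ = 0 := by
      change P ((ad k g (x + s • (x' - x))) y) = 0
      rw [LinearMap.mem_ker.1 hy1, map_zero]
    rw [this]; ext; simp
  have h4 := Matrix.eq_zero_of_mulVec_eq_zero h2 h3
  have h5 : (⟨y, hy2⟩ : V) = 0 := bV.repr.map_eq_zero_iff.1 (DFunLike.coe_injective h4)
  simpa using congrArg Subtype.val h5

namespace RD
variable {I' Φ' : Type*} [Fintype I'] [DecidableEq I'] [Fintype Φ'] [DecidableEq Φ']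

theorem zc_eq_t (R : RD k g I Φ) {y : g} (hy : IsRegular k y) {u : g ≃ₗ[k] g} (hu : u ∈ LA k g) {h : g}
    (hh : h ∈ R.t) (hyu : y = u h) (z : g) : z ∈ zc k g y ↔ u⁻¹ z ∈ R.t := by
  have h1 : ∀ z ∈ R.t, u z ∈ zc k g y := by
    intro z hz
    rw [zc, LinearMap.mem_ker, ad_apply, hyu, ← LA.map_lie hu, R.lie_t_t hh hz, map_zero]
  constructor
  · intro hz
    apply R.wt_zero_mem
    intro x hx
    apply u.injective
    rw [LA.map_lie hu, app_inv, map_zero]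
    exact zc_abelian hy (h1 x hx) hz
  · intro hz
    simpa using h1 _ hz

theorem cartan_conj (R : RD k g I Φ) (R' : RD k g I' Φ') :
    ∃ b ∈ IntG k g, ∀ z, z ∈ R'.t ↔ b z ∈ R.t := by
  obtain ⟨q, hq, h⟩ := R.generic
  obtain ⟨q', hq', h'⟩ := R'.generic
  obtain ⟨f, hf, hf2⟩ := PL_regular (k := k) (g := g)
  obtain ⟨x, hx⟩ := LieAlgebra.exists_isRegular k g
  have e1 : ∃ y, MvPolynomial.eval (R.B.repr y) q ≠ 0 := by
    by_contra hc
    push Not at hc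
    apply hq
    apply MvPolynomial.funext
    intro v
    have := hc (R.B.equivFun.symm v)
    have h2 : (R.B.repr (R.B.equivFun.symm v) : I ⊕ Φ → k) = v := by
      exact R.B.equivFun.apply_symm_apply v
    rw [h2] at this; simp [this]
  have e2 : ∃ y, MvPolynomial.eval (R'.B.repr y) q' ≠ 0 := by
    by_contra hc
    push Not at hc
    apply hq'
    apply MvPolynomial.funext
    intro v
    have := hc (R'.B.equivFun.symm v)
    have h2 : (R'.B.repr (R'.B.equivFun.symm v) : I' ⊕ Φ' → k) = v := by
      exact R'.B.equivFun.apply_symm_apply v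
    rw [h2] at this; simp [this]
  obtain ⟨y1, hy1⟩ := e1
  obtain ⟨y2, hy2⟩ := e2
  obtain ⟨s, hs⟩ := hf.both (PL_mv R.B q) ((hf2 x).2 hx) hy1
  obtain ⟨s', hs'⟩ := (hf.mul (PL_mv R.B q)).both (PL_mv R'.B q') hs hy2
  set y := x + s • (y1 - x) + s' • (y2 - (x + s • (y1 - x))) with hy
  have hr : IsRegular k y := (hf2 _).1 (left_ne_zero_of_mul (left_ne_zero_of_mul hs'))
  obtain ⟨u, hu, z, hz, hyu⟩ := h y (right_ne_zero_of_mul (left_ne_zero_of_mul hs'))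
  obtain ⟨u', hu', z', hz', hyu'⟩ := h' y (right_ne_zero_of_mul hs')
  refine ⟨u⁻¹ * u', Subgroup.mul_mem _ (Subgroup.inv_mem _ hu) hu', fun v => ?_⟩
  rw [LinearEquiv.mul_apply, ← R.zc_eq_t hr (IntG_le_LA hu) hz hyu, R'.zc_eq_t hr (IntG_le_LA hu') hz' hyu', inv_app]

end RD
end StepZero
end CL

set_option linter.all false
set_option linter.unusedSimpArgs false
set_option linter.unusedSectionVars false
namespace CL
section Construct
open LieAlgebra Module LieAlgebra.IsKilling LieModule
universe u v
variable {k : Type u} [Field k] [IsAlgClosed k] [CharZero k]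
variable {g : Type v} [LieRing g] [LieAlgebra k g] [FiniteDimensional k g]
  [LieAlgebra.IsSemisimple k g]

theorem exists_RD (H : LieSubalgebra k g) [H.IsCartanSubalgebra] :
    ∃ (I Φ : Type (max u v)) (_ : Fintype I) (_ : DecidableEq I) (_ : Fintype Φ) (_ : DecidableEq Φ)
      (R : RD k g I Φ), ∀ z, z ∈ R.t ↔ z ∈ H := by
  classical
  obtain ⟨b⟩ := (rootSystem H).nonempty_base
  have h0 : ∀ a : H.root, ∃ h e f : g, IsSl2Triple h e f ∧ e ∈ rootSpace H a.1 ∧ f ∈ rootSpace H (-a.1) :=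
    fun a => exists_isSl2Triple_of_weight_isNonZero (LieSubalgebra.isNonZero_coe_root a)
  choose hh ee ff hsl he hf using h0
  have hne : ∀ a, ee a ≠ 0 := fun a => (hsl a).e_ne_zero
  have hspan : ∀ (a : H.root) (y : g), y ∈ rootSpace H a.1 → ∃ c : k, y = c • ee a := by
    intro a y hy
    have h1 := finrank_rootSpace_eq_one a.1 (LieSubalgebra.isNonZero_coe_root a)
    obtain ⟨c, hc⟩ := (finrank_eq_one_iff_of_nonzero' (⟨ee a, he a⟩ : rootSpace H a.1)
      (by simpa [Subtype.ext_iff] using hne a)).1 h1 ⟨y, hy⟩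
    exact ⟨c, (congrArg Subtype.val hc).symm⟩
  have hroot : ∀ a : H.root, ∃ f : b.support → ℤ, (0 ≤ f ∨ f ≤ 0) ∧
      (rootSystem H).root a = ∑ j : b.support, f j • (rootSystem H).root j := by
    intro a
    obtain ⟨f, h1, h2, h3⟩ := b.exists_root_eq_sum_int a
    refine ⟨fun j => f j, ?_, ?_⟩
    · rcases h2 with h2 | h2
      · left; intro j; exact h2.le _
      · right; intro j; exact h2.le _
    · rw [h3, ← Finset.sum_coe_sort]
  choose n hn1 hn2 using hroot
  let ω : Basis b.support k H := b.toWeightBasis.dualBasis.map (evalEquiv k H).symm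
  have hω : ∀ i (φ : Dual k H), φ (ω i) = b.toWeightBasis.repr φ i := by
    intro i φ
    have : ω i = (evalEquiv k H).symm (b.toWeightBasis.dualBasis i) := by simp [ω]
    rw [this, apply_evalEquiv_symm_apply]
    simp
  have hωroot : ∀ (a : H.root) i, a.1 (ω i) = (n a i : k) := by
    intro a i
    have h1 : a.1 (ω i) = (rootSystem H).root a (ω i) := rfl
    rw [h1, hω, hn2]
    have h2 : ∀ j : b.support, (rootSystem H).root j = b.toWeightBasis j := by simp
    simp only [h2, map_sum, map_zsmul, Basis.repr_self]
    simp [Finsupp.single_apply]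
  let vv : b.support ⊕ H.root → g := Sum.elim (fun i => (ω i : g)) ee
  have hindep := LieModule.iSupIndep_genWeightSpace k H g
  rw [← LieSubmodule.iSupIndep_toSubmodule] at hindep
  have hinj : Function.Injective (fun a : H.root => (a.1 : H → k)) := by
    intro a a' h
    exact Subtype.ext (DFunLike.coe_injective h)
  have hli : LinearIndependent k vv := by
    apply LinearIndependent.sum_type
    · have := ω.linearIndependent.map' H.toSubmodule.subtype (Submodule.ker_subtype _)
      exact this
    · exact (hindep.comp hinj).linearIndependent _ (fun a => he a) hne
    · have h1 := hindep (0 : H → k)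
      refine h1.mono ?_ ?_
      · rw [Submodule.span_le]
        rintro _ ⟨i, rfl⟩
        have := toLieSubmodule_le_rootSpace_zero k g H (x := (ω i : g)) (by simp)
        exact this
      · rw [Submodule.span_le]
        rintro _ ⟨a, rfl⟩
        have hnz : (a.1 : H → k) ≠ 0 := by
          have : a.1.IsNonZero := LieSubalgebra.isNonZero_coe_root a
          exact this
        exact (le_iSup₂_of_le (f := fun (j : H → k) (_ : j ≠ 0) => (genWeightSpace g j).toSubmodule) (a.1 : H → k) hnz le_rfl) (he a)
  have hsp : ⊤ ≤ Submodule.span k (Set.range vv) := by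
    have h1 := cartan_sup_iSup_rootSpace_eq_top (K := k) (L := g) (H := H)
    have h2 := congrArg LieSubmodule.toSubmodule h1
    rw [LieSubmodule.sup_toSubmodule, LieSubmodule.top_toSubmodule] at h2
    rw [← h2]
    apply sup_le
    · intro x hx
      have hx' : x ∈ H := by simpa using hx
      have h3 : (⟨x, hx'⟩ : H) = ∑ i, ω.repr ⟨x, hx'⟩ i • ω i := (ω.sum_repr _).symm
      have h4 : x = ∑ i, ω.repr ⟨x, hx'⟩ i • (ω i : g) := by
        have := congrArg (H.toSubmodule.subtype) h3
        rw [map_sum] at this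
        exact this
      rw [h4]
      exact Submodule.sum_mem _ fun i _ => Submodule.smul_mem _ _ (Submodule.subset_span ⟨Sum.inl i, rfl⟩)
    · rw [LieSubmodule.iSup_toSubmodule]
      apply iSup_le
      intro α
      rw [LieSubmodule.iSup_toSubmodule]
      apply iSup_le
      intro hα y hy
      obtain ⟨c, rfl⟩ := hspan ⟨α, by simpa using hα⟩ y hy
      exact Submodule.smul_mem _ _ (Submodule.subset_span ⟨Sum.inr _, rfl⟩)
  let BB := Basis.mk hli hsp
  have hBl : ∀ i, BB (Sum.inl i) = (ω i : g) := by intro i; simp [BB, vv]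
  have hBr : ∀ a, BB (Sum.inr a) = ee a := by intro i; simp [BB, vv]
  have hnegmem : ∀ a : H.root, (-a.1) ∈ H.root := by
    intro a
    have : a.1.IsNonZero := LieSubalgebra.isNonZero_coe_root a
    simpa using this
  have hneg : ∀ a : H.root, ∃ c : k, ff a = c • ee ⟨-a.1, hnegmem a⟩ := by
    intro a
    apply hspan
    simpa using hf a
  choose cc hcc using hneg
  have hnuniq : ∀ (a : H.root) (f : b.support → ℤ), (∀ i, a.1 (ω i) = (f i : k)) → n a = f := by
    intro a f h
    ext i
    have := (hωroot a i).symm.trans (h i)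
    exact_mod_cast this
  have hninj : Function.Injective n := by
    intro a a' h
    have : (rootSystem H).root a = (rootSystem H).root a' := by rw [hn2, hn2, h]
    exact (rootSystem H).root.injective this
  have hns : ∀ i : b.support, n i = Pi.single i 1 := by
    intro i
    apply hnuniq
    intro j
    have h1 : (i : H.root).1 (ω j) = (rootSystem H).root i (ω j) := rfl
    rw [h1, hω, b.toWeightBasis_repr_root]
    simp [Finsupp.single_apply, Pi.single_apply, eq_comm]
  have hnn : ∀ a : H.root, n ⟨-a.1, hnegmem a⟩ = - n a := by
    intro a
    apply hnuniq
    intro j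
    have := hωroot a j
    simp [this]
  have hωr : ∀ i (a : H.root) (y : g), y ∈ rootSpace H a.1 → ⁅(ω i : g), y⁆ = (n a i : k) • y := by
    intro i a y hy
    have := lie_eq_smul_of_mem_rootSpace hy (ω i)
    rw [hωroot] at this
    exact this
  let RR : RD k g b.support H.root :=
    { B := BB
      n := n
      A := fun i j => b.cartanMatrix j i
      s := fun i => i.1
      f := fun i => ⟨-i.1.1, hnegmem i.1⟩
      F := fun i => ff i.1
      c := fun i => cc i.1
      hF := by intro i; rw [hBr]; exact hcc i.1
      n_inj := hninj
      n_ne := by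
        intro a h
        have := hn2 a
        rw [h] at this
        exact (rootSystem H).ne_zero a (by simpa using this)
      n_s := hns
      n_f := by intro i; rw [hnn, hns]
      pos := hn1
      red := by
        intro a i h
        have h1 : (rootSystem H).root a = n a i • (rootSystem H).root i := by
          conv_lhs => rw [hn2]
          rw [Finset.sum_eq_single i]
          · intro j _ hj; rw [h j hj, zero_smul]
          · simp
        have h2 := eq_neg_or_eq_of_eq_smul i.1.1 a.1 (LieSubalgebra.isNonZero_coe_root a) (n a i : k) (by
          have : ((rootSystem H).root a : H → k) = ((n a i • (rootSystem H).root i : Dual k H) : H → k) := by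
            rw [h1]
          have h5 : (a.1 : H → k) = ((rootSystem H).root a : H → k) := rfl
          rw [h5, this]
          ext x
          simp)
        rcases h2 with h2 | h2
        · right; exact Subtype.ext h2
        · left; exact Subtype.ext h2
      lie_tt := by
        intro i j
        rw [hBl, hBl]
        have : ⁅ω i, ω j⁆ = 0 := trivial_lie_zero _ _ _ _
        exact congrArg Subtype.val this
      lie_te := by
        intro i a
        rw [hBl, hBr]
        exact hωr i a _ (he a)
      lie_sF := by
        intro i
        rw [hBr, (hsl i.1).lie_e_f, (hsl i.1).h_eq_coroot (LieSubalgebra.isNonZero_coe_root i.1) (he i.1) (hf i.1)]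
        simp only [hBl]
        have h1 : (coroot i.1.1 : H) = ∑ j, ((b.cartanMatrix j i : ℤ) : k) • ω j := by
          rw [← ω.sum_repr (coroot i.1.1)]
          refine Finset.sum_congr rfl fun j _ => ?_
          congr 1
          have h2 : ω.repr (coroot i.1.1) j = (rootSystem H).root j (coroot i.1.1) := by
            conv_rhs => rw [← ω.sum_repr (coroot i.1.1)]
            rw [map_sum]
            simp only [map_smul, hω, b.toWeightBasis_repr_root]
            simp [Finsupp.single_apply, eq_comm]
          rw [h2]
          have h3 := b.algebraMap_cartanMatrixIn_apply ℤ j i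
          rw [← eq_intCast (algebraMap ℤ k), RootPairing.Base.cartanMatrix, h3]
          rfl
        have := congrArg (H.toSubmodule.subtype) h1
        rw [map_sum] at this
        exact this
      A_ii := by intro i; exact b.cartanMatrix_apply_same i
      A_det := by
        have h1 := b.cartanMatrix_nondegenerate
        rw [Matrix.nondegenerate_iff_det_ne_zero] at h1
        have h2 : (Matrix.of fun i j => b.cartanMatrix j i) = b.cartanMatrix.transpose := rfl
        rw [h2, Matrix.det_transpose]
        exact h1 }
  refine ⟨b.support, H.root, inferInstance, inferInstance, inferInstance, inferInstance, RR, fun z => ?_⟩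
  have hw : ∀ i, RR.w i = (ω i : g) := fun i => hBl i
  constructor
  · intro hz
    rw [RR.t_eq_sum hz]
    refine H.toSubmodule.sum_mem fun i _ => H.toSubmodule.smul_mem _ ?_
    rw [hw]; exact (ω i).2
  · intro hz
    have h3 : (⟨z, hz⟩ : H) = ∑ i, ω.repr ⟨z, hz⟩ i • ω i := (ω.sum_repr _).symm
    have h4 : z = ∑ i, ω.repr ⟨z, hz⟩ i • (ω i : g) := by
      have := congrArg (H.toSubmodule.subtype) h3
      rw [map_sum] at this
      exact this
    rw [h4]
    refine Submodule.sum_mem _ fun i _ => Submodule.smul_mem _ _ ?_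
    rw [← hw]; exact RR.w_mem i

theorem exists_RD_regular {x : g} (hx : IsRegular k x) :
    ∃ (I Φ : Type (max u v)) (_ : Fintype I) (_ : DecidableEq I) (_ : Fintype Φ) (_ : DecidableEq Φ)
      (R : RD k g I Φ), zc k g x = R.t := by
  haveI := engel_cartan hx
  obtain ⟨I, Φ, i1, i2, i3, i4, R, h⟩ := exists_RD (LieSubalgebra.engel k x)
  refine ⟨I, Φ, i1, i2, i3, i4, R, ?_⟩
  ext z
  rw [h, mem_engel_iff_zc hx]

end Construct
end CL

set_option linter.all false
set_option linter.unusedSimpArgs false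
set_option linter.unusedSectionVars false
namespace CL
section MatFun
open Module
variable {k : Type*} [Field k] [CharZero k]
variable {ι : Type*} [Fintype ι] [DecidableEq ι]

/-- derivation `X ↦ X N` of functions on matrices -/
noncomputable def mder (N : Matrix ι ι k) :
    Derivation k (MvPolynomial (ι × ι) k) (MvPolynomial (ι × ι) k) :=
  MvPolynomial.mkDerivation k fun p => ∑ d, MvPolynomial.X (p.1, d) * MvPolynomial.C (N d p.2)

theorem mder_X (N : Matrix ι ι k) (b c : ι) : mder N (MvPolynomial.X (b, c)) =
    ∑ d, MvPolynomial.X (b, d) * MvPolynomial.C (N d c) := by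
  rw [mder, MvPolynomial.mkDerivation_X]

/-- substitution `X ↦ X x` -/
noncomputable def msub (x : Matrix ι ι k) : MvPolynomial (ι × ι) k →ₐ[k] MvPolynomial (ι × ι) k :=
  MvPolynomial.aeval fun p => ∑ d, MvPolynomial.X (p.1, d) * MvPolynomial.C (x d p.2)

theorem msub_X (N : Matrix ι ι k) (b c : ι) : msub N (MvPolynomial.X (b, c)) =
    ∑ d, MvPolynomial.X (b, d) * MvPolynomial.C (N d c) := by
  rw [msub, MvPolynomial.aeval_X]

theorem msub_msub (x y : Matrix ι ι k) (p : MvPolynomial (ι × ι) k) :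
    msub x (msub y p) = msub (x * y) p := by
  have h : (msub x).comp (msub y) = msub (x * y) := by
    apply MvPolynomial.algHom_ext
    rintro ⟨b, c⟩
    rw [AlgHom.comp_apply, msub_X, msub_X, map_sum]
    have : ∀ a : k, msub x (MvPolynomial.C a) = MvPolynomial.C a := fun a => by
      simp [msub]
    simp only [map_mul, this, msub_X, Matrix.mul_apply, map_sum, Finset.mul_sum, Finset.sum_mul]
    rw [Finset.sum_comm]
    simp only [mul_assoc]
  rw [← h, AlgHom.comp_apply]

theorem msub_one (p : MvPolynomial (ι × ι) k) : msub (1 : Matrix ι ι k) p = p := by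
  have : msub (1 : Matrix ι ι k) = AlgHom.id k _ := by
    ext ⟨b, c⟩
    simp [msub_X, Matrix.one_apply]
  rw [this]; rfl

theorem mder_mder_X (N N' : Matrix ι ι k) (b c : ι) : mder N (mder N' (MvPolynomial.X (b, c))) =
    ∑ d, MvPolynomial.X (b, d) * MvPolynomial.C ((N * N') d c) := by
  rw [mder_X, map_sum]
  have h : ∀ d, mder N (MvPolynomial.X (b, d) * MvPolynomial.C (N' d c)) =
      ∑ i, MvPolynomial.X (b, i) * (MvPolynomial.C (N i d) * MvPolynomial.C (N' d c)) := by
    intro d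
    rw [Derivation.leibniz, MvPolynomial.derivation_C, smul_zero, zero_add, smul_eq_mul, mder_X,
      mul_comm, Finset.sum_mul]
    exact Finset.sum_congr rfl fun _ _ => mul_assoc _ _ _
  simp only [h]
  rw [Finset.sum_comm]
  refine Finset.sum_congr rfl fun i _ => ?_
  rw [Matrix.mul_apply, map_sum, Finset.mul_sum]
  simp only [map_mul]

theorem mder_comm (N N' : Matrix ι ι k) (p : MvPolynomial (ι × ι) k) :
    mder N (mder N' p) = mder N' (mder N p) + mder (N * N' - N' * N) p := by
  have : ⁅mder N, mder N'⁆ = mder (N * N' - N' * N) := by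
    apply MvPolynomial.derivation_ext
    rintro ⟨b, c⟩
    rw [Derivation.commutator_apply, mder_mder_X, mder_mder_X, mder_X, ← Finset.sum_sub_distrib]
    refine Finset.sum_congr rfl fun i _ => ?_
    rw [Matrix.sub_apply, map_sub, mul_sub]
  rw [← this, Derivation.commutator_apply, add_sub_cancel]

theorem mder_add (N N' : Matrix ι ι k) (p : MvPolynomial (ι × ι) k) :
    mder (N + N') p = mder N p + mder N' p := by
  have : mder (N + N') = mder N + mder N' := by
    apply MvPolynomial.derivation_ext
    rintro ⟨b, c⟩
    simp [mder_X, mul_add, Finset.sum_add_distrib]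
  rw [this]; rfl

theorem mder_smul (a : k) (N : Matrix ι ι k) (p : MvPolynomial (ι × ι) k) :
    mder (a • N) p = a • mder N p := by
  have : mder (a • N) = a • mder N := by
    apply MvPolynomial.derivation_ext
    rintro ⟨b, c⟩
    simp [mder_X, Finset.smul_sum, MvPolynomial.smul_eq_C_mul]
    exact Finset.sum_congr rfl fun _ _ => by ring
  rw [this]; rfl

/-- polynomial family substitution -/
noncomputable def mfam (M : ι → ι → Polynomial (MvPolynomial (ι × ι) k)) :
    MvPolynomial (ι × ι) k →ₐ[k] Polynomial (MvPolynomial (ι × ι) k) :=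
  MvPolynomial.aeval fun p => ∑ d, Polynomial.C (MvPolynomial.X (p.1, d)) * M d p.2

theorem mfam_X (M : ι → ι → Polynomial (MvPolynomial (ι × ι) k)) (b c : ι) :
    mfam M (MvPolynomial.X (b, c)) = ∑ d, Polynomial.C (MvPolynomial.X (b, d)) * M d c := by
  rw [mfam, MvPolynomial.aeval_X]

theorem mfam_C (M : ι → ι → Polynomial (MvPolynomial (ι × ι) k)) (a : k) :
    mfam M (MvPolynomial.C a) = Polynomial.C (MvPolynomial.C a) := by
  rw [mfam, MvPolynomial.aeval_C]; rfl

/-- exponential family -/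
noncomputable def mexp (n : ℕ) (N : Matrix ι ι k) (d c : ι) : Polynomial (MvPolynomial (ι × ι) k) :=
  ∑ j ∈ Finset.range (n + 1), Polynomial.monomial j (MvPolynomial.C ((j.factorial : k)⁻¹ * (N ^ j) d c))

theorem deriv_mexp (n : ℕ) (N : Matrix ι ι k) (hN : N ^ (n + 1) = 0) (d c : ι) :
    Polynomial.derivative (mexp n N d c) = ∑ d', mexp n N d d' * Polynomial.C (MvPolynomial.C (N d' c)) := by
  have h1 : ∑ d', mexp n N d d' * Polynomial.C (MvPolynomial.C (N d' c)) =
      ∑ j ∈ Finset.range (n + 1), Polynomial.monomial j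
        (MvPolynomial.C ((j.factorial : k)⁻¹ * (N ^ (j + 1)) d c)) := by
    simp only [mexp, Finset.sum_mul]
    rw [Finset.sum_comm]
    refine Finset.sum_congr rfl fun j _ => ?_
    simp only [Polynomial.monomial_mul_C, ← map_mul, ← map_sum, pow_succ, Matrix.mul_apply, Finset.mul_sum,
      mul_assoc]
  rw [h1, Finset.sum_range_succ, hN]
  simp only [mexp, Finset.sum_range_succ', map_add, map_sum, Polynomial.derivative_monomial]
  simp only [Matrix.zero_apply, mul_zero, map_zero, add_zero, Nat.cast_zero]
  refine Finset.sum_congr rfl fun j _ => ?_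
  rw [Nat.add_sub_cancel]
  congr 1
  have : ((j + 1 : ℕ) : MvPolynomial (ι × ι) k) = MvPolynomial.C ((j + 1 : ℕ) : k) := by simp
  rw [this, ← map_mul]
  congr 1
  rw [Nat.factorial_succ]
  have h2 : (j.factorial : k) ≠ 0 := by exact_mod_cast j.factorial_ne_zero
  have h3 : ((j + 1 : ℕ) : k) ≠ 0 := by exact_mod_cast Nat.succ_ne_zero j
  push_cast at h3 ⊢
  field_simp

theorem deriv_mfam (n : ℕ) (N : Matrix ι ι k) (hN : N ^ (n + 1) = 0) (p : MvPolynomial (ι × ι) k) :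
    Polynomial.derivative (mfam (mexp n N) p) = mfam (mexp n N) (mder N p) := by
  induction p using MvPolynomial.induction_on with
  | C a => rw [mfam_C, Polynomial.derivative_C, MvPolynomial.derivation_C, map_zero]
  | add p q hp hq => rw [map_add, map_add, map_add, map_add, hp, hq]
  | mul_X p i hp =>
    obtain ⟨b, c⟩ := i
    rw [map_mul, Polynomial.derivative_mul, hp, Derivation.leibniz, map_add]
    simp only [smul_eq_mul, map_mul, mder_X, mfam_X, map_sum, Polynomial.derivative_mul,
      Polynomial.derivative_C, zero_mul, zero_add, deriv_mexp n N hN, mfam_C]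
    rw [add_comm, mul_comm (∑ d, _)]
    congr 1
    · congr 1
      simp only [Finset.mul_sum, Finset.sum_mul]
      rw [Finset.sum_comm]
      exact Finset.sum_congr rfl fun _ _ => Finset.sum_congr rfl fun _ _ => by ring

theorem coeff_zero_mfam (n : ℕ) (N : Matrix ι ι k) (p : MvPolynomial (ι × ι) k) :
    (mfam (mexp n N) p).coeff 0 = p := by
  induction p using MvPolynomial.induction_on with
  | C a => rw [mfam_C]; simp
  | add p q hp hq => rw [map_add, Polynomial.coeff_add, hp, hq]
  | mul_X p i hp =>
    obtain ⟨b, c⟩ := i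
    rw [map_mul, Polynomial.mul_coeff_zero, hp, mfam_X]
    congr 1
    simp only [Polynomial.finset_sum_coeff, Polynomial.mul_coeff_zero, mexp, Polynomial.coeff_C_zero,
      Finset.sum_range_succ', Polynomial.coeff_add, Polynomial.coeff_monomial]
    simp [Matrix.one_apply]

theorem coeff_mfam (n : ℕ) (N : Matrix ι ι k) (hN : N ^ (n + 1) = 0) (p : MvPolynomial (ι × ι) k) (j : ℕ) :
    (mfam (mexp n N) p).coeff j = (j.factorial : k)⁻¹ • ((mder N : MvPolynomial (ι × ι) k →ₗ[k] MvPolynomial (ι × ι) k) ^ j) p := by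
  induction j generalizing p with
  | zero => simp [coeff_zero_mfam]
  | succ j ih =>
    have h1 := congrArg (fun q => Polynomial.coeff q j) (deriv_mfam n N hN p)
    simp only [Polynomial.coeff_derivative, ih] at h1
    rw [pow_succ, End.mul_apply, Nat.factorial_succ]
    have h3 : ((j : k) + 1) ≠ 0 := by exact_mod_cast Nat.succ_ne_zero j
    have h4 : (mfam (mexp n N) p).coeff (j + 1) * ((j : MvPolynomial (ι × ι) k) + 1) =
      ((j : k) + 1) • (mfam (mexp n N) p).coeff (j + 1) := by
      rw [MvPolynomial.smul_eq_C_mul]; simp [mul_comm]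
    rw [h4] at h1
    push_cast
    rw [mul_inv, mul_smul]
    rw [eq_inv_smul_iff₀ h3, h1]

theorem msub_exp_eq (n : ℕ) (N : Matrix ι ι k) (p : MvPolynomial (ι × ι) k) :
    msub (∑ j ∈ Finset.range (n + 1), (j.factorial : k)⁻¹ • N ^ j) p =
      (mfam (mexp n N) p).eval 1 := by
  induction p using MvPolynomial.induction_on with
  | C a => rw [mfam_C]; simp [msub]
  | add p q hp hq => rw [map_add, map_add, Polynomial.eval_add, hp, hq]
  | mul_X p i hp =>
    obtain ⟨b, c⟩ := i
    rw [map_mul, map_mul, Polynomial.eval_mul, hp, msub_X, mfam_X, Polynomial.eval_finset_sum]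
    congr 1
    refine Finset.sum_congr rfl fun d _ => ?_
    rw [Polynomial.eval_mul, Polynomial.eval_C, mexp, Polynomial.eval_finset_sum]
    congr 1
    simp [Matrix.sum_apply]

theorem msub_exp_mem (n : ℕ) (N : Matrix ι ι k) (hN : N ^ (n + 1) = 0)
    (P : Submodule k (MvPolynomial (ι × ι) k)) (hP : ∀ p ∈ P, mder N p ∈ P)
    {p : MvPolynomial (ι × ι) k} (hp : p ∈ P) :
    msub (∑ j ∈ Finset.range (n + 1), (j.factorial : k)⁻¹ • N ^ j) p ∈ P := by
  rw [msub_exp_eq, Polynomial.eval_eq_sum_range]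
  refine P.sum_mem fun j hj => ?_
  clear hj
  rw [coeff_mfam n N hN, one_pow, mul_one]
  refine P.smul_mem _ ?_
  induction j with
  | zero => simpa using hp
  | succ j ih => rw [pow_succ', End.mul_apply]; exact hP _ ih

end MatFun
end CL

set_option linter.all false
set_option linter.unusedSimpArgs false
set_option linter.unusedSectionVars false
namespace CL
section DerDet
open Module
variable {k : Type*} [Field k] [CharZero k]
variable {ι J : Type*} [Fintype ι] [DecidableEq ι] [Fintype J] [DecidableEq J]
variable {S : Type*} [CommRing S] [Algebra k S]

theorem der_prod (D : Derivation k S S) (s : Finset J) (f : J → S) :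
    D (∏ i ∈ s, f i) = ∑ i ∈ s, (∏ j ∈ s.erase i, f j) * D (f i) := by
  induction s using Finset.induction_on with
  | empty => simp
  | insert a s ha ih =>
    rw [Finset.prod_insert ha, Derivation.leibniz, ih, Finset.sum_insert ha, Finset.erase_insert ha,
      smul_eq_mul, smul_eq_mul, add_comm, Finset.mul_sum]
    congr 1
    refine Finset.sum_congr rfl fun i hi => ?_
    have : a ≠ i := fun h => ha (h ▸ hi)
    rw [Finset.erase_insert_of_ne this, Finset.prod_insert (by simp [ha]), mul_assoc]

theorem der_det (D : Derivation k S S) (M : Matrix J J S) :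
    D M.det = ∑ j, (M.updateCol j (fun a => D (M a j))).det := by
  simp only [Matrix.det_apply]
  rw [map_sum, Finset.sum_comm]
  refine Finset.sum_congr rfl fun σ _ => ?_
  rw [← Finset.smul_sum]
  have : D (Equiv.Perm.sign σ • ∏ i, M (σ i) i) = Equiv.Perm.sign σ • D (∏ i, M (σ i) i) := by
    rcases Int.units_eq_one_or (Equiv.Perm.sign σ) with h | h <;> rw [h] <;> simp
  rw [this, der_prod]
  congr 1
  refine Finset.sum_congr rfl fun j _ => ?_
  rw [← Finset.mul_prod_erase _ _ (Finset.mem_univ j), mul_comm]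
  congr 1
  · simp
  · refine Finset.prod_congr rfl fun i hi => ?_
    rw [Matrix.updateCol_ne (Finset.ne_of_mem_erase hi)]

theorem der_det_eq (D : Derivation k S S) (M : Matrix J J S) (Q : Matrix J J S)
    (h : ∀ a j, D (M a j) = ∑ i, Q i j * M a i) : D M.det = Q.trace * M.det := by
  rw [der_det, Matrix.trace, Finset.sum_mul]
  refine Finset.sum_congr rfl fun j _ => ?_
  simp only [h]
  exact Matrix.det_updateCol_sum M j fun i => Q i j

/-- minors as functions on matrices -/
noncomputable def mdet (r c : J → ι) : MvPolynomial (ι × ι) k :=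
  (Matrix.of fun a j => MvPolynomial.X (r a, c j) : Matrix J J (MvPolynomial (ι × ι) k)).det

theorem mdet_ne (r c : J → ι) (hr : Function.Injective r) (hc : Function.Injective c) :
    (mdet r c : MvPolynomial (ι × ι) k) ≠ 0 := by
  classical
  intro h
  have h1 := congrArg (MvPolynomial.eval
    (fun p : ι × ι => if ∃ j, p.1 = r j ∧ p.2 = c j then (1 : k) else 0)) h
  rw [mdet, RingHom.map_det, map_zero] at h1
  have : (MvPolynomial.eval (fun p : ι × ι => if ∃ j, p.1 = r j ∧ p.2 = c j then (1 : k) else 0)).mapMatrix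
    (Matrix.of fun a j => MvPolynomial.X (r a, c j)) = (1 : Matrix J J k) := by
    ext a j
    simp only [RingHom.mapMatrix_apply, Matrix.map_apply, Matrix.of_apply, MvPolynomial.eval_X, Matrix.one_apply]
    congr 1
    apply propext
    constructor
    · rintro ⟨i, h1, h2⟩; exact (hr h1).trans (hc h2).symm
    · rintro rfl; exact ⟨a, rfl, rfl⟩
  rw [this, Matrix.det_one] at h1
  exact one_ne_zero h1

theorem mder_mdet (N : Matrix ι ι k) (r c : J → ι) (Q : Matrix J J k)
    (h : ∀ d j, N d (c j) = ∑ i, if d = c i then Q i j else 0) :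
    mder N (mdet r c) = Q.trace • mdet r c := by
  rw [mdet, der_det_eq (mder N) _ (Q.map MvPolynomial.C)]
  · rw [MvPolynomial.smul_eq_C_mul]
    congr 1
    simp [Matrix.trace]
  · intro a j
    rw [Matrix.of_apply, mder_X]
    simp only [h, map_sum, Finset.mul_sum, Matrix.map_apply, Matrix.of_apply]
    rw [Finset.sum_comm]
    refine Finset.sum_congr rfl fun i _ => ?_
    rw [Finset.sum_eq_single (c i)]
    · simp [mul_comm]
    · intro b _ hb; simp [hb]
    · simp

theorem msub_mdet (x : Matrix ι ι k) (r c c' : J → ι) (q : J → k)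
    (h : ∀ d j, x d (c j) = if d = c' j then q j else 0) :
    msub x (mdet r c) = (∏ j, q j) • mdet r c' := by
  rw [mdet, AlgHom.map_det]
  have : (msub x).mapMatrix (Matrix.of fun a j => MvPolynomial.X (r a, c j)) =
     Matrix.of (fun a j => MvPolynomial.C (q j) * (Matrix.of fun a j => MvPolynomial.X (r a, c' j) :
        Matrix J J (MvPolynomial (ι × ι) k)) a j) := by
    ext a j : 2
    rw [AlgHom.mapMatrix_apply, Matrix.map_apply, Matrix.of_apply, msub_X, Finset.sum_eq_single (c' j)]
    · simp [h, mul_comm]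
    · intro b _ hb; simp [h, hb]
    · simp
  rw [this]
  rw [Matrix.det_mul_row (fun j => MvPolynomial.C (q j)), MvPolynomial.smul_eq_C_mul, map_prod]
  rfl
end DerDet
end CL

set_option linter.all false
set_option linter.unusedSimpArgs false
set_option linter.unusedSectionVars false
namespace CL
section GG
open LieAlgebra Module
variable {k : Type*} [Field k] [IsAlgClosed k] [CharZero k]
variable {g : Type*} [LieRing g] [LieAlgebra k g] [FiniteDimensional k g]
  [LieAlgebra.IsSemisimple k g]
variable {I Φ : Type*} [Fintype I] [DecidableEq I] [Fintype Φ] [DecidableEq Φ]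

theorem exp_inv_mul {n : g} (hn : IsNilpotent (ad k g n)) :
    expEnd k g (ad k g (-n)) * expEnd k g (ad k g n) = 1 := by
  letI : Module ℚ g := Module.compHom g (algebraMap ℚ k)
  haveI : IsScalarTower ℚ k g := ⟨fun q a x => by
    change (q • a) • x = (algebraMap ℚ k q) • (a • x)
    rw [smul_smul, Algebra.smul_def]⟩
  letI : Module ℚ (End k g) := Module.compHom (End k g) (algebraMap ℚ k)
  have h2 : IsNilpotent (ad k g (-n)) := by rw [map_neg]; exact hn.neg
  rw [expEnd_eq_exp hn, expEnd_eq_exp h2, map_neg]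
  exact IsNilpotent.exp_neg_mul_exp_self hn

theorem IntG_ind {P : (g ≃ₗ[k] g) → Prop} (h1 : P 1) (hm : ∀ a b, P a → P b → P (a * b))
    (he : ∀ (n : g) (τ : g ≃ₗ[k] g), IsNilpotent (ad k g n) →
      (τ : g →ₗ[k] g) = expEnd k g (ad k g n) → P τ) {a : g ≃ₗ[k] g} (ha : a ∈ IntG k g) : P a := by
  rw [IntG] at ha
  induction ha using Subgroup.closure_induction'' with
  | one => exact h1
  | mem x hx => obtain ⟨n, hn, h⟩ := hx; exact he n x hn h
  | mul x y _ _ h h' => exact hm _ _ h h'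
  | inv_mem x hx =>
    obtain ⟨n, hn, h⟩ := hx
    have h2 : IsNilpotent (ad k g (-n)) := by rw [map_neg]; exact hn.neg
    refine he (-n) _ h2 ?_
    ext z
    have h3 := exp_inv_mul hn
    have h4 := congrArg (fun f => f (x⁻¹ z)) h3
    simp only [End.mul_apply, End.one_apply] at h4
    have h5 : expEnd k g (ad k g n) (x⁻¹ z) = z := by rw [← h]; simp
    rw [h5] at h4
    rw [h4]; rfl

namespace RD
variable (R : RD k g I Φ)

/-- matrix of ad -/
noncomputable def adm (y : g) : Matrix (I ⊕ Φ) (I ⊕ Φ) k := LinearMap.toMatrix R.B R.B (ad k g y)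
/-- matrix of an automorphism -/
noncomputable def am (a : g ≃ₗ[k] g) : Matrix (I ⊕ Φ) (I ⊕ Φ) k := LinearMap.toMatrix R.B R.B (a : g →ₗ[k] g)

theorem adm_apply (y : g) (d b : I ⊕ Φ) : R.adm y d b = R.B.repr ⁅y, R.B b⁆ d := by
  rw [adm, LinearMap.toMatrix_apply, ad_apply]

theorem am_apply (a : g ≃ₗ[k] g) (d b : I ⊕ Φ) : R.am a d b = R.B.repr (a (R.B b)) d := by
  rw [am, LinearMap.toMatrix_apply]; rfl

theorem am_mul (a b : g ≃ₗ[k] g) : R.am (a * b) = R.am a * R.am b := by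
  rw [am, am, am, ← LinearMap.toMatrix_mul]; rfl

theorem am_one : R.am 1 = 1 := by
  rw [am]; exact LinearMap.toMatrix_id R.B

theorem adm_lie (y z : g) : R.adm ⁅y, z⁆ = R.adm y * R.adm z - R.adm z * R.adm y := by
  simp only [adm, ← LinearMap.toMatrix_mul, ← map_sub]
  congr 1
  ext z'
  simp

/-- the derivation attached to an element -/
noncomputable def dl : g →ₗ[k] End k (MvPolynomial ((I ⊕ Φ) × (I ⊕ Φ)) k) where
  toFun y := (mder (R.adm y) : MvPolynomial ((I ⊕ Φ) × (I ⊕ Φ)) k →ₗ[k] MvPolynomial ((I ⊕ Φ) × (I ⊕ Φ)) k)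
  map_add' y z := by
    refine LinearMap.ext fun p => ?_; simp only [LinearMap.add_apply, Derivation.coeFn_coe]; rw [← mder_add]; simp [adm]
  map_smul' c y := by
    refine LinearMap.ext fun p => ?_; simp only [LinearMap.smul_apply, Derivation.coeFn_coe, RingHom.id_apply]
    rw [← mder_smul]; simp [adm]

theorem dl_apply (y : g) (p) : R.dl y p = mder (R.adm y) p := rfl

theorem dl_comm (y z : g) (p) : R.dl y (R.dl z p) = R.dl z (R.dl y p) + R.dl ⁅y, z⁆ p := by
  simp only [dl_apply]; rw [mder_comm, adm_lie]

/-- descendants of a highest weight vector -/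
inductive Wd (ν0 : I → ℤ) (D : MvPolynomial ((I ⊕ Φ) × (I ⊕ Φ)) k) :
    (I → ℤ) → MvPolynomial ((I ⊕ Φ) × (I ⊕ Φ)) k → Prop
  | base : Wd ν0 D ν0 D
  | step (ν p a) : Wd ν0 D ν p → R.n a ≤ 0 → Wd ν0 D (ν + R.n a) (R.dl (R.e a) p)

variable {ν0 : I → ℤ} {D : MvPolynomial ((I ⊕ Φ) × (I ⊕ Φ)) k}

theorem Wd.le {ν p} (h : R.Wd ν0 D ν p) : ν ≤ ν0 := by
  induction h with
  | base => exact le_refl _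
  | step ν p a _ h ih => exact (add_le_add ih h).trans_eq (add_zero _)

theorem Wd.eig (hD : ∀ j, R.dl (R.w j) D = (ν0 j : k) • D) {ν p} (h : R.Wd ν0 D ν p) (j : I) :
    R.dl (R.w j) p = (ν j : k) • p := by
  induction h with
  | base => exact hD j
  | step ν p a _ h ih =>
    rw [dl_comm, ih, R.lie_t_e (R.w_mem j), R.al_w, map_smul, map_smul, LinearMap.smul_apply, ← add_smul]
    simp

/-- the generated module -/
noncomputable def Md (ν0 : I → ℤ) (D : MvPolynomial ((I ⊕ Φ) × (I ⊕ Φ)) k) :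
    Submodule k (MvPolynomial ((I ⊕ Φ) × (I ⊕ Φ)) k) := Submodule.span k {p | ∃ ν, R.Wd ν0 D ν p}

theorem Md_neg {a : Φ} (ha : R.n a ≤ 0) {p} (hp : p ∈ R.Md ν0 D) : R.dl (R.e a) p ∈ R.Md ν0 D := by
  induction hp using Submodule.span_induction with
  | mem p h => obtain ⟨ν, h⟩ := h; exact Submodule.subset_span ⟨_, Wd.step ν p a h ha⟩
  | zero => simp
  | add p q _ _ hp hq => rw [map_add]; exact add_mem hp hq
  | smul c p _ hp => rw [map_smul]; exact Submodule.smul_mem _ _ hp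

theorem Wd.stab (hD : ∀ j, R.dl (R.w j) D = (ν0 j : k) • D)
    (hD' : ∀ a, 0 ≤ R.n a → ∃ c : k, R.dl (R.e a) D = c • D) {ν p} (h : R.Wd ν0 D ν p) (z : g) :
    R.dl z p ∈ R.Md ν0 D := by
  have hDM : D ∈ R.Md ν0 D := Submodule.subset_span ⟨_, Wd.base⟩
  induction h generalizing z with
  | base =>
    rw [← R.B.sum_repr z, map_sum, LinearMap.sum_apply]
    refine Submodule.sum_mem _ fun b _ => ?_
    rw [map_smul, LinearMap.smul_apply]
    refine Submodule.smul_mem _ _ ?_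
    rcases b with j | a
    · have := hD j; rw [w] at this; rw [this]; exact Submodule.smul_mem _ _ hDM
    · rcases R.pos a with h | h
      · obtain ⟨c, hc⟩ := hD' a h
        rw [e] at hc; rw [hc]; exact Submodule.smul_mem _ _ hDM
      · exact R.Md_neg h hDM
  | step ν p a _ h ih =>
    rw [dl_comm]
    exact add_mem (R.Md_neg h (ih z)) (ih _)

theorem Md_stab (hD : ∀ j, R.dl (R.w j) D = (ν0 j : k) • D)
    (hD' : ∀ a, 0 ≤ R.n a → ∃ c : k, R.dl (R.e a) D = c • D) {p} (hp : p ∈ R.Md ν0 D) (z : g) :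
    R.dl z p ∈ R.Md ν0 D := by
  induction hp using Submodule.span_induction with
  | mem p h => obtain ⟨ν, h⟩ := h; exact h.stab R hD hD' z
  | zero => simp
  | add p q _ _ hp hq => rw [map_add]; exact add_mem hp hq
  | smul c p _ hp => rw [map_smul]; exact Submodule.smul_mem _ _ hp

theorem Md_stab_G (hD : ∀ j, R.dl (R.w j) D = (ν0 j : k) • D)
    (hD' : ∀ a, 0 ≤ R.n a → ∃ c : k, R.dl (R.e a) D = c • D) {a : g ≃ₗ[k] g} (ha : a ∈ IntG k g) :
    ∀ p ∈ R.Md ν0 D, msub (R.am a) p ∈ R.Md ν0 D := by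
  refine IntG_ind (P := fun a => ∀ p ∈ R.Md ν0 D, msub (R.am a) p ∈ R.Md ν0 D) ?_ ?_ ?_ ha
  · intro p hp; rw [am_one, msub_one]; exact hp
  · intro a b ha hb p hp
    rw [am_mul, ← msub_msub]; exact ha _ (hb _ hp)
  · intro n τ hn hτ p hp
    have : R.am τ = ∑ j ∈ Finset.range (finrank k g + 1), (j.factorial : k)⁻¹ • (R.adm n) ^ j := by
      rw [am, hτ, expEnd, map_sum]
      refine Finset.sum_congr rfl fun j _ => ?_
      rw [map_smul, adm, LinearMap.toMatrix_pow]
    rw [this]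
    apply msub_exp_mem _ _ _ _ _ hp
    · rw [adm, LinearMap.toMatrix_pow, pow_big hn (Nat.le_succ _), map_zero]
    · intro p hp; exact R.Md_stab hD hD' hp n

theorem Md_eig (hD : ∀ j, R.dl (R.w j) D = (ν0 j : k) • D) {p} (hp : p ∈ R.Md ν0 D) (h0 : p ≠ 0)
    {j : I} {μ : ℤ} (h : R.dl (R.w j) p = (μ : k) • p) : μ ≤ ν0 j := by
  by_contra hlt
  have h1 : R.Md ν0 D ≤ ⨆ l, ⨆ (_ : l ≠ (μ : k)), End.eigenspace (R.dl (R.w j)) l := by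
    rw [Md, Submodule.span_le]
    rintro q ⟨ν, hq⟩
    have h2 : ((ν j : ℤ) : k) ≠ μ := by
      intro h
      have := Int.cast_injective h
      have : ν j ≤ ν0 j := hq.le R j
      omega
    refine Submodule.mem_iSup_of_mem _ (Submodule.mem_iSup_of_mem h2 ?_)
    rw [End.mem_eigenspace_iff]; exact hq.eig R hD j
  have h3 := (Module.End.eigenspaces_iSupIndep (R.dl (R.w j))) (μ : k)
  rw [Submodule.disjoint_def] at h3
  exact h0 (h3 p (End.mem_eigenspace_iff.2 h) (h1 hp))

end RD
end GG
end CL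

set_option linter.all false
set_option linter.unusedSimpArgs false
set_option linter.unusedSectionVars false
namespace CL
section GG
open LieAlgebra Module
variable {k : Type*} [Field k] [IsAlgClosed k] [CharZero k]
variable {g : Type*} [LieRing g] [LieAlgebra k g] [FiniteDimensional k g]
  [LieAlgebra.IsSemisimple k g]
variable {I Φ : Type*} [Fintype I] [DecidableEq I] [Fintype Φ] [DecidableEq Φ]

namespace RD
variable (R : RD k g I Φ)

theorem al_sum {α : Type*} (s : Finset α) (c : α → ℤ) (μ : α → I → ℤ) (x : g) :
    R.al (∑ a ∈ s, c a • μ a) x = ∑ a ∈ s, (c a : k) * R.al (μ a) x := by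
  simp only [al_apply, Finset.sum_apply, Finset.mul_sum, Pi.smul_apply, smul_eq_mul]
  rw [Finset.sum_comm]
  refine Finset.sum_congr rfl fun i _ => ?_
  push_cast
  rw [Finset.sum_mul]
  exact Finset.sum_congr rfl fun _ _ => by ring

theorem nonneg_of_pos {a : Φ} {i : I} (h : 0 < R.n a i) : 0 ≤ R.n a := by
  rcases R.pos a with h1 | h1
  · exact h1
  · exact absurd (h1 i) (by simpa using h)

theorem exists_pos {a : Φ} (h : 0 ≤ R.n a) : ∃ i, 0 < R.n a i := by
  by_contra h1
  push Not at h1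
  exact R.n_ne a (le_antisymm h1 h)

theorem s_pos (i : I) : 0 ≤ R.n (R.s i) := by
  rw [R.n_s]; intro j; rw [Pi.single_apply]; split_ifs <;> simp

theorem s_inj : Function.Injective R.s := by
  intro i j h
  have := congrArg (fun a => R.n a i) h
  simp only [R.n_s, Pi.single_apply] at this
  by_contra hij
  simp [hij] at this

variable {R}
section
variable {φ : g ≃ₗ[k] g} {π : Equiv.Perm Φ}

theorem n_perm (hφ : R.Nt φ)
    (hπ : ∀ a, ∀ x ∈ R.t, R.al (R.n (π a)) (φ x) = R.al (R.n a) x)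
    (a : Φ) : R.n (π a) = ∑ i, R.n a i • R.n (π (R.s i)) := by
  apply R.al_inj
  intro x hx
  have hy : φ⁻¹ x ∈ R.t := (hφ.inv R).2 x |>.2 hx
  have hx' : φ (φ⁻¹ x) = x := app_inv _ _
  rw [al_sum, ← hx', hπ a _ hy, R.al_eq_sum]
  refine Finset.sum_congr rfl fun i _ => ?_
  rw [hπ _ _ hy, R.n_s]


theorem pos_symm (hφ : R.Nt φ)
    (hπ : ∀ a, ∀ x ∈ R.t, R.al (R.n (π a)) (φ x) = R.al (R.n a) x)
    (hp : ∀ a, 0 ≤ R.n a → 0 ≤ R.n (π a))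
    (a : Φ) (ha : 0 ≤ R.n a) : 0 ≤ R.n (π.symm a) := by
  classical
  let P : Finset Φ := Finset.univ.filter fun a => 0 ≤ R.n a
  have h1 : P.image π = P := by
    apply Finset.eq_of_subset_of_card_le
    · intro b hb
      obtain ⟨c, hc, rfl⟩ := Finset.mem_image.1 hb
      simp only [P, Finset.mem_filter, Finset.mem_univ, true_and] at hc ⊢
      exact hp c hc
    · rw [Finset.card_image_of_injective _ π.injective]
  have h2 : a ∈ P.image π := by rw [h1]; simpa [P] using ha
  obtain ⟨c, hc, rfl⟩ := Finset.mem_image.1 h2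
  simpa [P] using hc

theorem perm_simple (hφ : R.Nt φ)
    (hπ : ∀ a, ∀ x ∈ R.t, R.al (R.n (π a)) (φ x) = R.al (R.n a) x)
    (hp : ∀ a, 0 ≤ R.n a → 0 ≤ R.n (π a))
    : ∃ σ : Equiv.Perm I, (∀ i, π (R.s i) = R.s (σ i)) ∧
    ∀ a i, R.n (π a) (σ i) = R.n a i := by
  have key : ∀ i, ∃ j, π (R.s j) = R.s i := by
    intro i
    set b := π.symm (R.s i) with hb
    have hbp : 0 ≤ R.n b := pos_symm hφ hπ hp _ (R.s_pos i)
    have hπb : π b = R.s i := by rw [hb]; exact π.apply_symm_apply _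
    have h1 : (∑ l, R.n (R.s i) l) = ∑ j, R.n b j * ∑ l, R.n (π (R.s j)) l := by
      rw [← hπb, n_perm hφ hπ b]
      simp only [Finset.sum_apply, Pi.smul_apply, smul_eq_mul]
      rw [Finset.sum_comm]
      simp only [Finset.mul_sum]
    rw [R.n_s, Finset.sum_pi_single', if_pos (Finset.mem_univ _)] at h1
    have hge : ∀ j, 1 ≤ ∑ l, R.n (π (R.s j)) l := by
      intro j
      have hj := hp _ (R.s_pos j)
      obtain ⟨l, hl⟩ := R.exists_pos hj
      have := Finset.single_le_sum (f := fun l => R.n (π (R.s j)) l) (fun l _ => hj l) (Finset.mem_univ l)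
      omega
    obtain ⟨j, hj⟩ := R.exists_pos hbp
    have hterm : ∀ l, R.n b l ≤ R.n b l * ∑ l', R.n (π (R.s l)) l' := fun l =>
      le_mul_of_one_le_right (hbp l) (hge l)
    have hz : ∀ l, l ≠ j → R.n b l = 0 := by
      intro l hl
      by_contra hne
      have hl0 : 0 < R.n b l := lt_of_le_of_ne (hbp l) (Ne.symm hne)
      have h2 : ∑ l' ∈ {j, l}, R.n b l' * ∑ l'', R.n (π (R.s l')) l'' ≤ 1 := by
        rw [h1]
        apply Finset.sum_le_sum_of_subset_of_nonneg (Finset.subset_univ _)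
        intro q _ _
        exact (hbp q).trans (hterm q)
      rw [Finset.sum_pair hl.symm] at h2
      have := hterm l
      have := hterm j
      omega
    rcases R.red b j hz with h | h
    · exact ⟨j, by rw [← h, hπb]⟩
    · rw [h, R.n_f] at hj; simp at hj
  choose σ' hσ' using key
  have hinj : Function.Injective σ' := by
    intro i j h
    apply R.s_inj
    rw [← hσ' i, ← hσ' j, h]
  let σ := Equiv.ofBijective σ' (Finite.injective_iff_bijective.1 hinj)
  have hσ : ∀ i, π (R.s i) = R.s (σ.symm i) := by
    intro i
    have := hσ' (σ.symm i)
    rw [← this]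
    congr 2
    exact (σ.apply_symm_apply i).symm
  refine ⟨σ.symm, hσ, fun a i => ?_⟩
  rw [n_perm hφ hπ a]
  simp only [hσ, R.n_s, Finset.sum_apply, Pi.smul_apply, Pi.single_apply, smul_eq_mul, mul_ite, mul_one,
    mul_zero, EmbeddingLike.apply_eq_iff_eq]
  simp
end

variable (R)
/-- roots with positive coefficient -/
abbrev JJ (i : I) : Type _ := {a : Φ // 0 < R.n a i}

/-- weights of the minors -/
def NN (i j : I) : ℤ := ∑ a : R.JJ i, R.n a.1 j

theorem dl_mdet_t {J : Type*} [Fintype J] [DecidableEq J] (r : J → I ⊕ Φ) (c : J → Φ) (j : I) :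
    R.dl (R.w j) (mdet r fun a => Sum.inr (c a)) =
      ((∑ a, R.n (c a) j : ℤ) : k) • mdet r fun a => Sum.inr (c a) := by
  rw [dl_apply, mder_mdet _ _ _ (Matrix.diagonal fun a => (R.n (c a) j : k))]
  · simp [Matrix.trace_diagonal]
  · intro d a
    rw [adm_apply]
    have := R.lie_t_e (R.w_mem j) (c a)
    rw [e] at this
    rw [this, R.al_w]
    rw [Finset.sum_eq_single a]
    · simp only [map_smul, Basis.repr_self, Finsupp.smul_apply, Finsupp.single_apply, Matrix.diagonal_apply_eq, eq_comm]
      split_ifs <;> simp_all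
    · intro b _ hb; simp [Matrix.diagonal_apply_ne _ hb]
    · simp

theorem dl_mdet_e (i : I) {b : Φ} (hb : 0 ≤ R.n b) (r : R.JJ i → I ⊕ Φ) : ∃ c : k,
    R.dl (R.e b) (mdet r fun a : R.JJ i => Sum.inr a.1) = c • mdet r fun a : R.JJ i => Sum.inr a.1 := by
  rw [dl_apply]
  refine ⟨_, mder_mdet _ _ _ (Matrix.of fun a' a : R.JJ i => R.B.repr ⁅R.e b, R.B (Sum.inr a.1)⁆ (Sum.inr a'.1)) ?_⟩
  intro d a
  rw [adm_apply]
  by_cases h : R.B.repr ⁅R.e b, R.B (Sum.inr a.1)⁆ d = 0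
  · rw [h]
    symm
    refine Finset.sum_eq_zero fun a' _ => ?_
    split_ifs with h1
    · rw [Matrix.of_apply, ← h1]; exact h
    · rfl
  · have h1 := congrFun (R.B_lie_B (Sum.inr b) (Sum.inr a.1) d h) i
    have h2 := a.2
    have h3 : 0 ≤ R.n b i := hb i
    rcases d with d | d
    · simp only [wt, Pi.add_apply, Pi.zero_apply] at h1; omega
    · simp only [wt, Pi.add_apply] at h1
      rw [Finset.sum_eq_single (⟨d, by omega⟩ : R.JJ i)]
      · simp
      · intro a' _ ha'
        rw [if_neg]
        intro h4
        exact ha' (Subtype.ext (Sum.inr_injective h4).symm)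
      · simp

theorem trivial_of_pos {a : g ≃ₗ[k] g} (ha : a ∈ IntG k g) (hN : R.Nt a)
    {π : Equiv.Perm Φ} (hπ : ∀ b, ∀ x ∈ R.t, R.al (R.n (π b)) (a x) = R.al (R.n b) x)
    {c : Φ → k} (hc0 : ∀ b, c b ≠ 0) (hc : ∀ b, a (R.e b) = c b • R.e (π b))
    (hp : ∀ b, 0 ≤ R.n b → 0 ≤ R.n (π b)) : ∀ x ∈ R.t, a x = x := by
  obtain ⟨σ, hσ, hσ2⟩ := perm_simple hN hπ hp
  have h1 : ∀ i j, R.NN (σ i) j ≤ R.NN i j := by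
    intro i j
    let r : R.JJ i → I ⊕ Φ := fun a => Sum.inr a.1
    have hr : Function.Injective r := fun a b h => Subtype.ext (Sum.inr_injective h)
    have hD := fun j => R.dl_mdet_t r (fun a => a.1) j
    have hD' := fun b (hb : 0 ≤ R.n b) => R.dl_mdet_e i hb r
    have hM := R.Md_stab_G (ν0 := R.NN i) hD hD' ha _ (Submodule.subset_span ⟨_, Wd.base⟩)
    rw [msub_mdet (R.am a) r _ (fun b => Sum.inr (π b.1)) (fun b => c b.1)] at hM
    · have h0 : (∏ j : R.JJ i, c j.1) ≠ 0 := Finset.prod_ne_zero_iff.2 fun _ _ => hc0 _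
      have hM' := (Submodule.smul_mem_iff _ h0).1 hM
      have := R.Md_eig hD hM' (mdet_ne _ _ hr fun a b h => Subtype.ext (π.injective (Sum.inr_injective h)))
        (R.dl_mdet_t r (fun a => π a.1) j)
      refine le_trans (le_of_eq ?_) this
      rw [NN]
      symm
      refine Fintype.sum_equiv (π.subtypeEquiv fun b => by rw [hσ2]) _ _ fun b => rfl
    · intro d b
      rw [am_apply]
      have := hc b.1
      rw [e, e] at this
      rw [this]
      simp only [map_smul, Basis.repr_self, Finsupp.smul_apply, Finsupp.single_apply, eq_comm]
      split_ifs <;> simp_all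
  have h2 : ∀ i j, R.NN (σ i) j = R.NN i j := by
    intro i j
    have := (Finset.sum_eq_sum_iff_of_le (s := Finset.univ) (f := fun i => R.NN (σ i) j)
      (g := fun i => R.NN i j) fun i _ => h1 i j).1 (Equiv.sum_comp σ fun i => R.NN i j)
    exact this i (Finset.mem_univ i)
  have h3 : ∀ i, σ i = i := by
    intro i
    by_contra hne
    have h4 := h2 i i
    have e1 : ∀ l, R.NN l i = ∑ b, if 0 < R.n b l then R.n b i else 0 := by
      intro l
      rw [NN, ← Finset.sum_filter]
      exact (Finset.sum_subtype (Finset.univ.filter fun b => 0 < R.n b l) (by simp) (fun b => R.n b i)).symm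
    rw [e1, e1] at h4
    refine absurd h4 (ne_of_lt ?_)
    apply Finset.sum_lt_sum
    · intro b _
      split_ifs with q1 q2
      · exact le_refl _
      · omega
      · omega
      · exact le_refl _
    · refine ⟨R.s i, Finset.mem_univ _, ?_⟩
      simp [R.n_s, Pi.single_apply, hne]
  intro x hx
  apply R.t_ext ((hN.2 x).2 hx) hx
  intro i
  have := hπ (R.s i) x hx
  rw [hσ, h3, R.n_s] at this
  exact this

end RD
end GG
end CL

set_option linter.all false
set_option linter.unusedSimpArgs false
set_option linter.unusedSectionVars false
namespace CL
section GG
open LieAlgebra Module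
variable {k : Type*} [Field k] [IsAlgClosed k] [CharZero k]
variable {g : Type*} [LieRing g] [LieAlgebra k g] [FiniteDimensional k g]
  [LieAlgebra.IsSemisimple k g]
variable {I Φ : Type*} [Fintype I] [DecidableEq I] [Fintype Φ] [DecidableEq Φ]

theorem exists_exp3 (n : g) (hn : IsNilpotent (ad k g n)) :
    ∃ τ ∈ IntG k g, (∀ x, ⁅n, ⁅n, x⁆⁆ = 0 → τ x = x + ⁅n, x⁆) ∧
      ∀ x, ⁅n, ⁅n, ⁅n, x⁆⁆⁆ = 0 → τ x = x + ⁅n, x⁆ + (2 : k)⁻¹ • ⁅n, ⁅n, x⁆⁆ := by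
  obtain ⟨τ, hτ, h1, _⟩ := exists_exp n hn
  have h2 : ∀ x, τ x = expEnd k g (ad k g n) x := fun x => by rw [← h1]; rfl
  refine ⟨τ, hτ, fun x hx => ?_, fun x hx => ?_⟩
  · rw [h2, expEnd_apply hn (j := 2) (by simpa [pow_succ] using hx)]
    simp [Finset.sum_range_succ]
  · rw [h2, expEnd_apply hn (j := 3) (by simpa [pow_succ] using hx)]
    simp [Finset.sum_range_succ, pow_succ]

namespace RD
variable (R : RD k g I Φ)

theorem F_nilp (i : I) (c : k) : IsNilpotent (ad k g (c • R.F i)) := by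
  rw [R.hF, smul_smul]; exact R.e_nilp _ _

theorem h_mem (i : I) : R.h i ∈ R.t := by
  rw [h]; exact Submodule.sum_mem _ fun j _ => Submodule.smul_mem _ _ (R.w_mem j)

theorem lie_eF (i : I) : ⁅R.e (R.s i), R.F i⁆ = R.h i := R.lie_sF i

theorem lie_tF {x : g} (hx : x ∈ R.t) (i : I) : ⁅x, R.F i⁆ = - R.al (Pi.single i 1) x • R.F i := by
  have := R.lie_t_e hx (R.f i)
  rw [R.hF, lie_smul]
  rw [e] at this
  rw [this, R.n_f, R.al_neg, smul_comm]

theorem lie_ts {x : g} (hx : x ∈ R.t) (i : I) :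
    ⁅x, R.e (R.s i)⁆ = R.al (Pi.single i 1) x • R.e (R.s i) := by
  rw [R.lie_t_e hx, R.n_s]

theorem al_h (μ : I → ℤ) (i : I) : R.al μ (R.h i) = ((∑ j, μ j * R.A i j : ℤ) : k) := by
  rw [h, map_sum]
  simp [R.al_w, mul_comm]

theorem al_hi (i : I) : R.al (Pi.single i 1) (R.h i) = 2 := by
  rw [al_h]
  simp [Pi.single_apply, R.A_ii]

theorem exists_sig (i : I) : ∃ σ ∈ IntG k g, ∀ x ∈ R.t,
    σ x = x - R.al (Pi.single i 1) x • R.h i := by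
  obtain ⟨u, hu, u2, u3⟩ := exists_exp3 ((1 : k) • R.e (R.s i)) (R.e_nilp _ _)
  obtain ⟨v, hv, v2, v3⟩ := exists_exp3 ((-1 : k) • R.F i) (R.F_nilp _ _)
  refine ⟨u * v * u, mul_mem (mul_mem hu hv) hu, fun x hx => ?_⟩
  set E := R.e (R.s i)
  set F := R.F i
  set H := R.h i
  have hEF : ⁅E, F⁆ = H := R.lie_eF i
  have hFE : ⁅F, E⁆ = -H := by rw [← lie_skew, hEF]
  have hEx : ∀ x ∈ R.t, ⁅E, x⁆ = - R.al (Pi.single i 1) x • E := fun x hx => by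
    rw [← lie_skew, R.lie_ts hx]; simp [E]
  have hFx : ∀ x ∈ R.t, ⁅F, x⁆ = R.al (Pi.single i 1) x • F := fun x hx => by
    rw [← lie_skew, R.lie_tF hx]; simp [F]
  have hEH : ⁅E, H⁆ = -(2 : k) • E := by rw [hEx _ (R.h_mem i), R.al_hi]
  have hFH : ⁅F, H⁆ = (2 : k) • F := by rw [hFx _ (R.h_mem i), R.al_hi]
  have ux : ∀ x ∈ R.t, u x = x - R.al (Pi.single i 1) x • E := fun x hx => by
    rw [u2, one_smul, hEx x hx, neg_smul, sub_eq_add_neg]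
    rw [one_smul, hEx x hx]; simp
  have uE : u E = E := by rw [u2]; simp; simp
  have uH : u H = H - (2 : k) • E := by rw [ux _ (R.h_mem i), R.al_hi]
  have vx : v x = x - R.al (Pi.single i 1) x • F := by
    rw [v2]
    · simp [hFx x hx, sub_eq_add_neg]
    · simp [hFx x hx]
  have vE : v E = E + H - F := by
    rw [v3]
    · simp only [smul_lie, lie_smul, hFE, lie_neg, hFH, smul_smul]
      simp [smul_smul, sub_eq_add_neg]
    · simp [hFE, hFH]
  simp only [LinearEquiv.mul_apply]
  rw [ux x hx, map_sub, map_smul, vx, vE]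
  set α := R.al (Pi.single i 1) x
  have e1 : x - α • F - α • (E + H - F) = x - α • E - α • H := by module
  rw [e1, map_sub, map_sub, map_smul, map_smul, ux x hx, uE, uH]
  module

/-- simple reflections lifted to the group -/
noncomputable def sig (i : I) : g ≃ₗ[k] g := (R.exists_sig i).choose
theorem sig_mem (i : I) : R.sig i ∈ IntG k g := (R.exists_sig i).choose_spec.1
theorem sig_t (i : I) {x : g} (hx : x ∈ R.t) : R.sig i x = x - R.al (Pi.single i 1) x • R.h i :=
  (R.exists_sig i).choose_spec.2 x hx
theorem sig_Nt (i : I) : R.Nt (R.sig i) := by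
  apply R.Nt_of (IntG_le_LA (R.sig_mem i))
  intro x hx
  rw [R.sig_t i hx]
  exact sub_mem hx (Submodule.smul_mem _ _ (R.h_mem i))
theorem sig_sig (i : I) {x : g} (hx : x ∈ R.t) : R.sig i (R.sig i x) = x := by
  rw [R.sig_t i (((R.sig_Nt i).2 x).2 hx), R.sig_t i hx, map_sub, map_smul, R.al_hi]
  simp only [smul_eq_mul]
  module

/-- the Weyl group (lifted) -/
noncomputable def Wg : Subgroup (g ≃ₗ[k] g) := Subgroup.closure (Set.range R.sig)

theorem Wg_le : R.Wg ≤ IntG k g := by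
  rw [Wg, Subgroup.closure_le]
  rintro _ ⟨i, rfl⟩
  exact R.sig_mem i

theorem Wg_Nt {v : g ≃ₗ[k] g} (h : v ∈ R.Wg) : R.Nt v := by
  rw [Wg] at h
  induction h using Subgroup.closure_induction with
  | mem v h => obtain ⟨i, rfl⟩ := h; exact R.sig_Nt i
  | one => exact ⟨one_mem _, fun x => Iff.rfl⟩
  | mul a b _ _ ha hb => exact ha.mul R hb
  | inv a _ ha => exact ha.inv R

theorem sig_perm (i : I) : ∃ π : Equiv.Perm Φ, (∀ a, ∀ x ∈ R.t, R.al (R.n (π a)) x = R.al (R.n a) (R.sig i x)) ∧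
    ∀ a j, j ≠ i → R.n (π a) j = R.n a j := by
  obtain ⟨π, c, hc, hc2, hπ⟩ := (R.sig_Nt i).exists_perm
  have h1 : ∀ a, ∀ x ∈ R.t, R.al (R.n (π a)) x = R.al (R.n a) (R.sig i x) := by
    intro a x hx
    rw [← hπ a _ (((R.sig_Nt i).2 x).2 hx), R.sig_sig i hx]
  refine ⟨π, h1, fun a j hj => ?_⟩
  have := h1 a _ (R.w_mem j)
  rw [R.sig_t i (R.w_mem j), R.al_w, R.al_w, Pi.single_apply, if_neg hj] at this
  simp only [Int.cast_zero, zero_smul, sub_zero, R.al_w] at this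
  exact_mod_cast this

/-- rational points -/
noncomputable def qp (q : I → ℚ) : g := ∑ i, (q i : k) • R.w i
theorem qp_mem (q : I → ℚ) : R.qp q ∈ R.t :=
  Submodule.sum_mem _ fun j _ => Submodule.smul_mem _ _ (R.w_mem j)
theorem al_qp (μ : I → ℤ) (q : I → ℚ) : R.al μ (R.qp q) = ((∑ i, (μ i : ℚ) * q i : ℚ) : k) := by
  rw [qp, map_sum]
  simp [R.al_w, mul_comm]

theorem sig_qp (i : I) (q : I → ℚ) : R.sig i (R.qp q) = R.qp fun j => q j - q i * R.A i j := by
  rw [R.sig_t i (R.qp_mem q)]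
  have : R.al (Pi.single i 1) (R.qp q) = (q i : k) := by rw [al_qp]; simp [Pi.single_apply]
  rw [this, qp, qp, h, Finset.smul_sum, ← Finset.sum_sub_distrib]
  refine Finset.sum_congr rfl fun j _ => ?_
  rw [smul_smul, ← sub_smul]
  push_cast
  rfl

theorem qp_pos {q : I → ℚ} (hq : ∀ i, 0 < q i) {a : Φ} (ha : 0 ≤ R.n a) : 0 < ∑ i, (R.n a i : ℚ) * q i := by
  obtain ⟨j, hj⟩ := R.exists_pos ha
  apply Finset.sum_pos'
  · intro i _
    exact mul_nonneg (by exact_mod_cast ha i) (hq i).le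
  · exact ⟨j, Finset.mem_univ _, mul_pos (by exact_mod_cast hj) (hq j)⟩

open scoped Classical in
theorem dominant (N : ℕ) : ∀ (q : I → ℚ), (∀ a, R.al (R.n a) (R.qp q) ≠ 0) →
    (Finset.univ.filter fun a => 0 ≤ R.n a ∧ ∑ i, (R.n a i : ℚ) * q i < 0).card ≤ N →
    ∃ v ∈ R.Wg, ∃ q' : I → ℚ, (∀ i, 0 < q' i) ∧ v (R.qp q) = R.qp q' := by
  induction N with
  | zero =>
    intro q hq hN
    refine ⟨1, one_mem _, q, fun i => ?_, rfl⟩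
    by_contra h
    have h1 : q i ≠ 0 := by
      intro h0
      apply hq (R.s i)
      rw [al_qp, R.n_s]; simp [Pi.single_apply, h0]
    have h2 : q i < 0 := lt_of_le_of_ne (not_lt.1 h) h1
    have h5 : R.s i ∈ Finset.univ.filter fun a => 0 ≤ R.n a ∧ ∑ i, (R.n a i : ℚ) * q i < 0 :=
      Finset.mem_filter.2 ⟨Finset.mem_univ _, R.s_pos i, by
      rw [R.n_s]; simpa [Pi.single_apply] using h2⟩
    have := Finset.card_pos.2 ⟨_, h5⟩
    omega
  | succ N ih =>
    intro q hq hN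
    by_cases hall : ∀ i, 0 < q i
    · exact ⟨1, one_mem _, q, hall, rfl⟩
    push Not at hall
    obtain ⟨i, h⟩ := hall
    have h1 : q i ≠ 0 := by
      intro h0
      apply hq (R.s i)
      rw [al_qp, R.n_s]; simp [Pi.single_apply, h0]
    have h2 : q i < 0 := lt_of_le_of_ne h h1
    obtain ⟨π, hπ, hπ2⟩ := R.sig_perm i
    set q' : I → ℚ := fun j => q j - q i * R.A i j with hq'
    have hx' : R.sig i (R.qp q) = R.qp q' := R.sig_qp i q
    have hval : ∀ a, ∑ j, (R.n (π a) j : ℚ) * q j = ∑ j, (R.n a j : ℚ) * q' j := by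
      intro a
      have := hπ a _ (R.qp_mem q)
      rw [hx', al_qp, al_qp] at this
      exact_mod_cast this
    have hsi : ∑ j, (R.n (R.s i) j : ℚ) * q' j = - q i := by
      rw [R.n_s]; simp [Pi.single_apply, q', R.A_ii]; ring
    have g1 : ∀ a, R.al (R.n a) (R.qp q') ≠ 0 := by
      intro a
      rw [← hx', ← hπ a _ (R.qp_mem q)]; exact hq _
    have g2 : (Finset.univ.filter fun a => 0 ≤ R.n a ∧ ∑ i, (R.n a i : ℚ) * q' i < 0).card ≤ N := by
      refine Nat.le_of_lt_succ (lt_of_lt_of_le ?_ hN)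
      rw [← Finset.card_image_of_injective _ π.injective]
      apply Finset.card_lt_card
      rw [Finset.ssubset_iff_of_subset]
      · refine ⟨R.s i, Finset.mem_filter.2 ⟨Finset.mem_univ _, R.s_pos i, by
          rw [R.n_s]; simpa [Pi.single_apply] using h2⟩, ?_⟩
        intro hm
        obtain ⟨b, hb, hb2⟩ := Finset.mem_image.1 hm
        obtain ⟨_, hb3, hb4⟩ := Finset.mem_filter.1 hb
        have : b = R.s i ∨ b = R.f i := R.red b i fun j hj => by
          rw [← hπ2 b j hj, hb2, R.n_s]; simp [Pi.single_apply, hj]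
        rcases this with h | h
        · rw [h, hsi] at hb4; linarith
        · rw [h, R.n_f] at hb3; have := hb3 i; simp at this
      · intro b' hb'
        obtain ⟨b, hb, rfl⟩ := Finset.mem_image.1 hb'
        obtain ⟨_, hb3, hb4⟩ := Finset.mem_filter.1 hb
        refine Finset.mem_filter.2 ⟨Finset.mem_univ _, ?_, by rw [hval]; exact hb4⟩
        by_cases hne : ∃ j, j ≠ i ∧ R.n b j ≠ 0
        · obtain ⟨j, hj, hj2⟩ := hne
          apply R.nonneg_of_pos (i := j)
          rw [hπ2 b j hj]
          exact lt_of_le_of_ne (hb3 j) (Ne.symm hj2)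
        · push Not at hne
          rcases R.red b i hne with h | h
          · rw [h, hsi] at hb4; linarith
          · rw [h, R.n_f] at hb3; have := hb3 i; simp at this
    obtain ⟨v, hv, q'', h3, h4⟩ := ih q' g1 g2
    refine ⟨v * R.sig i, mul_mem hv (Subgroup.subset_closure ⟨i, rfl⟩), q'', h3, ?_⟩
    rw [LinearEquiv.mul_apply, hx', h4]

theorem pos_of_dominant {φ : g ≃ₗ[k] g} {π : Equiv.Perm Φ}
    (hπ : ∀ a, ∀ x ∈ R.t, R.al (R.n (π a)) (φ x) = R.al (R.n a) x) {q q' : I → ℚ} (hq : ∀ i, 0 < q i)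
    (hq' : ∀ i, 0 < q' i) (h : φ (R.qp q) = R.qp q') : ∀ a, 0 ≤ R.n a → 0 ≤ R.n (π a) := by
  intro a ha
  have h1 := hπ a _ (R.qp_mem q)
  rw [h, al_qp, al_qp] at h1
  have h2 : ∑ i, (R.n (π a) i : ℚ) * q' i = ∑ i, (R.n a i : ℚ) * q i := by exact_mod_cast h1
  have h3 := R.qp_pos hq ha
  rcases R.pos (π a) with h4 | h4
  · exact h4
  · exfalso
    rw [← h2] at h3
    refine absurd h3 (not_lt.2 ?_)
    apply Finset.sum_nonpos
    intro i _
    exact mul_nonpos_of_nonpos_of_nonneg (by exact_mod_cast h4 i) (hq' i).le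

/-- positivity preserving elements of the normalizer -/
def PosP (φ : g ≃ₗ[k] g) : Prop := ∃ (π : Equiv.Perm Φ) (c : Φ → k),
    (∀ a, c a ≠ 0) ∧ (∀ a, φ (R.e a) = c a • R.e (π a)) ∧
    (∀ a, ∀ x ∈ R.t, R.al (R.n (π a)) (φ x) = R.al (R.n a) x) ∧ ∀ a, 0 ≤ R.n a → 0 ≤ R.n (π a)

theorem exists_PosP {φ : g ≃ₗ[k] g} (hφ : R.Nt φ) : ∃ v ∈ R.Wg, R.PosP (v * φ) := by
  obtain ⟨π, c, hc, hc2, hπ⟩ := (hφ.inv R).exists_perm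
  have h1 : φ (R.qp 1) = R.qp fun i => ((R.ht (Sum.inr (π (R.s i))) : ℤ) : ℚ) := by
    apply R.t_ext ((hφ.2 _).2 (R.qp_mem _)) (R.qp_mem _)
    intro i
    have := hπ (R.s i) _ ((hφ.2 _).2 (R.qp_mem 1))
    rw [inv_app, R.n_s] at this
    rw [← this, al_qp, al_qp]
    simp [ht, wt, Pi.single_apply]
  obtain ⟨v, hv, q', hq', h2⟩ := R.dominant _ (fun i => ((R.ht (Sum.inr (π (R.s i))) : ℤ) : ℚ)) (by
    intro a
    rw [← h1, ← hπ a _ ((hφ.2 _).2 (R.qp_mem 1)), inv_app, al_qp]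
    have := R.ht_ne (π a)
    simp only [ht, wt] at this
    simpa using (by exact_mod_cast this : ((∑ i, R.n (π a) i : ℤ) : k) ≠ 0)) le_rfl
  refine ⟨v, hv, ?_⟩
  obtain ⟨π', c', hc', hc2', hπ'⟩ := ((R.Wg_Nt hv).mul R hφ).exists_perm
  refine ⟨π', c', hc', hc2', hπ', R.pos_of_dominant hπ' (q := 1) (fun _ => one_pos) hq' ?_⟩
  rw [LinearEquiv.mul_apply, h1, h2]

theorem trivial_of_PosP {a : g ≃ₗ[k] g} (ha : a ∈ IntG k g) (hN : R.Nt a) (hp : R.PosP a) :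
    ∀ x ∈ R.t, a x = x := by
  obtain ⟨π, c, h1, h2, h3, h4⟩ := hp
  exact R.trivial_of_pos ha hN h3 h1 h2 h4

/-- every element of the normalizer in `G` acts through `Wg` -/
theorem exists_Wg {a : g ≃ₗ[k] g} (ha : a ∈ IntG k g) (hN : R.Nt a) : ∃ v ∈ R.Wg, ∀ x ∈ R.t, a x = v x := by
  obtain ⟨v, hv, h⟩ := R.exists_PosP hN
  refine ⟨v⁻¹, inv_mem hv, fun x hx => ?_⟩
  have := R.trivial_of_PosP (mul_mem (R.Wg_le hv) ha) ((R.Wg_Nt hv).mul R hN) h x hx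
  rw [LinearEquiv.mul_apply] at this
  calc a x = v⁻¹ (v (a x)) := (inv_app _ _).symm
    _ = _ := by rw [this]

/-- freeness on regular elements -/
theorem free_of_reg {c : g ≃ₗ[k] g} (hc : c ∈ IntG k g) {x : g} (hx : R.Reg x) (hcx : c x = x) :
    ∀ y ∈ R.t, c y = y := by
  have hcL := IntG_le_LA hc
  have hN : R.Nt c := by
    apply R.Nt_of hcL
    intro y hy
    rw [← hx.zc, zc, LinearMap.mem_ker, ad_apply]
    calc ⁅x, c y⁆ = ⁅c x, c y⁆ := by rw [hcx]
      _ = c ⁅x, y⁆ := (LA.map_lie hcL x y).symm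
      _ = 0 := by rw [R.lie_t_t hx.1 hy, map_zero]
  obtain ⟨ℓ, hℓ⟩ := Module.exists_dual_forall_apply_ne_zero (K := ℚ) (fun a => R.al (R.n a) x) hx.2
  set q : I → ℚ := fun i => ℓ (R.al (Pi.single i 1) x) with hq
  have hval : ∀ a, R.al (R.n a) (R.qp q) = ((ℓ (R.al (R.n a) x) : ℚ) : k) := by
    intro a
    rw [al_qp, R.al_eq_sum, map_sum]
    congr 1
    refine Finset.sum_congr rfl fun i _ => ?_
    rw [← zsmul_eq_mul, ← zsmul_eq_mul, map_zsmul]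
  obtain ⟨π, d, hd, hd2, hπ⟩ := hN.exists_perm
  have hfix : c (R.qp q) = R.qp q := by
    apply R.t_ext ((hN.2 _).2 (R.qp_mem q)) (R.qp_mem q)
    intro i
    have h1 := hπ (π.symm (R.s i)) _ (R.qp_mem q)
    have h2 := hπ (π.symm (R.s i)) _ hx.1
    rw [Equiv.apply_symm_apply, hval] at h1
    rw [Equiv.apply_symm_apply, hcx] at h2
    rw [← h2, ← hval, R.n_s] at h1
    exact h1
  obtain ⟨v, hv, q', hq', h2⟩ := R.dominant _ q (by
    intro a; rw [hval]; exact_mod_cast hℓ a) le_rfl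
  have hvN := R.Wg_Nt hv
  have hN' : R.Nt (v * c * v⁻¹) := (hvN.mul R hN).mul R (hvN.inv R)
  obtain ⟨π', c', hc', hc2', hπ'⟩ := hN'.exists_perm
  have hp : R.PosP (v * c * v⁻¹) := by
    refine ⟨π', c', hc', hc2', hπ', R.pos_of_dominant hπ' hq' hq' ?_⟩
    rw [← h2]
    simp only [LinearEquiv.mul_apply]
    rw [inv_app, hfix]
  intro y hy
  have := R.trivial_of_PosP (mul_mem (mul_mem (R.Wg_le hv) hc) (inv_mem (R.Wg_le hv))) hN' hp (v y)
    ((hvN.2 y).2 hy)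
  simp only [LinearEquiv.mul_apply, inv_app] at this
  exact v.injective this

end RD
end GG
end CL

set_option linter.all false
set_option linter.unusedSimpArgs false
set_option linter.unusedSectionVars false
namespace CL
section GG
open LieAlgebra Module
variable {k : Type*} [Field k] [IsAlgClosed k] [CharZero k]
variable {g : Type*} [LieRing g] [LieAlgebra k g] [FiniteDimensional k g]
  [LieAlgebra.IsSemisimple k g]
variable {I Φ : Type*} [Fintype I] [DecidableEq I] [Fintype Φ] [DecidableEq Φ]

theorem root_int (D : ℤ) (hD : D ≠ 0) (u : kˣ) : ∃ v : kˣ, v ^ D = u := by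
  have key : ∀ (d : ℕ), d ≠ 0 → ∀ u : kˣ, ∃ v : kˣ, v ^ d = u := by
    intro d hd u
    obtain ⟨z, hz⟩ := IsAlgClosed.exists_pow_nat_eq (u : k) (Nat.pos_of_ne_zero hd)
    have hz0 : z ≠ 0 := by
      rintro rfl
      rw [zero_pow hd] at hz
      exact u.ne_zero hz.symm
    exact ⟨Units.mk0 z hz0, Units.ext (by simpa using hz)⟩
  rcases Int.natAbs_eq D with h | h
  · obtain ⟨v, hv⟩ := key D.natAbs (by omega) u
    exact ⟨v, by rw [h, zpow_natCast, hv]⟩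
  · obtain ⟨v, hv⟩ := key D.natAbs (by omega) u⁻¹
    exact ⟨v, by rw [h, zpow_neg, zpow_natCast, hv, inv_inv]⟩

theorem zpow_sum' {J : Type*} (u : kˣ) (S : Finset J) (p : J → ℤ) :
    u ^ (∑ j ∈ S, p j) = ∏ j ∈ S, u ^ p j := by
  classical
  induction S using Finset.induction_on with
  | empty => simp
  | insert a S ha ih => rw [Finset.sum_insert ha, Finset.prod_insert ha, zpow_add, ih]

theorem torus_surj (A : Matrix I I ℤ) (hA : A.det ≠ 0) (β : I → kˣ) :
    ∃ γ : I → kˣ, ∀ i, ∏ j, γ j ^ A i j = β i := by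
  choose δ hδ using fun i => root_int A.det hA (β i)
  refine ⟨fun j => ∏ l, δ l ^ A.adjugate j l, fun i => ?_⟩
  have h1 : ∀ j, (∏ l, δ l ^ A.adjugate j l) ^ A i j = ∏ l, δ l ^ (A i j * A.adjugate j l) := by
    intro j
    rw [← Finset.prod_zpow]
    refine Finset.prod_congr rfl fun l _ => ?_
    rw [← zpow_mul, mul_comm]
  simp only [h1]
  rw [Finset.prod_comm]
  have h2 : ∀ l, ∏ j, δ l ^ (A i j * A.adjugate j l) = δ l ^ (if i = l then A.det else 0) := by
    intro l
    have h3 : ∑ j, A i j * A.adjugate j l = if i = l then A.det else 0 := by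
      have := congrFun (congrFun (Matrix.mul_adjugate A) i) l
      rw [Matrix.mul_apply] at this
      rw [this]; simp [Matrix.one_apply]
    rw [← h3]
    rw [zpow_sum']
  simp only [h2]
  rw [Finset.prod_eq_single i]
  · simp [hδ]
  · intro l _ hl; simp [Ne.symm hl]
  · simp

theorem sl2_inj {E H F v : g} (hEF : ⁅E, F⁆ = H) (hHF : ⁅H, F⁆ = -F)
    (hn : IsNilpotent (ad k g F)) (n : ℕ) (hv : ⁅H, v⁆ = -((n : k) + 1) • v)
    (h0 : ⁅F, ⁅E, v⁆⁆ = 0) : v = 0 := by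
  by_contra hne
  obtain ⟨N, hN⟩ := hn
  have key : ∀ j : ℕ, ((ad k g F) ^ j) v ≠ 0 ∧
      ⁅H, ((ad k g F) ^ j) v⁆ = -((n : k) + 1 + j) • ((ad k g F) ^ j) v ∧
      ∃ p : ℕ, ⁅F, ⁅E, ((ad k g F) ^ j) v⁆⁆ = -(p : k) • ((ad k g F) ^ j) v := by
    intro j
    induction j with
    | zero => exact ⟨by simpa using hne, by simpa using hv, 0, by simpa using h0⟩
    | succ j ih =>
      rw [pow_succ', End.mul_apply, ad_apply]
      generalize ((ad k g F) ^ j) v = w at ih ⊢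
      obtain ⟨h1, h2, p, h3⟩ := ih
      have h4 : ⁅E, ⁅F, w⁆⁆ = -((p : k) + (n + 1 + j)) • w := by
        rw [leibniz_lie, hEF, h2, h3, ← add_smul]; congr 1; ring
      refine ⟨fun h5 => ?_, ?_, p + (n + 1 + j), ?_⟩
      · rw [h5, lie_zero] at h4
        rcases smul_eq_zero.1 h4.symm with h6 | h6
        · rw [neg_eq_zero] at h6
          have : ((p + (n + 1 + j) : ℕ) : k) = 0 := by push_cast; exact h6
          rw [Nat.cast_eq_zero] at this
          omega
        · exact h1 h6
      · rw [leibniz_lie, hHF, h2, lie_smul, neg_lie, ← neg_one_smul k, ← add_smul]; congr 1; push_cast; ring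
      · rw [h4, lie_smul]; push_cast; rfl
  apply (key N).1
  rw [hN]; rfl

namespace RD
variable (R : RD k g I Φ)

/-- half sum of positive coroots -/
noncomputable def rho : g := ∑ i, R.w i
/-- regular nilpotent -/
noncomputable def E : g := ∑ i, R.e (R.s i)

theorem rho_mem : R.rho ∈ R.t := Submodule.sum_mem _ fun i _ => R.w_mem i

theorem al_rho (b : I ⊕ Φ) : R.al (R.wt b) R.rho = (R.ht b : k) := by
  simp [rho, al_w, ht]

theorem lie_rho_B (b : I ⊕ Φ) : ⁅R.rho, R.B b⁆ = (R.ht b : k) • R.B b := by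
  rw [R.lie_t_B R.rho_mem, al_rho]

theorem exists_cc : ∃ c : I → k, ∑ i, c i • R.h i = R.rho := by
  have hdet : IsUnit ((Matrix.of R.A).map (Int.castRingHom k)).det := by
    rw [← RingHom.mapMatrix_apply, ← RingHom.map_det]
    simpa using R.A_det
  refine ⟨Matrix.vecMul 1 ((Matrix.of R.A).map (Int.castRingHom k))⁻¹, ?_⟩
  set v := Matrix.vecMul (1 : I → k) ((Matrix.of R.A).map (Int.castRingHom k))⁻¹ with hv
  have h1 : Matrix.vecMul v ((Matrix.of R.A).map (Int.castRingHom k)) = 1 := by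
    rw [hv, Matrix.vecMul_vecMul, Matrix.nonsing_inv_mul _ hdet, Matrix.vecMul_one]
  unfold h rho
  simp only [Finset.smul_sum, smul_smul]
  rw [Finset.sum_comm]
  refine Finset.sum_congr rfl fun j _ => ?_
  rw [← Finset.sum_smul]
  have := congrFun h1 j
  simp only [Matrix.vecMul, dotProduct, Matrix.map_apply, Matrix.of_apply, Pi.one_apply] at this
  simp at this
  rw [this, one_smul]

noncomputable def cc : I → k := R.exists_cc.choose
theorem cc_spec : ∑ i, R.cc i • R.h i = R.rho := R.exists_cc.choose_spec
/-- opposite regular nilpotent -/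
noncomputable def FF : g := ∑ i, R.cc i • R.F i

theorem ht_s (i : I) : R.ht (Sum.inr (R.s i)) = 1 := by simp [ht, wt, R.n_s]
theorem ht_f (i : I) : R.ht (Sum.inr (R.f i)) = -1 := by simp [ht, wt, R.n_f]

theorem lie_rho_E : ⁅R.rho, R.E⁆ = R.E := by
  rw [E, lie_sum]
  refine Finset.sum_congr rfl fun i _ => ?_
  rw [e, lie_rho_B, ht_s]; simp

theorem lie_rho_F (i : I) : ⁅R.rho, R.F i⁆ = - R.F i := by
  rw [R.hF, lie_smul, lie_rho_B, ht_f]; simp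

theorem lie_rho_FF : ⁅R.rho, R.FF⁆ = - R.FF := by
  rw [FF, lie_sum, ← Finset.sum_neg_distrib]
  refine Finset.sum_congr rfl fun i _ => ?_
  rw [lie_smul, lie_rho_F, smul_neg]

theorem lie_sF_ne {i j : I} (hij : i ≠ j) : ⁅R.e (R.s i), R.F j⁆ = 0 := by
  by_contra hne
  obtain ⟨d, hd⟩ := R.exists_repr_ne hne
  rw [R.hF, lie_smul] at hd
  have hd2 : R.B.repr ⁅R.B (Sum.inr (R.s i)), R.B (Sum.inr (R.f j))⁆ d ≠ 0 := by
    intro h0; apply hd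
    rw [map_smul, Finsupp.smul_apply, e, h0, smul_zero]
  have h1 := R.B_lie_B _ _ _ hd2
  simp only [wt, R.n_s, R.n_f] at h1
  have hi := congrFun h1 i
  have hj := congrFun h1 j
  simp [Pi.single_apply, hij, hij.symm] at hi hj
  rcases d with l | a
  · simp at hi
  · rcases R.pos a with h | h
    · have := h j; simp at this; simp at hj; omega
    · have := h i; simp at this; simp at hi; omega

theorem lie_E_FF : ⁅R.E, R.FF⁆ = R.rho := by
  rw [← R.cc_spec, E, FF, sum_lie]
  refine Finset.sum_congr rfl fun i _ => ?_
  rw [lie_sum, Finset.sum_eq_single i]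
  · rw [lie_smul, lie_eF]
  · intro j _ hj; rw [lie_smul, R.lie_sF_ne hj.symm, smul_zero]
  · simp

theorem E_Fil : R.E ∈ R.Fil (-1) (-1) :=
  Submodule.sum_mem _ fun i _ => R.B_mem_Fil (by rw [ht_s]; simp)
theorem E_Fil' : R.E ∈ R.Fil 1 1 :=
  Submodule.sum_mem _ fun i _ => R.B_mem_Fil (by rw [ht_s]; simp)
theorem F_Fil (i : I) : R.F i ∈ R.Fil 1 (-1) := by
  rw [R.hF]; exact Submodule.smul_mem _ _ (R.B_mem_Fil (by rw [ht_f]; simp))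
theorem FF_Fil : R.FF ∈ R.Fil 1 (-1) :=
  Submodule.sum_mem _ fun i _ => Submodule.smul_mem _ _ (R.F_Fil i)

/-- negative heights: `f e` injective -/
theorem inj_neg {v : g} (n : ℕ) (hv : ⁅R.rho, v⁆ = -((n : k) + 1) • v)
    (h0 : ⁅R.FF, ⁅R.E, v⁆⁆ = 0) : v = 0 :=
  sl2_inj (k := k) R.lie_E_FF R.lie_rho_FF (R.ad_nilp (by simp) R.FF_Fil) n hv h0

theorem inj_pos {v : g} (n : ℕ) (hv : ⁅R.rho, v⁆ = ((n : k) + 1) • v)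
    (h0 : ⁅R.FF, v⁆ = 0) : v = 0 := by
  refine sl2_inj (k := k) (E := R.FF) (F := R.E) (H := -R.rho) (by rw [← R.lie_E_FF, lie_skew]) (by rw [neg_lie, lie_rho_E])
    (R.ad_nilp (σ := -1) (by simp) R.E_Fil) n (by rw [neg_lie, hv, neg_smul]) (by rw [h0, lie_zero])

/-- the torus character -/
def chi (γ : I → kˣ) (μ : I → ℤ) : kˣ := ∏ j, γ j ^ μ j

theorem chi_add (γ : I → kˣ) (μ ν : I → ℤ) : chi γ (μ + ν) = chi γ μ * chi γ ν := by
  simp [chi, zpow_add, Finset.prod_mul_distrib]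
theorem chi_zero (γ : I → kˣ) : chi γ 0 = 1 := by simp [chi]
theorem chi_neg (γ : I → kˣ) (μ : I → ℤ) : chi γ (-μ) = (chi γ μ)⁻¹ := by simp [chi]
theorem chi_single (γ : I → kˣ) (i : I) : chi γ (Pi.single i 1) = γ i := by
  rw [chi, Finset.prod_eq_single i]
  · simp
  · intro j _ hj; simp [hj]
  · simp
theorem chi_mul (γ δ : I → kˣ) (μ : I → ℤ) : chi (γ * δ) μ = chi γ μ * chi δ μ := by
  simp [chi, mul_zpow, Finset.prod_mul_distrib]

/-- torus elements -/
noncomputable def tor (γ : I → kˣ) : g ≃ₗ[k] g :=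
  R.B.equiv (R.B.unitsSMul fun b => chi γ (R.wt b)) (Equiv.refl _)

theorem tor_B (γ : I → kˣ) (b : I ⊕ Φ) : R.tor γ (R.B b) = (chi γ (R.wt b) : k) • R.B b := by
  simp [tor, Basis.unitsSMul_apply, Units.smul_def]

theorem tor_e (γ : I → kˣ) (a : Φ) : R.tor γ (R.e a) = (chi γ (R.n a) : k) • R.e a := R.tor_B γ _

theorem tor_t (γ : I → kˣ) {x : g} (hx : x ∈ R.t) : R.tor γ x = x := by
  rw [R.t_eq_sum hx, map_sum]
  refine Finset.sum_congr rfl fun i _ => ?_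
  rw [map_smul, w, tor_B]; simp [wt, chi_zero]

theorem tor_wt (γ : I → kˣ) {y : g} {μ : I → ℤ} (hμ : ∀ x ∈ R.t, ⁅x, y⁆ = R.al μ x • y) :
    R.tor γ y = (chi γ μ : k) • y := by
  by_cases hy : y = 0
  · simp [hy]
  rcases R.wt_vec hμ hy with ⟨h1, h2⟩ | ⟨a, h1, c, _, h3⟩
  · rw [R.tor_t γ h2, h1, chi_zero]; simp
  · rw [h3, map_smul, tor_e, h1, smul_comm]

theorem LA_of_B {φ : g ≃ₗ[k] g} (h : ∀ b c, φ ⁅R.B b, R.B c⁆ = ⁅φ (R.B b), φ (R.B c)⁆) (x y : g) :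
    φ ⁅x, y⁆ = ⁅φ x, φ y⁆ := by
  rw [← R.B.sum_repr x, ← R.B.sum_repr y]
  simp only [sum_lie, lie_sum, map_sum, map_smul, smul_lie, lie_smul, h]

theorem tor_lie (γ : I → kˣ) (x y : g) : R.tor γ ⁅x, y⁆ = ⁅R.tor γ x, R.tor γ y⁆ := by
  apply R.LA_of_B
  intro b c
  rw [R.tor_wt γ (μ := R.wt b + R.wt c) (fun x hx => R.lie_wt (R.lie_t_B hx b) (R.lie_t_B hx c)),
    tor_B, tor_B, smul_lie, lie_smul, smul_smul, chi_add]
  simp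

end RD
end GG
end CL

set_option linter.all false
set_option linter.unusedSimpArgs false
set_option linter.unusedSectionVars false
namespace CL
section GG
open LieAlgebra Module
variable {k : Type*} [Field k] [IsAlgClosed k] [CharZero k]
variable {g : Type*} [LieRing g] [LieAlgebra k g] [FiniteDimensional k g]
  [LieAlgebra.IsSemisimple k g]
variable {I Φ : Type*} [Fintype I] [DecidableEq I] [Fintype Φ] [DecidableEq Φ]
namespace RD
variable (R : RD k g I Φ)

theorem tor_LA (γ : I → kˣ) : R.tor γ ∈ LA k g := R.tor_lie γ

theorem tor_mul (γ δ : I → kˣ) : R.tor (γ * δ) = R.tor γ * R.tor δ := by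
  apply LinearEquiv.toLinearMap_injective
  apply R.B.ext
  intro b
  simp [tor_B, chi_mul, smul_smul, mul_comm]

theorem tor_one : R.tor 1 = 1 := by
  apply LinearEquiv.toLinearMap_injective
  apply R.B.ext
  intro b
  simp [tor_B, chi]

theorem chi_pow (c : kˣ) (q μ : I → ℤ) : chi (fun j => c ^ q j) μ = c ^ (∑ j, μ j * q j) := by
  rw [zpow_sum', chi]
  refine Finset.prod_congr rfl fun j _ => ?_
  rw [← zpow_mul, mul_comm]

theorem tor_coroot_mem (i : I) (c : kˣ) : R.tor (fun j => c ^ R.A i j) ∈ IntG k g := by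
  obtain ⟨π, d, hd, hd2, hπ⟩ := (R.sig_Nt i).exists_perm
  set L := R.tor (Pi.mulSingle i c) with hL
  have hchi : ∀ μ : I → ℤ, chi (Pi.mulSingle i c) μ = c ^ μ i := by
    intro μ
    rw [chi, Finset.prod_eq_single i]
    · simp
    · intro j _ hj; simp [hj]
    · simp
  have h1 : R.sig i (R.h i) = - R.h i := by
    rw [R.sig_t i (R.h_mem i), al_hi, two_smul]; abel
  have h2 : R.sig i (R.w i) = R.w i - R.h i := by
    rw [R.sig_t i (R.w_mem i), al_w]; simp
  have h3 : ∀ a, R.n (π a) i - R.n a i = ∑ j, R.n (π a) j * R.A i j := by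
    intro a
    have := hπ a _ (R.w_mem i)
    rw [h2, map_sub, al_h, al_w, al_w] at this
    have h4 : R.n (π a) i - (∑ j, R.n (π a) j * R.A i j) = R.n a i := by exact_mod_cast this
    omega
  have key : L * R.sig i = R.tor (fun j => c ^ R.A i j) * R.sig i * L := by
    apply LinearEquiv.toLinearMap_injective
    apply R.B.ext
    rintro (j | a)
    · have hm := ((R.sig_Nt i).2 _).2 (R.w_mem j)
      change L (R.sig i (R.w j)) = R.tor _ (R.sig i (L (R.w j)))
      rw [hL, R.tor_t _ hm, R.tor_t _ (R.w_mem j), R.tor_t _ hm]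
    · change L (R.sig i (R.e a)) = R.tor _ (R.sig i (L (R.e a)))
      rw [hL, tor_e, map_smul, hd2, map_smul, tor_e, map_smul, map_smul, tor_e, chi_pow, hchi, hchi, ← h3]
      simp only [smul_smul]
      congr 1
      have : (c ^ R.n (π a) i : kˣ) = c ^ R.n a i * c ^ (R.n (π a) i - R.n a i) := by
        rw [← zpow_add]; congr 1; ring
      rw [this]
      push_cast
      ring
  have h5 : R.tor (fun j => c ^ R.A i j) = (L * R.sig i * L⁻¹) * (R.sig i)⁻¹ := by
    rw [key]; group
  rw [h5]
  exact mul_mem (IntG_conj (R.tor_LA _) (R.sig_mem i)) (inv_mem (R.sig_mem i))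

theorem tor_prod {J : Type*} [DecidableEq J] (S : Finset J) (γ : J → I → kˣ) (h : ∀ j, R.tor (γ j) ∈ IntG k g) :
    R.tor (∏ j ∈ S, γ j) ∈ IntG k g := by
  induction S using Finset.induction_on with
  | empty => rw [Finset.prod_empty, tor_one]; exact one_mem _
  | insert a S ha ih => rw [Finset.prod_insert ha, tor_mul]; exact mul_mem (h a) ih

theorem tor_mem (γ : I → kˣ) : R.tor γ ∈ IntG k g := by
  obtain ⟨c, hc⟩ := torus_surj (Matrix.of R.A).transpose (by rw [Matrix.det_transpose]; exact R.A_det) γ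
  have : γ = ∏ i, fun j => c i ^ R.A i j := by
    ext j
    rw [← hc j]; simp
  rw [this]
  exact R.tor_prod _ _ fun i => R.tor_coroot_mem i (c i)

/-- positive roots reach a simple root -/
theorem down {a : Φ} (ha : 0 < R.ht (Sum.inr a)) : ∃ i, ⁅R.F i, R.e a⁆ ≠ 0 := by
  by_contra h
  push Not at h
  apply R.e_ne a
  obtain ⟨n, hn⟩ := Int.eq_ofNat_of_zero_le (show 0 ≤ R.ht (Sum.inr a) - 1 by omega)
  refine R.inj_pos n ?_ ?_
  · rw [e, lie_rho_B, show R.ht (Sum.inr a) = n + 1 by omega]; push_cast; rfl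
  · rw [FF, sum_lie]; exact Finset.sum_eq_zero fun i _ => by rw [smul_lie, h, smul_zero]

theorem up {a : Φ} (ha : R.ht (Sum.inr a) < 0) : ∃ i, ⁅R.e (R.s i), R.e a⁆ ≠ 0 := by
  by_contra h
  push Not at h
  apply R.e_ne a
  obtain ⟨n, hn⟩ := Int.eq_ofNat_of_zero_le (show 0 ≤ - R.ht (Sum.inr a) - 1 by omega)
  refine R.inj_neg n ?_ ?_
  · rw [e, lie_rho_B, show R.ht (Sum.inr a) = -(n + 1) by omega]; push_cast; rfl
  · rw [E, sum_lie, Finset.sum_eq_zero fun i _ => h i, lie_zero]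

theorem h_ne (i : I) : R.h i ≠ 0 := by
  intro h
  have := R.al_hi i
  rw [h, map_zero] at this
  exact two_ne_zero this.symm

theorem exists_tor {c : g ≃ₗ[k] g} (hc : c ∈ LA k g) (ht : ∀ x ∈ R.t, c x = x) : ∃ γ, c = R.tor γ := by
  have hN : R.Nt c := R.Nt_of hc fun x hx => by rwa [ht x hx]
  obtain ⟨π, d, hd, hd2, hπ⟩ := hN.exists_perm
  have hπ1 : ∀ a, π a = a := by
    intro a
    apply R.n_inj
    apply R.al_inj
    intro x hx
    rw [← hπ a x hx, ht x hx]
  simp only [hπ1] at hd2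
  set γ : I → kˣ := fun i => Units.mk0 (d (R.s i)) (hd _) with hγ
  refine ⟨γ, ?_⟩
  have hF : ∀ i, c (R.F i) = ((γ i)⁻¹ : kˣ) • R.F i := by
    intro i
    have h1 := LA.map_lie hc (R.e (R.s i)) (R.F i)
    rw [lie_eF, ht _ (R.h_mem i), hd2] at h1
    have h2 : c (R.F i) = d (R.f i) • R.F i := by
      rw [R.hF, map_smul, ← e, hd2, smul_comm]
    rw [h2, smul_lie, lie_smul, lie_eF, smul_smul] at h1
    have h3 : d (R.s i) * d (R.f i) = 1 := by
      have : (d (R.s i) * d (R.f i) - 1) • R.h i = 0 := by rw [sub_smul, ← h1]; simp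
      rcases smul_eq_zero.1 this with h | h
      · exact sub_eq_zero.1 h
      · exact absurd h (R.h_ne i)
    rw [h2, Units.smul_def]
    congr 1
    simp only [hγ, Units.val_inv_eq_inv_val, Units.val_mk0]
    exact eq_inv_of_mul_eq_one_right h3
  have hstep : ∀ a b (r q : k), r ≠ 0 → q ≠ 0 → ∀ z, ⁅z, R.e a⁆ = r • R.e b → c z = q • z → d b = q * d a := by
    intro a b r q hr hq z hz hcz
    have h1 := LA.map_lie hc z (R.e a)
    rw [hz, map_smul, hd2, hcz, hd2, smul_lie, lie_smul, hz] at h1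
    simp only [smul_smul] at h1
    have : (r * d b - q * (d a * r)) • R.e b = 0 := by rw [sub_smul, h1, sub_self]
    rcases smul_eq_zero.1 this with h | h
    · have : r * (d b - q * d a) = 0 := by linear_combination h
      rcases mul_eq_zero.1 this with h | h
      · exact absurd h hr
      · exact sub_eq_zero.1 h
    · exact absurd h (R.e_ne b)
  have main : ∀ n : ℕ, ∀ a, (R.ht (Sum.inr a)).natAbs ≤ n → d a = chi γ (R.n a) := by
    intro n
    induction n with
    | zero => intro a ha; have := R.ht_ne a; omega
    | succ n ih =>
      intro a ha
      rcases lt_or_gt_of_ne (R.ht_ne a) with h | h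
      · obtain ⟨i, hi⟩ := R.up h
        have hw : ∀ x ∈ R.t, ⁅x, ⁅R.e (R.s i), R.e a⁆⁆ = R.al (Pi.single i 1 + R.n a) x • ⁅R.e (R.s i), R.e a⁆ :=
          fun x hx => R.lie_wt (R.lie_ts hx i) (R.lie_t_e hx a)
        rcases R.wt_vec hw hi with ⟨h0, h1⟩ | ⟨b, hb, r, hr, h1⟩
        · have : a = R.f i := R.n_inj (by rw [R.n_f]; exact (neg_eq_of_add_eq_zero_right h0).symm)
          have hci : R.c i ≠ 0 := by
            intro h0
            apply R.h_ne i
            rw [← lie_eF, R.hF, h0]; simp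
          have h2 := hF i
          rw [R.hF, map_smul, ← e, hd2, ← this, Units.smul_def, smul_comm] at h2
          have h3 : (d a - ((γ i)⁻¹ : kˣ)) • (R.c i • R.e a) = 0 := by rw [sub_smul, h2, sub_self]
          rcases smul_eq_zero.1 h3 with h | h
          · rw [this] at h ⊢
            rw [R.n_f, chi_neg, chi_single]; exact sub_eq_zero.1 h
          · rcases smul_eq_zero.1 h with h | h
            · exact absurd h hci
            · exact absurd h (R.e_ne a)
        · have h2 := hstep a b r (γ i) hr (γ i).ne_zero _ h1 (hd2 _)
          have hh : R.ht (Sum.inr b) = 1 + R.ht (Sum.inr a) := by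
            simp only [RD.ht, wt, ← hb, Pi.add_apply, Finset.sum_add_distrib]; simp
          have hne := R.ht_ne b
          rw [ih b (by omega), ← hb, chi_add, chi_single] at h2
          push_cast at h2
          exact (mul_left_cancel₀ (γ i).ne_zero h2).symm
      · obtain ⟨i, hi⟩ := R.down h
        have hw : ∀ x ∈ R.t, ⁅x, ⁅R.F i, R.e a⁆⁆ = R.al (-Pi.single i 1 + R.n a) x • ⁅R.F i, R.e a⁆ :=
          fun x hx => R.lie_wt (by rw [R.lie_tF hx, al_neg]) (R.lie_t_e hx a)
        rcases R.wt_vec hw hi with ⟨h0, h1⟩ | ⟨b, hb, r, hr, h1⟩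
        · have : a = R.s i := R.n_inj (by rw [R.n_s]; exact (neg_add_eq_zero.1 h0).symm)
          rw [this, R.n_s, chi_single]; rfl
        · have h2 := hstep a b r ((γ i)⁻¹ : kˣ) hr ((γ i)⁻¹).ne_zero _ h1 (hF i)
          have hh : R.ht (Sum.inr b) = -1 + R.ht (Sum.inr a) := by
            simp only [RD.ht, wt, ← hb, Pi.add_apply, Finset.sum_add_distrib]; simp
          have hne := R.ht_ne b
          rw [ih b (by omega), ← hb, chi_add, chi_neg, chi_single] at h2
          push_cast at h2
          refine (mul_left_cancel₀ (inv_ne_zero (γ i).ne_zero) ?_).symm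
          push_cast
          exact h2
  apply LinearEquiv.toLinearMap_injective
  apply R.B.ext
  rintro (j | a)
  · change c (R.w j) = R.tor γ (R.w j)
    rw [ht _ (R.w_mem j), R.tor_t _ (R.w_mem j)]
  · change c (R.e a) = R.tor γ (R.e a)
    rw [hd2, tor_e, main _ a le_rfl]

theorem tor_ext {c c' : g ≃ₗ[k] g} (hc : c ∈ LA k g) (ht : ∀ x ∈ R.t, c x = x)
    (hc' : c' ∈ LA k g) (ht' : ∀ x ∈ R.t, c' x = x) (h : ∀ i, c (R.e (R.s i)) = c' (R.e (R.s i))) : c = c' := by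
  obtain ⟨γ, rfl⟩ := R.exists_tor hc ht
  obtain ⟨γ', rfl⟩ := R.exists_tor hc' ht'
  congr 1
  ext i
  have := h i
  rw [tor_e, tor_e, R.n_s, chi_single, chi_single] at this
  exact smul_left_injective k (R.e_ne _) this

theorem step4 {θ c : g ≃ₗ[k] g} (hθ : R.Nt θ) (hfix : ∀ x ∈ R.t, θ x = x → x = 0)
    (hc : c ∈ LA k g) (hct : ∀ x ∈ R.t, c x = x) : ∃ s ∈ IntG k g, s * θ * s⁻¹ = c * θ := by
  obtain ⟨δ, rfl⟩ := R.exists_tor hc hct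
  obtain ⟨π, d, hd, hd2, hπ⟩ := hθ.exists_perm
  set M : Matrix I I ℤ := Matrix.of fun i j => (if i = j then 1 else 0) - R.n (π.symm (R.s i)) j with hM
  have hdet : M.det ≠ 0 := by
    intro h0
    obtain ⟨v, hv, hv2⟩ := Matrix.exists_mulVec_eq_zero_iff.2 h0
    apply hv
    set x : g := ∑ j, (v j : k) • R.w j with hx
    have hxt : x ∈ R.t := Submodule.sum_mem _ fun j _ => Submodule.smul_mem _ _ (R.w_mem j)
    have hal : ∀ μ : I → ℤ, R.al μ x = ((∑ j, μ j * v j : ℤ) : k) := by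
      intro μ
      rw [hx, map_sum]
      simp [al_w, mul_comm]
    have h1 : ∀ i, v i = ∑ j, R.n (π.symm (R.s i)) j * v j := by
      intro i
      have := congrFun hv2 i
      simp only [hM, Matrix.mulVec, dotProduct, Matrix.of_apply, sub_mul, Finset.sum_sub_distrib, Pi.zero_apply] at this
      simp at this
      omega
    have hfx : θ x = x := by
      apply R.t_ext ((hθ.2 x).2 hxt) hxt
      intro i
      have := hπ (π.symm (R.s i)) x hxt
      rw [π.apply_symm_apply, R.n_s] at this
      rw [this, hal, hal, ← h1]; simp [Pi.single_apply]
    have hx0 := hfix x hxt hfx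
    ext i
    have := hal (Pi.single i 1)
    rw [hx0, map_zero] at this
    simp [Pi.single_apply] at this
    simpa using this.symm
  obtain ⟨γ, hγ⟩ := torus_surj M hdet δ
  have hθi := (hθ.inv R)
  refine ⟨R.tor γ, R.tor_mem γ, ?_⟩
  have h1 : R.tor γ * (θ * (R.tor γ)⁻¹ * θ⁻¹) = R.tor δ := by
    have hinv : ∀ x ∈ R.t, (R.tor γ)⁻¹ x = x := fun x hx => by
      conv_lhs => rw [← R.tor_t γ hx]
      simp
    apply R.tor_ext
    · exact mul_mem (R.tor_LA _) (mul_mem (mul_mem hθ.1 (inv_mem (R.tor_LA _))) (inv_mem hθ.1))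
    · intro x hx
      simp only [LinearEquiv.mul_apply]
      rw [hinv _ ((hθi.2 x).2 hx), app_inv, R.tor_t _ hx]
    · exact R.tor_LA _
    · intro x hx; exact R.tor_t _ hx
    · intro i
      simp only [LinearEquiv.mul_apply]
      set b := π.symm (R.s i) with hb
      have hbi : π b = R.s i := π.apply_symm_apply _
      have h2 : θ⁻¹ (R.e (R.s i)) = (d b)⁻¹ • R.e b := by
        apply θ.injective
        rw [app_inv, map_smul, hd2, hbi, smul_smul, inv_mul_cancel₀ (hd b), one_smul]
      have h3 : (R.tor γ)⁻¹ (R.e b) = ((chi γ (R.n b))⁻¹ : kˣ) • R.e b := by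
        apply (R.tor γ).injective
        rw [app_inv, Units.smul_def, map_smul, tor_e, smul_smul]; simp
      rw [h2, map_smul, h3, Units.smul_def]
      simp only [map_smul, hd2, hbi, tor_e, R.n_s, chi_single]
      simp only [smul_smul]
      congr 1
      rw [← hγ i]
      have h4 : ∏ j, γ j ^ M i j = γ i * (chi γ (R.n b))⁻¹ := by
        rw [← chi_single γ i, ← chi_neg, ← chi_add, chi]
        refine Finset.prod_congr rfl fun j _ => ?_
        congr 1
        simp [hM, Pi.single_apply, eq_comm, hb, sub_eq_add_neg]
      rw [h4]
      push_cast
      field_simp [hd b]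
  rw [← h1]; group

end RD
end GG
end CL

set_option linter.all false
set_option linter.unusedSimpArgs false
set_option linter.unusedSectionVars false
namespace CL
section GG
open LieAlgebra Module
variable {k : Type*} [Field k] [IsAlgClosed k] [CharZero k]
variable {g : Type*} [LieRing g] [LieAlgebra k g] [FiniteDimensional k g]
  [LieAlgebra.IsSemisimple k g]
variable {I Φ : Type*} [Fintype I] [DecidableEq I] [Fintype Φ] [DecidableEq Φ]
namespace RD
variable (R : RD k g I Φ)

theorem exists_exp4 {σ p : ℤ} (hσ : |σ| = 1) (hp : 1 ≤ p) {ν : g} (hν : ν ∈ R.Fil σ (-p)) :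
    ∃ τ ∈ IntG k g, (∀ m, ∀ y ∈ R.Fil σ m, τ y - y - ⁅ν, y⁆ ∈ R.Fil σ (m - 2 * p)) ∧
      ∀ x, ⁅ν, ⁅ν, ⁅ν, x⁆⁆⁆ = 0 → τ x = x + ⁅ν, x⁆ + (2 : k)⁻¹ • ⁅ν, ⁅ν, x⁆⁆ := by
  have hn : IsNilpotent (ad k g ν) := R.ad_nilp hσ (R.Fil_mono σ (by omega) hν)
  obtain ⟨τ, hτ, h1, _⟩ := exists_exp ν hn
  have h2 : ∀ x, τ x = expEnd k g (ad k g ν) x := fun x => by rw [← h1]; rfl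
  refine ⟨τ, hτ, fun m y hy => ?_, fun x hx => ?_⟩
  · have hn' := hn
    obtain ⟨N, hN⟩ := hn'
    have h3 : ((ad k g ν) ^ (N + 2)) y = 0 := by rw [pow_add, hN, zero_mul]; rfl
    rw [h2, expEnd_apply hn h3, Finset.sum_range_succ', Finset.sum_range_succ']
    have : ∀ s a b : g, s + a + b - b - a = s := by intro s a b; abel
    simp only [zero_add, pow_zero, pow_one, Nat.factorial_zero, Nat.factorial_one, Nat.cast_one, inv_one,
      one_smul, Module.End.one_apply, ad_apply, this]
    refine Submodule.sum_mem _ fun i _ => Submodule.smul_mem _ _ ?_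
    refine R.Fil_mono σ ?_ (R.ad_pow_mem hν hy (i + 1 + 1))
    push_cast
    nlinarith [Int.natCast_nonneg i]
  · rw [h2, expEnd_apply hn (j := 3) (by simpa [pow_succ] using hx)]
    simp [Finset.sum_range_succ, pow_succ]

/-- the unipotent group -/
noncomputable def U : Subgroup (g ≃ₗ[k] g) where
  carrier := {u | u ∈ IntG k g ∧ ∀ m, ∀ y ∈ R.Fil 1 m, u y - y ∈ R.Fil 1 (m - 1)}
  one_mem' := ⟨one_mem _, fun m y hy => by simp⟩
  mul_mem' := by
    rintro a b ⟨ha, ha2⟩ ⟨hb, hb2⟩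
    refine ⟨mul_mem ha hb, fun m y hy => ?_⟩
    have h1 := hb2 m y hy
    have h2 := R.Fil_mono 1 (by omega : m - 1 - 1 ≤ m - 1) (ha2 _ _ h1)
    have h3 := add_mem (add_mem h2 h1) (ha2 m y hy)
    rw [LinearEquiv.mul_apply]
    convert h3 using 1
    rw [map_sub]; abel
  inv_mem' := by
    rintro a ⟨ha, ha2⟩
    refine ⟨inv_mem ha, fun m y hy => ?_⟩
    have key : ∀ l, ∀ z ∈ R.Fil 1 l, a⁻¹ z ∈ R.Fil 1 l := by
      intro l z hz
      have h3 : (R.Fil 1 l).map (a : g →ₗ[k] g) = R.Fil 1 l := by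
        apply Submodule.eq_of_le_of_finrank_eq
        · rintro _ ⟨x, hx, rfl⟩
          have := add_mem (R.Fil_mono 1 (by omega : l - 1 ≤ l) (ha2 l x hx)) hx
          simpa using this
        · exact LinearEquiv.finrank_map_eq a _
      rw [← h3] at hz
      obtain ⟨x, hx, rfl⟩ := hz
      simpa using hx
    have h1 := key _ _ (ha2 m y hy)
    rw [map_sub, inv_app] at h1
    rw [← neg_mem_iff]; simpa using h1

theorem exp_U {u : g ≃ₗ[k] g} (hu : u ∈ IntG k g) {p : ℤ} (hp : 1 ≤ p) {ν : g} (hν : ν ∈ R.Fil 1 (-p))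
    (h : ∀ m, ∀ y ∈ R.Fil 1 m, u y - y - ⁅ν, y⁆ ∈ R.Fil 1 (m - 2 * p)) : u ∈ R.U := by
  refine ⟨hu, fun m y hy => ?_⟩
  have h1 := R.Fil_mono 1 (by omega : m - 2 * p ≤ m - 1) (h m y hy)
  have h2 := R.Fil_mono 1 (by omega : -p + m ≤ m - 1) (R.lie_mem_Fil hν hy)
  simpa using add_mem h1 h2

theorem ht_of_hom {z : g} {c : k} (hz : ⁅R.rho, z⁆ = c • z) {b : I ⊕ Φ} (hb : R.B.repr z b ≠ 0) :
    (R.ht b : k) = c := by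
  have := R.repr_lie R.rho_mem z b
  rw [hz, al_rho, map_smul, Finsupp.smul_apply, smul_eq_mul] at this
  exact (mul_right_cancel₀ hb this).symm

theorem hom_zero {z : g} {j : ℤ} (hz : ⁅R.rho, z⁆ = (j : k) • z) (h : z ∈ R.Fil 1 (j - 1)) : z = 0 := by
  by_contra hne
  obtain ⟨b, hb⟩ := R.exists_repr_ne hne
  have h1 : R.ht b = j := by exact_mod_cast R.ht_of_hom hz hb
  have := h b hb
  omega

theorem hom_lie {y z : g} {i j : k} (hy : ⁅R.rho, y⁆ = i • y) (hz : ⁅R.rho, z⁆ = j • z) :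
    ⁅R.rho, ⁅y, z⁆⁆ = (i + j) • ⁅y, z⁆ := by
  rw [leibniz_lie, hy, hz, add_smul, smul_lie, lie_smul]

/-- `f e` injective on negative filtration -/
theorem FE_inj (p : ℤ) (hp : p ≤ -1) {v : g} (hv : v ∈ R.Fil 1 p) (h0 : ⁅R.FF, ⁅R.E, v⁆⁆ = 0) : v = 0 := by
  set N : Submodule k g := LinearMap.ker ((ad k g R.FF) ∘ₗ (ad k g R.E)) ⊓ R.Fil 1 p with hN
  have hmem : ∀ z, z ∈ N ↔ ⁅R.FF, ⁅R.E, z⁆⁆ = 0 ∧ z ∈ R.Fil 1 p := by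
    intro z; rw [hN]; simp
  have hinv : ∀ z ∈ N, ad k g R.rho z ∈ N := by
    intro z hz
    rw [hmem] at hz ⊢
    rw [ad_apply]
    constructor
    · have h1 : ⁅R.rho, ⁅R.FF, ⁅R.E, z⁆⁆⁆ = 0 := by rw [hz.1, lie_zero]
      rw [leibniz_lie, leibniz_lie R.rho R.E, lie_rho_E, lie_rho_FF, lie_add, neg_lie, hz.1] at h1
      simpa using h1
    · intro b hb
      apply hz.2
      intro h2
      apply hb
      rw [R.repr_lie R.rho_mem, h2, mul_zero]
  by_contra hne
  have : Nontrivial N := ⟨⟨⟨v, (hmem v).2 ⟨h0, hv⟩⟩, 0, fun h => hne (congrArg Subtype.val h)⟩⟩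
  obtain ⟨μ, hμ⟩ := Module.End.exists_eigenvalue (LinearMap.restrict (ad k g R.rho) hinv)
  obtain ⟨⟨y, hyN⟩, hy⟩ := hμ.exists_hasEigenvector
  have hy0 : y ≠ 0 := fun h => hy.2 (Subtype.ext h)
  have hy1 : ⁅R.rho, y⁆ = μ • y := congrArg Subtype.val hy.apply_eq_smul
  obtain ⟨b, hb⟩ := R.exists_repr_ne hy0
  have h1 := R.ht_of_hom hy1 hb
  rw [hmem] at hyN
  have h2 := hyN.2 b hb
  obtain ⟨n, hn⟩ := Int.eq_ofNat_of_zero_le (show 0 ≤ - R.ht b - 1 by omega)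
  apply hy0
  refine R.inj_neg n ?_ hyN.1
  rw [hy1, ← h1, show R.ht b = -(n + 1) by omega]; push_cast; rfl

theorem FE_mem {p : ℤ} {v : g} (hv : v ∈ R.Fil 1 p) : ⁅R.FF, ⁅R.E, v⁆⁆ ∈ R.Fil 1 p := by
  have := R.lie_mem_Fil R.FF_Fil (R.lie_mem_Fil R.E_Fil' hv)
  exact R.Fil_mono 1 (by omega) this

theorem decomp {p : ℤ} (hp : 0 ≤ p) {r : g} (hr : r ∈ R.Fil 1 (-p)) :
    ∃ ν ∈ R.Fil 1 (-(p + 1)), ⁅R.FF, r - ⁅R.E, ν⁆⁆ = 0 := by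
  set T : g →ₗ[k] g := (ad k g R.FF) ∘ₗ (ad k g R.E) with hT
  have hinv : ∀ z ∈ R.Fil 1 (-(p + 1)), T z ∈ R.Fil 1 (-(p + 1)) := fun z hz => R.FE_mem hz
  have hinj : Function.Injective (T.restrict hinv) := by
    rw [injective_iff_map_eq_zero]
    rintro ⟨z, hz⟩ h
    exact Subtype.ext (R.FE_inj _ (by omega) hz (congrArg Subtype.val h))
  have hsurj := LinearMap.injective_iff_surjective.1 hinj
  have hm : ⁅R.FF, r⁆ ∈ R.Fil 1 (-(p + 1)) := R.Fil_mono 1 (by omega) (R.lie_mem_Fil R.FF_Fil hr)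
  obtain ⟨⟨ν, hν⟩, h⟩ := hsurj ⟨_, hm⟩
  refine ⟨ν, hν, ?_⟩
  have : ⁅R.FF, ⁅R.E, ν⁆⁆ = ⁅R.FF, r⁆ := congrArg Subtype.val h
  rw [lie_sub, this, sub_self]

theorem slice_exists {x : g} (hx : x ∈ R.Fil 1 0) : ∃ u ∈ R.U, ∃ s ∈ R.Fil 1 0, ⁅R.FF, s⁆ = 0 ∧
    u (R.E + x) = R.E + s := by
  have key : ∀ p : ℕ, ∃ u ∈ R.U, ∃ s ∈ R.Fil 1 0, ⁅R.FF, s⁆ = 0 ∧ u (R.E + x) - (R.E + s) ∈ R.Fil 1 (-p) := by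
    intro p
    induction p with
    | zero => exact ⟨1, one_mem _, 0, zero_mem _, by simp, by simpa using hx⟩
    | succ p ih =>
      obtain ⟨u, hu, s, hs, hs2, hr⟩ := ih
      set r := u (R.E + x) - (R.E + s) with hrr
      obtain ⟨ν, hν, h1⟩ := R.decomp (by omega) hr
      obtain ⟨τ, hτ, h2, -⟩ := R.exists_exp4 (by simp) (by omega : (1 : ℤ) ≤ p + 1) hν
      have hEν : ⁅R.E, ν⁆ ∈ R.Fil 1 (-p) := R.Fil_mono 1 (by omega) (R.lie_mem_Fil R.E_Fil' hν)
      refine ⟨τ * u, mul_mem (R.exp_U hτ (by omega) hν h2) hu, s + (r - ⁅R.E, ν⁆),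
        add_mem hs (R.Fil_mono 1 (by omega) (sub_mem hr hEν)), by rw [lie_add, hs2, h1, add_zero], ?_⟩
      have h3 := h2 _ _ R.E_Fil'
      have h4 := R.exp_U hτ (by omega) hν h2
      have h5 : s + r ∈ R.Fil 1 0 := add_mem hs (R.Fil_mono 1 (by omega) hr)
      have h6 := h2 _ _ h5
      have h7 := R.lie_mem_Fil hν h5
      have h8 := add_mem (add_mem (R.Fil_mono 1 (by push_cast; omega : (1 : ℤ) - 2 * (p + 1) ≤ -((p + 1 : ℕ) : ℤ)) h3)
        (R.Fil_mono 1 (by push_cast; omega : (0 : ℤ) - 2 * (p + 1) ≤ -((p + 1 : ℕ) : ℤ)) h6))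
        (R.Fil_mono 1 (by push_cast; omega : (-((p : ℤ) + 1) + 0) ≤ -((p + 1 : ℕ) : ℤ)) h7)
      convert h8 using 1
      have h9 : u (R.E + x) = R.E + (s + r) := by rw [hrr]; abel
      rw [LinearEquiv.mul_apply, h9, map_add, ← lie_skew R.E ν]
      abel
  obtain ⟨u, hu, s, hs, hs2, hr⟩ := key R.M.toNat
  refine ⟨u, hu, s, hs, hs2, ?_⟩
  have := R.Fil_bot (by simp) (by rw [Int.toNat_of_nonneg R.M_pos.le]) hr
  exact sub_eq_zero.1 this

theorem reg_conj {x : g} (hx : R.Reg x) : ∃ u ∈ IntG k g, u (R.E + x) = x := by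
  have key : ∀ p : ℕ, ∃ u ∈ IntG k g, u (R.E + x) - x ∈ R.Fil (-1) (-(p + 1)) := by
    intro p
    induction p with
    | zero => exact ⟨1, one_mem _, by simpa using R.E_Fil⟩
    | succ p ih =>
      obtain ⟨u, hu, hr⟩ := ih
      set r := u (R.E + x) - x with hrr
      have hx0 : x ∈ R.Fil (-1) 0 := by
        intro b hb
        rcases b with i | a
        · simp [ht, wt]
        · exact absurd (R.mem_t_iff.1 hx.1 a) hb
      set ν : g := ∑ b, ((R.al (R.wt b) x)⁻¹ * R.B.repr r b) • R.B b with hν0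
      have hνr : ∀ b, R.B.repr ν b = (R.al (R.wt b) x)⁻¹ * R.B.repr r b := by
        intro b; rw [hν0, R.B.repr_sum_self]
      have hν : ν ∈ R.Fil (-1) (-(p + 1)) := by
        intro b hb
        apply hr
        intro h0
        rw [hνr, h0, mul_zero] at hb
        exact hb rfl
      have hνx : ⁅x, ν⁆ = r := by
        apply R.B.repr.injective
        ext b
        rw [R.repr_lie hx.1, hνr]
        rcases b with i | a
        · have : R.B.repr r (Sum.inl i) = 0 := by
            by_contra h
            have := hr _ h
            simp [ht, wt] at this
            omega
          rw [this]; simp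
        · rw [mul_inv_cancel_left₀]; exact hx.2 a
      obtain ⟨τ, hτ, h2, -⟩ := R.exists_exp4 (by simp) (by omega : (1 : ℤ) ≤ p + 1) hν
      refine ⟨τ * u, mul_mem hτ hu, ?_⟩
      have h3 := h2 _ _ hx0
      have h6 := h2 _ _ hr
      have h7 := R.lie_mem_Fil hν hr
      have h8 := add_mem (add_mem (R.Fil_mono (-1) (by push_cast; omega : (0 : ℤ) - 2 * (p + 1) ≤ -(((p + 1 : ℕ) : ℤ) + 1)) h3)
        (R.Fil_mono (-1) (by push_cast; omega : (-((p : ℤ) + 1) - 2 * (p + 1)) ≤ -(((p + 1 : ℕ) : ℤ) + 1)) h6))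
        (R.Fil_mono (-1) (by push_cast; omega : (-((p : ℤ) + 1) + (-(p + 1))) ≤ -(((p + 1 : ℕ) : ℤ) + 1)) h7)
      convert h8 using 1
      have h9 : u (R.E + x) = x + r := by rw [hrr]; abel
      rw [LinearEquiv.mul_apply, h9, map_add, ← lie_skew ν x, hνx]
      abel
  obtain ⟨u, hu, hr⟩ := key R.M.toNat
  refine ⟨u, hu, ?_⟩
  have := R.Fil_bot (by simp) (by rw [Int.toNat_of_nonneg R.M_pos.le]; omega) hr
  exact sub_eq_zero.1 this

theorem sig_U (i : I) {x : g} (hx : x ∈ R.t) : ∃ u ∈ R.U, u (R.E + x) = R.E + R.sig i x := by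
  set c := R.al (Pi.single i 1) x with hc
  have hν : c • R.F i ∈ R.Fil 1 (-1) := Submodule.smul_mem _ _ (R.F_Fil i)
  obtain ⟨τ, hτ, h2, h3⟩ := R.exists_exp4 (by simp) le_rfl hν
  refine ⟨τ, R.exp_U hτ le_rfl hν h2, ?_⟩
  have hE : ⁅R.F i, R.E⁆ = - R.h i := by
    rw [E, lie_sum, Finset.sum_eq_single i]
    · rw [← lie_skew, lie_eF]
    · intro j _ hj; rw [← lie_skew, R.lie_sF_ne hj, neg_zero]
    · simp
  have hX : ⁅R.F i, x⁆ = c • R.F i := by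
    rw [← lie_skew, R.lie_tF hx, neg_smul, neg_neg]
  have hH : ⁅R.F i, R.h i⁆ = (2 : k) • R.F i := by
    rw [← lie_skew, R.lie_tF (R.h_mem i), al_hi, neg_smul, neg_neg]
  have h4 : ⁅c • R.F i, R.E + x⁆ = (c * c) • R.F i - c • R.h i := by
    rw [smul_lie, lie_add, hE, hX, smul_add, smul_smul, smul_neg]; abel
  have h5 : ⁅c • R.F i, ⁅c • R.F i, R.E + x⁆⁆ = -(c * c * 2) • R.F i := by
    rw [h4, lie_sub, smul_lie, smul_lie, lie_smul, lie_smul, hH, lie_self, smul_smul, smul_smul]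
    simp [mul_assoc, smul_smul]
  rw [h3, h5, h4, R.sig_t i hx, ← hc, smul_smul]
  · have : (2 : k)⁻¹ * -(c * c * 2) = -(c * c) := by field_simp
    rw [this, neg_smul]; abel
  · rw [h5]; simp

theorem Wg_U {v : g ≃ₗ[k] g} (hv : v ∈ R.Wg) : ∀ x ∈ R.t, ∃ u ∈ R.U, u (R.E + x) = R.E + v x := by
  rw [Wg] at hv
  induction hv using Subgroup.closure_induction with
  | mem v h => obtain ⟨i, rfl⟩ := h; exact fun x hx => R.sig_U i hx
  | one => exact fun x hx => ⟨1, one_mem _, rfl⟩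
  | mul a b ha' hb' ha hb =>
    intro x hx
    obtain ⟨u, hu, h1⟩ := hb x hx
    obtain ⟨u', hu', h2⟩ := ha (b x) (((R.Wg_Nt hb').2 x).2 hx)
    exact ⟨u' * u, mul_mem hu' hu, by simp [h1, h2]⟩
  | inv a ha' ha =>
    intro x hx
    obtain ⟨u, hu, h1⟩ := ha (a⁻¹ x) ((((R.Wg_Nt ha').inv R).2 x).2 hx)
    refine ⟨u⁻¹, inv_mem hu, ?_⟩
    rw [app_inv] at h1
    rw [← h1, inv_app]

end RD
end GG
end CL

set_option linter.all false
set_option linter.unusedSimpArgs false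
set_option linter.unusedSectionVars false
namespace CL
section GG
open LieAlgebra Module
variable {k : Type*} [Field k] [IsAlgClosed k] [CharZero k]
variable {g : Type*} [LieRing g] [LieAlgebra k g] [FiniteDimensional k g]
  [LieAlgebra.IsSemisimple k g]
variable {I Φ : Type*} [Fintype I] [DecidableEq I] [Fintype Φ] [DecidableEq Φ]
namespace RD
variable (R : RD k g I Φ)

/-- projection to a height -/
noncomputable def pr (j : ℤ) : g →ₗ[k] g := R.B.constr k fun b => if R.ht b = j then R.B b else 0

theorem map_sum_repr (T : g →ₗ[k] g) (y : g) : T y = ∑ b, R.B.repr y b • T (R.B b) := by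
  conv_lhs => rw [← R.B.sum_repr y]
  rw [map_sum]; simp only [map_smul]

theorem pr_B (j : ℤ) (b : I ⊕ Φ) : R.pr j (R.B b) = if R.ht b = j then R.B b else 0 := by
  rw [pr, Basis.constr_basis]

theorem pr_hom (j : ℤ) (y : g) : ⁅R.rho, R.pr j y⁆ = (j : k) • R.pr j y := by
  rw [R.map_sum_repr (R.pr j) y, lie_sum, Finset.smul_sum]
  refine Finset.sum_congr rfl fun b _ => ?_
  rw [lie_smul, pr_B]
  split_ifs with h
  · rw [lie_rho_B, h, smul_comm]
  · simp

theorem pr_sub {j : ℤ} {y : g} (hy : y ∈ R.Fil 1 j) : y - R.pr j y ∈ R.Fil 1 (j - 1) := by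
  have := R.map_sum_repr (LinearMap.id - R.pr j) y
  simp only [LinearMap.sub_apply, LinearMap.id_apply] at this
  rw [this]
  refine Submodule.sum_mem _ fun b _ => ?_
  by_cases hb : R.B.repr y b = 0
  · rw [hb, zero_smul]; exact zero_mem _
  · refine Submodule.smul_mem _ _ ?_
    rw [pr_B]
    split_ifs with h
    · simp
    · rw [sub_zero]
      have := hy b hb
      exact R.B_mem_Fil (by omega)

/-- leading term -/
noncomputable def lead (u : g ≃ₗ[k] g) (q : ℤ) : g →ₗ[k] g :=
  R.B.constr k fun b => R.pr (R.ht b - q) (u (R.B b) - R.B b)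

theorem lead_B (u : g ≃ₗ[k] g) (q : ℤ) (b : I ⊕ Φ) :
    R.lead u q (R.B b) = R.pr (R.ht b - q) (u (R.B b) - R.B b) := by
  rw [lead, Basis.constr_basis]

theorem lead_hom (u : g ≃ₗ[k] g) (q : ℤ) {y : g} {j : ℤ} (hy : ⁅R.rho, y⁆ = (j : k) • y) :
    ⁅R.rho, R.lead u q y⁆ = ((j - q : ℤ) : k) • R.lead u q y := by
  rw [R.map_sum_repr (R.lead u q) y, lie_sum, Finset.smul_sum]
  refine Finset.sum_congr rfl fun b _ => ?_
  by_cases hb : R.B.repr y b = 0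
  · rw [hb, zero_smul, lie_zero, smul_zero]
  · have h1 : R.ht b = j := by exact_mod_cast R.ht_of_hom hy hb
    rw [lie_smul, lead_B, pr_hom, h1, smul_comm]

theorem lead_app {u : g ≃ₗ[k] g} {q : ℤ} (H : ∀ m, ∀ y ∈ R.Fil 1 m, u y - y ∈ R.Fil 1 (m - q))
    {m : ℤ} {y : g} (hy : y ∈ R.Fil 1 m) : u y - y - R.lead u q y ∈ R.Fil 1 (m - q - 1) := by
  have := R.map_sum_repr ((u : g →ₗ[k] g) - LinearMap.id - R.lead u q) y
  simp only [LinearMap.sub_apply, LinearMap.id_apply, LinearEquiv.coe_coe] at this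
  rw [this]
  refine Submodule.sum_mem _ fun b _ => ?_
  by_cases hb : R.B.repr y b = 0
  · rw [hb, zero_smul]; exact zero_mem _
  · refine Submodule.smul_mem _ _ ?_
    have h1 := hy b hb
    rw [lead_B]
    refine R.Fil_mono 1 ?_ (R.pr_sub (H (R.ht b) _ (R.B_mem_Fil (by omega))))
    omega

theorem lead_der {u : g ≃ₗ[k] g} (hu : u ∈ LA k g) {q : ℤ} (hq : 1 ≤ q)
    (H : ∀ m, ∀ y ∈ R.Fil 1 m, u y - y ∈ R.Fil 1 (m - q)) (x y : g) :
    R.lead u q ⁅x, y⁆ = ⁅x, R.lead u q y⁆ - ⁅y, R.lead u q x⁆ := by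
  have key : ∀ b c, R.lead u q ⁅R.B b, R.B c⁆ = ⁅R.B b, R.lead u q (R.B c)⁆ - ⁅R.B c, R.lead u q (R.B b)⁆ := by
    intro b c
    have hb := R.lie_rho_B b
    have hc := R.lie_rho_B c
    have hbc := R.hom_lie hb hc
    rw [← Int.cast_add] at hbc
    have hbF : R.B b ∈ R.Fil 1 (R.ht b) := R.B_mem_Fil (by omega)
    have hcF : R.B c ∈ R.Fil 1 (R.ht c) := R.B_mem_Fil (by omega)
    have hlb := R.lead_hom u q hb
    have hlc := R.lead_hom u q hc
    rw [← sub_eq_zero]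
    apply R.hom_zero (j := R.ht b + R.ht c - q)
    · rw [lie_sub, lie_sub, R.lead_hom u q hbc, R.hom_lie hb hlc, R.hom_lie hc hlb, smul_sub, smul_sub]
      push_cast
      congr 2 <;> congr 1 <;> ring
    · have h1 := R.lead_app H (R.lie_mem_Fil hbF hcF)
      have h2 := R.Fil_mono 1 (by omega : (R.ht b - q) + (R.ht c - q) ≤ R.ht b + R.ht c - q - 1)
        (R.lie_mem_Fil (H _ _ hbF) (H _ _ hcF))
      have h3 := R.Fil_mono 1 (by omega : R.ht b + (R.ht c - q - 1) ≤ R.ht b + R.ht c - q - 1)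
        (R.lie_mem_Fil hbF (R.lead_app H hcF))
      have h4 := R.Fil_mono 1 (by omega : R.ht c + (R.ht b - q - 1) ≤ R.ht b + R.ht c - q - 1)
        (R.lie_mem_Fil hcF (R.lead_app H hbF))
      have h5 := sub_mem (sub_mem (add_mem h2 h3) h4) h1
      convert h5 using 1
      rw [LA.map_lie hu]
      simp only [lie_sub, sub_lie]
      rw [← lie_skew (u (R.B b)) (R.B c), ← lie_skew (R.B b) (R.B c)]
      abel
  have h1 : ∀ b, R.lead u q ⁅R.B b, y⁆ = ⁅R.B b, R.lead u q y⁆ - ⁅y, R.lead u q (R.B b)⁆ := by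
    intro b
    conv_lhs => rw [← R.B.sum_repr y]
    conv_rhs => rw [← R.B.sum_repr y]
    simp only [lie_sum, sum_lie, map_sum, lie_smul, smul_lie, map_smul, key, smul_sub, Finset.sum_sub_distrib]
  conv_lhs => rw [← R.B.sum_repr x]
  conv_rhs => rw [← R.B.sum_repr x]
  simp only [lie_sum, sum_lie, map_sum, lie_smul, smul_lie, map_smul, h1, smul_sub, Finset.sum_sub_distrib]

theorem exists_lead {u : g ≃ₗ[k] g} (hu : u ∈ LA k g) {q : ℤ} (hq : 1 ≤ q)
    (H : ∀ m, ∀ y ∈ R.Fil 1 m, u y - y ∈ R.Fil 1 (m - q)) :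
    ∃ ν : g, (∀ y, R.lead u q y = ⁅ν, y⁆) ∧ ⁅R.rho, ν⁆ = ((-q : ℤ) : k) • ν := by
  haveI : LieAlgebra.IsKilling k g := inferInstance
  obtain ⟨ν, hν⟩ := LieDerivation.IsKilling.exists_eq_ad (R := k) (L := g)
    ({ toLinearMap := R.lead u q, leibniz' := R.lead_der hu hq H } : LieDerivation k g g)
  have hν2 : ∀ y, R.lead u q y = ⁅ν, y⁆ := by
    intro y
    have := congrArg (fun D : LieDerivation k g g => D y) hν
    simp only [LieDerivation.ad_apply_apply] at this
    rw [this]; rfl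
  refine ⟨ν, hν2, ?_⟩
  rw [← sub_eq_zero]
  set z := ⁅R.rho, ν⁆ - ((-q : ℤ) : k) • ν with hz
  have h1 : ∀ y : g, ⁅z, y⁆ = 0 := by
    intro y
    have h2 : ∀ b, ⁅z, R.B b⁆ = 0 := by
      intro b
      have h3 := R.lead_hom u q (R.lie_rho_B b)
      rw [hν2, leibniz_lie, lie_rho_B, lie_smul] at h3
      rw [hz, sub_lie, smul_lie]
      have h4 := eq_sub_of_add_eq h3
      rw [h4, ← sub_smul, ← sub_smul]
      push_cast
      ring_nf
      simp
    rw [← R.B.sum_repr y, lie_sum]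
    exact Finset.sum_eq_zero fun b _ => by rw [lie_smul, h2, smul_zero]
  have h5 : z ∈ LieAlgebra.center k g := by
    rw [LieModule.mem_maxTrivSubmodule]
    intro y; rw [← lie_skew, h1, neg_zero]
  rw [LieAlgebra.center_eq_bot] at h5
  simpa using h5

theorem slice_unique {u : g ≃ₗ[k] g} (hu : u ∈ R.U) {s s' : g} (hs : s ∈ R.Fil 1 0)
    (hF : ⁅R.FF, s⁆ = 0) (hF' : ⁅R.FF, s'⁆ = 0) (h : u (R.E + s) = R.E + s') : s' = s := by
  have key : ∀ p : ℕ, ∀ m, ∀ y ∈ R.Fil 1 m, u y - y ∈ R.Fil 1 (m - (p + 1)) := by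
    intro p
    induction p with
    | zero => simpa using hu.2
    | succ p ih =>
      obtain ⟨ν, h1, h2⟩ := R.exists_lead (IntG_le_LA hu.1) (by omega) ih
      have hν : ν = 0 := by
        refine R.inj_neg p (by rw [h2]; push_cast; rfl) ?_
        apply R.hom_zero (j := -(p + 1))
        · have hE : ⁅R.rho, R.E⁆ = (1 : k) • R.E := by rw [lie_rho_E, one_smul]
          have hFF : ⁅R.rho, R.FF⁆ = (-1 : k) • R.FF := by rw [lie_rho_FF]; simp
          rw [R.hom_lie hFF (R.hom_lie hE h2)]
          congr 1; push_cast; ring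
        · have h3 := R.lead_app ih R.E_Fil'
          have h4 := ih _ _ hs
          rw [h1] at h3
          have h5 := R.lie_mem_Fil R.FF_Fil (add_mem (R.Fil_mono 1 (by omega : (1 : ℤ) - (p + 1) - 1 ≤ -(p + 1)) h3)
            (R.Fil_mono 1 (by omega : (0 : ℤ) - (p + 1) ≤ -(p + 1)) h4))
          have h6 : u R.E - R.E - ⁅ν, R.E⁆ + (u s - s) = s' - s + ⁅R.E, ν⁆ := by
            rw [map_add] at h
            rw [← lie_skew ν R.E]
            have : u R.E = R.E + s' - u s := by rw [← h]; abel
            rw [this]; abel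
          rw [h6, lie_add, lie_sub, hF, hF'] at h5
          refine R.Fil_mono 1 ?_ (by simpa using h5)
          omega
      intro m y hy
      have h3 := R.lead_app ih hy
      rw [h1, hν, zero_lie, sub_zero] at h3
      exact R.Fil_mono 1 (by push_cast; omega) h3
  have h1 : ∀ y, u y = y := by
    intro y
    have := key (2 * R.M).toNat _ y (R.Fil_top (by simp) y)
    exact sub_eq_zero.1 (R.Fil_bot (by simp) (by have := R.M_pos; rw [Int.toNat_of_nonneg (by omega)]; omega) this)
  rw [h1] at h
  exact (add_left_cancel h).symm

end RD
end GG
end CL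

set_option linter.all false
set_option linter.unusedSimpArgs false
set_option linter.unusedSectionVars false
namespace CL
section GG
open LieAlgebra Module
variable {k : Type*} [Field k] [IsAlgClosed k] [CharZero k]
variable {g : Type*} [LieRing g] [LieAlgebra k g] [FiniteDimensional k g]
  [LieAlgebra.IsSemisimple k g]
variable {I Φ : Type*} [Fintype I] [DecidableEq I] [Fintype Φ] [DecidableEq Φ]
namespace RD
variable (R : RD k g I Φ)

theorem Fil_rho {φ : g ≃ₗ[k] g} (hφ : φ ∈ LA k g) (hρ : φ R.rho = R.rho) {m : ℤ} {y : g}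
    (hy : y ∈ R.Fil 1 m) : φ y ∈ R.Fil 1 m := by
  have h0 : φ y = ∑ b, R.B.repr y b • φ (R.B b) := R.map_sum_repr (φ : g →ₗ[k] g) y
  rw [h0]
  refine Submodule.sum_mem _ fun b _ => ?_
  by_cases hb : R.B.repr y b = 0
  · rw [hb, zero_smul]; exact zero_mem _
  refine Submodule.smul_mem _ _ fun c hc => ?_
  have h1 := LA.map_lie hφ R.rho (R.B b)
  rw [hρ, lie_rho_B, map_smul] at h1
  have h2 : R.ht c = R.ht b := by exact_mod_cast R.ht_of_hom h1.symm hc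
  rw [h2]; exact hy b hb

theorem U_conj {φ : g ≃ₗ[k] g} (hφ : φ ∈ LA k g) (hρ : φ R.rho = R.rho) {u : g ≃ₗ[k] g}
    (hu : u ∈ R.U) : φ * u * φ⁻¹ ∈ R.U := by
  refine ⟨IntG_conj hφ hu.1, fun m y hy => ?_⟩
  have hρ' : φ⁻¹ R.rho = R.rho := by conv_lhs => rw [← hρ, inv_app]
  have h1 := R.Fil_rho hφ hρ (hu.2 _ _ (R.Fil_rho (inv_mem hφ) hρ' hy))
  rw [map_sub, app_inv] at h1
  simpa using h1

theorem Nt_of_eig {θ : g ≃ₗ[k] g} (hθ : θ ∈ LA k g) {x : g} (hx : R.Reg x) {ζ : k} (hζ : ζ ≠ 0)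
    (h : θ x = ζ • x) : R.Nt θ := by
  apply R.Nt_of hθ
  intro y hy
  rw [← hx.zc, zc, LinearMap.mem_ker, ad_apply]
  have h1 := LA.map_lie hθ x y
  rw [R.lie_t_t hx.1 hy, map_zero, h, smul_lie] at h1
  exact (smul_eq_zero.1 h1.symm).resolve_left hζ

theorem main_lemma {θ₀ θ : g ≃ₗ[k] g} {ζ : k} (hζ : ζ ≠ 0) (h0 : R.Nt θ₀) (h0E : θ₀ R.E = ζ • R.E)
    (h0ρ : θ₀ R.rho = R.rho) (hθ : θ ∈ LA k g) (hG : θ * θ₀⁻¹ ∈ IntG k g) {x : g} (hx : R.Reg x)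
    (hθx : θ x = ζ • x) (hfix : ∀ y ∈ R.t, θ y = y → y = 0) :
    ∃ τ ∈ IntG k g, θ = τ * θ₀ * τ⁻¹ := by
  have hN := R.Nt_of_eig hθ hx hζ hθx
  have hFF : θ₀ R.FF = ζ⁻¹ • R.FF := by
    have h1 := LA.map_lie h0.1 R.E R.FF
    rw [lie_E_FF, h0ρ, h0E, smul_lie] at h1
    have h2 := LA.map_lie h0.1 R.rho R.FF
    rw [lie_rho_FF, h0ρ, map_neg] at h2
    have h3 : ζ • θ₀ R.FF - R.FF = 0 := by
      refine R.inj_neg 0 ?_ ?_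
      · rw [lie_sub, lie_smul, ← h2, lie_rho_FF]; simp; abel
      · have : ⁅R.E, ζ • θ₀ R.FF - R.FF⁆ = 0 := by
          rw [lie_sub, lie_smul, ← h1, lie_E_FF, sub_self]
        rw [this, lie_zero]
    have h4 := sub_eq_zero.1 h3
    calc θ₀ R.FF = ζ⁻¹ • (ζ • θ₀ R.FF) := by rw [smul_smul, inv_mul_cancel₀ hζ, one_smul]
      _ = _ := by rw [h4]
  set a := θ * θ₀⁻¹ with ha
  have haN : R.Nt a⁻¹ := (hN.mul R (h0.inv R)).inv R
  obtain ⟨v, hv, hva⟩ := R.exists_Wg (inv_mem hG) haN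
  obtain ⟨w, hw, hw2⟩ := R.Wg_U hv x hx.1
  have h0x : θ₀ x = ζ • v x := by
    have : θ₀ = a⁻¹ * θ := by rw [ha]; group
    rw [← hva x hx.1, this, LinearEquiv.mul_apply, hθx, map_smul]
  have hx0 : x ∈ R.Fil 1 0 := by
    intro b hb
    rcases b with i | a
    · simp [ht, wt]
    · exact absurd (R.mem_t_iff.1 hx.1 a) hb
  obtain ⟨n', hn', s, hs, hs2, hy⟩ := R.slice_exists hx0
  have h0y : θ₀ (R.E + s) = ζ • ((θ₀ * n' * θ₀⁻¹) * w * n'⁻¹) (R.E + s) := by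
    simp only [LinearEquiv.mul_apply]
    rw [← hy, inv_app, hw2, ← map_smul, ← map_smul, ← map_smul]
    congr 2
    apply θ₀.injective
    rw [app_inv, map_add, h0E, h0x, smul_add]
  have hs' : ζ⁻¹ • θ₀ s = s := by
    refine R.slice_unique (mul_mem (mul_mem (R.U_conj h0.1 h0ρ hn') hw) (inv_mem hn')) hs hs2 ?_ ?_
    · have h1 := LA.map_lie h0.1 R.FF s
      rw [hs2, map_zero, hFF, smul_lie] at h1
      rw [lie_smul, ← h1]
    · have h1 : R.E + ζ⁻¹ • θ₀ s = ζ⁻¹ • θ₀ (R.E + s) := by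
        rw [map_add, h0E, smul_add, smul_smul, inv_mul_cancel₀ hζ, one_smul]
      rw [h1, h0y, smul_smul, inv_mul_cancel₀ hζ, one_smul]
  have hyz : θ₀ (R.E + s) = ζ • (R.E + s) := by
    rw [map_add, h0E, smul_add]
    conv_rhs => rw [← hs']
    rw [smul_smul, mul_inv_cancel₀ hζ, one_smul]
  obtain ⟨u₁, hu₁, hu₂⟩ := R.reg_conj hx
  set b := n' * u₁⁻¹ with hb
  have hbG : b ∈ IntG k g := mul_mem hn'.1 (inv_mem hu₁)
  have hbx : b x = R.E + s := by
    rw [hb, LinearEquiv.mul_apply, ← hy]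
    conv_lhs => rw [← hu₂, inv_app]
  set φ := b⁻¹ * θ₀ * b with hφ
  have hφx : φ x = ζ • x := by
    simp only [hφ, LinearEquiv.mul_apply]
    rw [hbx, hyz, map_smul, ← hbx, inv_app]
  have hφL : φ ∈ LA k g := mul_mem (mul_mem (inv_mem (IntG_le_LA hbG)) h0.1) (IntG_le_LA hbG)
  set c := θ * φ⁻¹ with hc
  have hcG : c ∈ IntG k g := by
    have : c = a * (θ₀ * b⁻¹ * θ₀⁻¹) * b := by rw [hc, hφ, ha]; group
    rw [this]
    exact mul_mem (mul_mem hG (IntG_conj h0.1 (inv_mem hbG))) hbG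
  have hφx' : φ⁻¹ x = ζ⁻¹ • x := by
    apply φ.injective
    rw [app_inv, map_smul, hφx, smul_smul, inv_mul_cancel₀ hζ, one_smul]
  have hcx : c x = x := by
    rw [hc, LinearEquiv.mul_apply, hφx', map_smul, hθx, smul_smul, inv_mul_cancel₀ hζ, one_smul]
  have hct := R.free_of_reg hcG hx hcx
  have hcθ : c * φ = θ := by rw [hc]; group
  obtain ⟨s₁, hs₁, h2⟩ := R.step4 (R.Nt_of_eig hφL hx hζ hφx) (c := c) (fun y hy hyy => by
    apply hfix y hy
    rw [← hcθ, LinearEquiv.mul_apply, hyy, hct y hy]) (IntG_le_LA hcG) hct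
  refine ⟨s₁ * b⁻¹, mul_mem hs₁ (inv_mem hbG), ?_⟩
  rw [← hcθ, ← h2, hφ]; group

theorem exists_pinned {θ : g ≃ₗ[k] g} (hN : R.Nt θ) {ζ : k} (hζ : ζ ≠ 0) : ∃ θ₀, R.Nt θ₀ ∧
    θ₀ R.E = ζ • R.E ∧ θ₀ R.rho = R.rho ∧ θ₀ * θ⁻¹ ∈ IntG k g := by
  obtain ⟨v, hv, π, d, hd, hd2, hπ, hp⟩ := R.exists_PosP hN
  have hφN : R.Nt (v * θ) := (R.Wg_Nt hv).mul R hN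
  obtain ⟨σ, hσ, -⟩ := perm_simple hφN hπ hp
  set γ : I → kˣ := fun j => Units.mk0 (ζ / d (R.s (σ.symm j))) (div_ne_zero hζ (hd _)) with hγ
  have ht : ∀ x ∈ R.t, R.tor γ ((v * θ) x) = (v * θ) x := fun x hx => R.tor_t γ ((hφN.2 x).2 hx)
  have hN0 : R.Nt (R.tor γ * (v * θ)) := (R.Nt_of (R.tor_LA γ) fun x hx => by rwa [R.tor_t γ hx]).mul R hφN
  refine ⟨R.tor γ * (v * θ), hN0, ?_, ?_, ?_⟩
  · rw [E, map_sum, Finset.smul_sum, ← Equiv.sum_comp σ (fun i => ζ • R.e (R.s i))]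
    refine Finset.sum_congr rfl fun i _ => ?_
    rw [LinearEquiv.mul_apply, hd2, map_smul, hσ, tor_e, R.n_s, chi_single, smul_smul]
    congr 1
    simp only [hγ, Units.val_mk0, Equiv.symm_apply_apply]
    field_simp [hd (R.s i)]
  · apply R.t_ext ((hN0.2 _).2 R.rho_mem) R.rho_mem
    intro j
    obtain ⟨i, rfl⟩ := σ.surjective j
    have h1 := hπ (R.s i) _ R.rho_mem
    rw [hσ, R.n_s, R.n_s] at h1
    rw [LinearEquiv.mul_apply, ht _ R.rho_mem, h1]
    simp [rho, al_w, Pi.single_apply]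
  · have : R.tor γ * (v * θ) * θ⁻¹ = R.tor γ * v := by group
    rw [this]; exact mul_mem (R.tor_mem γ) (R.Wg_le hv)

end RD

theorem final {ζ : k} (hζ : ζ ≠ 0) {θ₁ θ₂ : g ≃ₗ[k] g} (hb₁ : θ₁ ∈ LA k g) (hb₂ : θ₂ ∈ LA k g)
    (hinner : θ₁ * θ₂⁻¹ ∈ IntG k g) {x₁ x₂ : g} (hr₁ : IsRegular k x₁) (hr₂ : IsRegular k x₂)
    (hx₁ : θ₁ x₁ = ζ • x₁) (hx₂ : θ₂ x₂ = ζ • x₂) (hf₁ : ∀ y ∈ zc k g x₁, θ₁ y = y → y = 0)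
    (hf₂ : ∀ y ∈ zc k g x₂, θ₂ y = y → y = 0) : ∃ τ ∈ IntG k g, θ₁ = τ * θ₂ * τ⁻¹ := by
  obtain ⟨I, Φ, _, _, _, _, R, hR⟩ := exists_RD_regular hr₁
  obtain ⟨I', Φ', _, _, _, _, R', hR'⟩ := exists_RD_regular hr₂
  obtain ⟨b, hb, hbt⟩ := RD.cartan_conj R R'
  have hreg₁ := R.Reg_of_zc hR
  obtain ⟨θ₀, hN0, hE0, hρ0, hG0⟩ := R.exists_pinned (R.Nt_of_eig hb₁ hreg₁ hζ hx₁) hζ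
  have hbL := IntG_le_LA hb
  have hreg₂ : R.Reg (b x₂) := by
    apply R.Reg_of_zc
    ext z
    have h1 := hbt (b⁻¹ z)
    rw [app_inv] at h1
    rw [← h1, ← hR', zc, zc, LinearMap.mem_ker, LinearMap.mem_ker, ad_apply, ad_apply]
    have h2 := LA.map_lie hbL x₂ (b⁻¹ z)
    rw [app_inv] at h2
    rw [← h2, LinearEquiv.map_eq_zero_iff]
  have hG1 : θ₁ * θ₀⁻¹ ∈ IntG k g := by
    have := inv_mem hG0
    rwa [mul_inv_rev, inv_inv] at this
  have hG2 : (b * θ₂ * b⁻¹) * θ₀⁻¹ ∈ IntG k g := by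
    have : (b * θ₂ * b⁻¹) * θ₀⁻¹ = b * (θ₂ * b⁻¹ * θ₂⁻¹) * (θ₁ * θ₂⁻¹)⁻¹ * (θ₁ * θ₀⁻¹) := by group
    rw [this]
    exact mul_mem (mul_mem (mul_mem hb (IntG_conj hb₂ (inv_mem hb))) (inv_mem hinner)) hG1
  obtain ⟨τ₁, hτ₁, h1⟩ := R.main_lemma hζ hN0 hE0 hρ0 hb₁ hG1 hreg₁ hx₁ (by rw [← hR]; exact hf₁)
  obtain ⟨τ₂, hτ₂, h2⟩ := R.main_lemma hζ hN0 hE0 hρ0 (mul_mem (mul_mem hbL hb₂) (inv_mem hbL)) hG2 hreg₂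
    (by simp only [LinearEquiv.mul_apply]; rw [inv_app, hx₂, map_smul]) (by
      intro y hy hyy
      simp only [LinearEquiv.mul_apply] at hyy
      have h3 : b⁻¹ y ∈ zc k g x₂ := by rw [hR', hbt, app_inv]; exact hy
      have h4 : θ₂ (b⁻¹ y) = b⁻¹ y := by
        apply b.injective
        rw [hyy, app_inv]
      have h5 := hf₂ _ h3 h4
      simpa using congrArg b h5)
  refine ⟨τ₁ * τ₂⁻¹ * b, mul_mem (mul_mem hτ₁ (inv_mem hτ₂)) hb, ?_⟩
  have h3 : θ₀ = τ₂⁻¹ * (b * θ₂ * b⁻¹) * τ₂ := by rw [h2]; group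
  rw [h1, h3]; group

end GG
end CL


open LieAlgebra Module

namespace CL
section GG
variable {k : Type*} [Field k] [IsAlgClosed k] [CharZero k]
variable {g : Type*} [LieRing g] [LieAlgebra k g] [FiniteDimensional k g]
  [LieAlgebra.IsSemisimple k g]

theorem mem_gp_zero {m : ℕ} {ζ : k} {θ : g ≃ₗ[k] g} {x : g} (h : θ x = x) :
    x ∈ gradePiece k g ζ θ (0 : ZMod m) := by
  unfold gradePiece
  rw [Module.End.mem_eigenspace_iff, ZMod.val_zero, pow_zero, one_smul]
  exact h

theorem mem_gp_one {m : ℕ} (hm : 1 ≤ m) {ζ : k} (hζ : IsPrimitiveRoot ζ m)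
    {θ : g ≃ₗ[k] g} {x : g} (h : x ∈ gradePiece k g ζ θ (1 : ZMod m)) : θ x = ζ • x := by
  unfold gradePiece at h
  rw [Module.End.mem_eigenspace_iff] at h
  have h1 : ζ ^ (1 : ZMod m).val = ζ := by
    rcases hm.lt_or_eq with h2 | h2
    · haveI : Fact (1 < m) := ⟨h2⟩
      rw [ZMod.val_one, pow_one]
    · subst h2
      have : ζ = 1 := by simpa using hζ.pow_eq_one
      rw [this, one_pow]
  rw [h1] at h
  exact h

end GG
end CL

theorem conj_of_sRegular_locallyFree
    (m : ℕ) (hm : 1 ≤ m) (ζ : k) (hζ : IsPrimitiveRoot ζ m)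
    (θ₁ θ₂ : g ≃ₗ[k] g)
    (hb₁ : ∀ x y : g, θ₁ ⁅x, y⁆ = ⁅θ₁ x, θ₁ y⁆)
    (hb₂ : ∀ x y : g, θ₂ ⁅x, y⁆ = ⁅θ₂ x, θ₂ y⁆)
    (ho₁ : orderOf θ₁ = m) (ho₂ : orderOf θ₂ = m)
    (hinner : θ₁ * θ₂⁻¹ ∈ IntG k g)
    (hS₁ : ∃ x ∈ gradePiece k g ζ θ₁ (1 : ZMod m), (LieAlgebra.ad k g x).IsSemisimple ∧
      Module.finrank k (zc k g x) = LieAlgebra.rank k g)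
    (hS₂ : ∃ x ∈ gradePiece k g ζ θ₂ (1 : ZMod m), (LieAlgebra.ad k g x).IsSemisimple ∧
      Module.finrank k (zc k g x) = LieAlgebra.rank k g)
    (hLF₁ : ∃ x ∈ gradePiece k g ζ θ₁ (1 : ZMod m),
      zc k g x ⊓ gradePiece k g ζ θ₁ (0 : ZMod m) = ⊥)
    (hLF₂ : ∃ x ∈ gradePiece k g ζ θ₂ (1 : ZMod m),
      zc k g x ⊓ gradePiece k g ζ θ₂ (0 : ZMod m) = ⊥) :
    ∃ τ ∈ IntG k g, θ₁ = τ * θ₂ * τ⁻¹ := by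
  obtain ⟨x₁, hx₁, hr₁, hf₁⟩ := CL.step0 _ _ hS₁ hLF₁
  obtain ⟨x₂, hx₂, hr₂, hf₂⟩ := CL.step0 _ _ hS₂ hLF₂
  have h0 : ζ ≠ 0 := hζ.ne_zero (by omega)
  refine CL.final h0 hb₁ hb₂ hinner hr₁ hr₂ (CL.mem_gp_one hm hζ hx₁) (CL.mem_gp_one hm hζ hx₂)
    ?_ ?_
  · intro y hy h
    have : y ∈ zc k g x₁ ⊓ gradePiece k g ζ θ₁ (0 : ZMod m) := ⟨hy, CL.mem_gp_zero h⟩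
    rw [hf₁] at this
    simpa using this
  · intro y hy h
    have : y ∈ zc k g x₂ ⊓ gradePiece k g ζ θ₂ (0 : ZMod m) := ⟨hy, CL.mem_gp_zero h⟩
    rw [hf₂] at this
    simpa using this
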